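/- Let k be a finite field of characteristic p. Then the class of Frobenius traces realized by elliptic curves over k includes 1; i.e., there exists an elliptic curve E over k with #E(k) = #k, equivalently with trace of Frobenius equal to 1, and any such curve is ordinary. -/

import Mathlib

/-- The values of the `x`-coordinate on the group of points of an elliptic curve over an
algebraically closed field, together with the coefficients that govern the group law. -/
structure KummerModel (G K : Type*) [AddCommGroup G] [Field K] where
  /-- the `x`-coordinate (its value at `0` is irrelevant) -/
  x : G → K
  /-- the coefficient `b₂` -/
  b2 : K
  /-- the coefficient `b₄` -/
  b4 : K
  /-- the coefficient `b₆` -/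
  b6 : K
  /-- the coefficient `b₈` -/
  b8 : K
  rel : 4 * b8 = b2 * b6 - b4 ^ 2
  disc : -b2 ^ 2 * b8 - 8 * b4 ^ 3 - 27 * b6 ^ 2 + 9 * b2 * b4 * b6 ≠ 0
  x_eq : ∀ P S, P ≠ 0 → S ≠ 0 → (x P = x S ↔ P = S ∨ P = -S)
  surj : ∀ c, ∃ P, P ≠ 0 ∧ x P = c
  sum_eq : ∀ P S, P ≠ 0 → S ≠ 0 → P + S ≠ 0 → P - S ≠ 0 →
    (x P - x S) ^ 2 * (x (P + S) + x (P - S)) =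
      2 * x P * x S * (x P + x S) + b2 * (x P * x S) + b4 * (x P + x S) + b6
  prod_eq : ∀ P S, P ≠ 0 → S ≠ 0 → P + S ≠ 0 → P - S ≠ 0 →
    (x P - x S) ^ 2 * (x (P + S) * x (P - S)) =
      (x P * x S) ^ 2 - b4 * (x P * x S) - b6 * (x P + x S) - b8
  dup : ∀ P, P + P ≠ 0 → (4 * x P ^ 3 + b2 * x P ^ 2 + 2 * b4 * x P + b6) * x (P + P) =
    x P ^ 4 - b4 * x P ^ 2 - 2 * b6 * x P - b8
  two_tors : ∀ P, P ≠ 0 → P + P = 0 → 4 * x P ^ 3 + b2 * x P ^ 2 + 2 * b4 * x P + b6 = 0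

namespace KummerModel

variable {G K : Type*} [AddCommGroup G] [Field K]

/-- The discriminant. -/
def Δ (D : KummerModel G K) : K :=
  -D.b2 ^ 2 * D.b8 - 8 * D.b4 ^ 3 - 27 * D.b6 ^ 2 + 9 * D.b2 * D.b4 * D.b6

/-- The cubic polynomial whose roots are the `x`-coordinates of the points of order two. -/
def psi (D : KummerModel G K) (X : K) : K := 4 * X ^ 3 + D.b2 * X ^ 2 + 2 * D.b4 * X + D.b6

/-- The numerator of the duplication formula. -/
def phi (D : KummerModel G K) (X : K) : K := X ^ 4 - D.b4 * X ^ 2 - 2 * D.b6 * X - D.b8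

/-- The numerator of `x (P + S) + x (P - S)`. -/
def sumForm (D : KummerModel G K) (X Y : K) : K :=
  2 * X * Y * (X + Y) + D.b2 * (X * Y) + D.b4 * (X + Y) + D.b6

/-- The numerator of `x (P + S) * x (P - S)`. -/
def prodForm (D : KummerModel G K) (X Y : K) : K :=
  (X * Y) ^ 2 - D.b4 * (X * Y) - D.b6 * (X + Y) - D.b8

variable (D : KummerModel G K)

lemma Δ_ne : D.Δ ≠ 0 := D.disc

lemma x_neg (P : G) : D.x (-P) = D.x P := by
  by_cases h : P = 0
  · simp [h]
  · exact (D.x_eq _ _ (neg_ne_zero.2 h) h).2 (Or.inr rfl)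

lemma psi_eq_zero_iff {P : G} (h : P ≠ 0) : D.psi (D.x P) = 0 ↔ P + P = 0 := by
  refine ⟨fun h0 => ?_, D.two_tors P h⟩
  by_contra h2
  have h1 := D.dup P h2
  have h3 : D.phi (D.x P) = 0 := by
    rw [phi, ← h1]; unfold psi at h0; rw [h0, zero_mul]
  refine D.disc ?_
  have rel := D.rel
  unfold psi at h0
  unfold phi at h3
  generalize D.x P = X at *
  linear_combination (-12*X^3 + D.b2*X^2 + 10*D.b4*X + 27*D.b6 - D.b2*D.b4) * (-h0) + (-(48*X^2+8*D.b2*X + 32*D.b4 - D.b2^2)) * h3 -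
    (12 * X ^ 2 + 2 * D.b2 * X + 8 * D.b4) * rel

lemma sum_eq' {P S : G} (hP : P ≠ 0) (hS : S ≠ 0) (h₁ : P + S ≠ 0) (h₂ : P - S ≠ 0) :
    (D.x P - D.x S) ^ 2 * (D.x (P + S) + D.x (P - S)) = D.sumForm (D.x P) (D.x S) :=
  D.sum_eq P S hP hS h₁ h₂

lemma prod_eq' {P S : G} (hP : P ≠ 0) (hS : S ≠ 0) (h₁ : P + S ≠ 0) (h₂ : P - S ≠ 0) :
    (D.x P - D.x S) ^ 2 * (D.x (P + S) * D.x (P - S)) = D.prodForm (D.x P) (D.x S) :=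
  D.prod_eq P S hP hS h₁ h₂

lemma dup' {P : G} (h : P + P ≠ 0) : D.psi (D.x P) * D.x (P + P) = D.phi (D.x P) := D.dup P h

lemma x_ne {P S : G} (hP : P ≠ 0) (hS : S ≠ 0) (h₁ : P + S ≠ 0) (h₂ : P - S ≠ 0) :
    D.x P ≠ D.x S := by
  intro h
  rcases (D.x_eq P S hP hS).1 h with h | h
  · exact h₂ (sub_eq_zero.2 h)
  · exact h₁ (by rw [h, neg_add_cancel])

lemma sumForm_sq_sub (X Y : K) :
    D.sumForm X Y ^ 2 - 4 * D.prodForm X Y * (X - Y) ^ 2 = D.psi X * D.psi Y := by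
  have := D.rel
  unfold sumForm prodForm psi
  linear_combination (X - Y) ^ 2 * this

/-- The relation between the `x`-coordinates of `P`, `S` and `P ± S`. -/
def theta (X Y Z : K) : K := (X - Y) ^ 2 * Z ^ 2 - D.sumForm X Y * Z + D.prodForm X Y

lemma theta_rotate (X Y Z : K) : D.theta X Y Z = D.theta Z X Y := by
  unfold theta sumForm prodForm; ring

lemma theta_swap (X Y Z : K) : D.theta X Y Z = D.theta Y X Z := by
  unfold theta sumForm prodForm; ring

lemma theta_eq {P S : G} (hP : P ≠ 0) (hS : S ≠ 0) (h₁ : P + S ≠ 0) (h₂ : P - S ≠ 0) (Z : K) :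
    D.theta (D.x P) (D.x S) Z =
      (D.x P - D.x S) ^ 2 * ((Z - D.x (P + S)) * (Z - D.x (P - S))) := by
  unfold theta
  rw [← D.sum_eq' hP hS h₁ h₂, ← D.prod_eq' hP hS h₁ h₂]; ring

/-- The Bezout identity for the two forms. -/
lemma bezout_forms (X Y : K) :
    (-12 * (X + Y) ^ 2 - 4 * D.b2 * (X + Y) + (D.b2 ^ 2 - 32 * D.b4)) * D.prodForm X Y +
      (6 * (X * Y) * (X + Y) - D.b2 * (X * Y) - 5 * D.b4 * (X + Y) + (D.b2 * D.b4 - 27 * D.b6)) *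
        D.sumForm X Y +
      (-8 * D.b4 * (X * Y) - 12 * D.b6 * (X + Y) + (D.b4 ^ 2 - 28 * D.b8)) * (X - Y) ^ 2 = D.Δ := by
  have := D.rel
  unfold sumForm prodForm Δ
  linear_combination (20 * (X * Y) + D.b2 * (X + Y) - 4 * (X ^ 2 + Y ^ 2) + 8 * D.b4) * this

/-- An affine change of the coordinate. -/
def affine (r s : K) (hs : s ≠ 0) : KummerModel G K where
  x P := (D.x P - r) / s
  b2 := (D.b2 + 12 * r) / s
  b4 := (D.b4 + r * D.b2 + 6 * r ^ 2) / s ^ 2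
  b6 := (D.b6 + 2 * r * D.b4 + r ^ 2 * D.b2 + 4 * r ^ 3) / s ^ 3
  b8 := (D.b8 + 3 * r * D.b6 + 3 * r ^ 2 * D.b4 + r ^ 3 * D.b2 + 3 * r ^ 4) / s ^ 4
  rel := by
    have := D.rel
    field_simp
    linear_combination this
  disc := by
    have h : ∀ X : K, X = D.Δ / s ^ 6 → X ≠ 0 := by
      rintro X rfl
      exact div_ne_zero D.Δ_ne (pow_ne_zero _ hs)
    apply h
    have := D.rel
    unfold Δ
    field_simp
    linear_combination -(6 * D.b2 * r + 36 * r ^ 2) * this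
  x_eq P S hP hS := by
    rw [← D.x_eq P S hP hS, div_left_inj' hs, sub_left_inj]
  surj c := by
    obtain ⟨P, hP, h⟩ := D.surj (c * s + r)
    exact ⟨P, hP, by rw [h]; field_simp; ring⟩
  sum_eq P S hP hS h₁ h₂ := by
    have := D.sum_eq P S hP hS h₁ h₂
    field_simp
    linear_combination this
  prod_eq P S hP hS h₁ h₂ := by
    have h := D.sum_eq P S hP hS h₁ h₂
    have := D.prod_eq P S hP hS h₁ h₂
    field_simp
    linear_combination this - r * h
  dup P h := by
    have := D.dup P h
    field_simp
    linear_combination this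
  two_tors P hP h := by
    have := D.two_tors P hP h
    field_simp
    linear_combination this

@[simp] lemma affine_x (r s : K) (hs : s ≠ 0) (P : G) : (D.affine r s hs).x P = (D.x P - r) / s := rfl

end KummerModel

namespace KummerModel

variable {G K : Type*} [AddCommGroup G] [Field K]

/-- The effect on `x`-coordinates of an endomorphism `Γ` with nonzero kernel elements `C` and
multiplier `g`. -/
structure IsMult (D : KummerModel G K) (Γ : G →+ G) (C : Finset G) (g : K) : Prop where
  mem : ∀ u, u ∈ C ↔ u ≠ 0 ∧ Γ u = 0
  ne : g ≠ 0
  eq : ∀ P S, Γ P ≠ 0 → Γ S ≠ 0 →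
    (D.x (Γ P) - D.x (Γ S)) * (g ^ 2 * ∏ u ∈ C, (D.x P - D.x u)) =
      (D.x P - D.x S) * ∏ u ∈ C, (D.x P - D.x (S + u))

lemma IsMult.affine {D : KummerModel G K} {Γ : G →+ G} {C : Finset G} {g : K}
    (h : D.IsMult Γ C g) (r s : K) (hs : s ≠ 0) : (D.affine r s hs).IsMult Γ C g where
  mem := h.mem
  ne := h.ne
  eq P S hP hS := by
    have := h.eq P S hP hS
    simp only [affine_x, ← sub_div, sub_sub_sub_cancel_right, Finset.prod_div_distrib,
      Finset.prod_const]
    field_simp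
    linear_combination this

end KummerModel

/-- A model with complex multiplication by a root `τ` of `X ^ 2 - X + q`. -/
structure KummerModel.IsCM {G K : Type*} [AddCommGroup G] [Field K] (D : KummerModel G K)
    (Γ : G →+ G) (q p : ℕ) (τ : K) : Prop where
  root : τ ^ 2 = τ - q
  sq : ∀ P, Γ (Γ P) = Γ P - q • P
  surj : Function.Surjective Γ
  surj_one_sub : Function.Surjective (AddMonoidHom.id G - Γ)
  surj_nsmul : Function.Surjective (p • AddMonoidHom.id G)
  mult : ∃ C, D.IsMult Γ C τ ∧ C.card + 1 = q
  cyclic : ∃ w, Γ w = 0 ∧ ∀ u, Γ u = 0 → ∃ n : ℤ, n • w = u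
  mult_one_sub : ∃ C, D.IsMult (AddMonoidHom.id G - Γ) C (1 - τ) ∧ C.card + 1 = q
  mult_two_sub : ∃ C, D.IsMult (2 • Γ - AddMonoidHom.id G) C (2 * τ - 1) ∧ C.card + 2 = 4 * q
  mult_nsmul : ∃ C, D.IsMult (p • AddMonoidHom.id G) C p
  infinite_order : ∃ P : G, ∀ n : ℕ, n ≠ 0 → n • P ≠ 0
  two_torsion : ∃ T : G, T ≠ 0 ∧ T + T = 0

section Analytic

open Filter Topology

namespace PeriodPair

variable (L : PeriodPair)

/-- A meromorphic function without poles that is periodic with respect to a lattice is constant. -/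
lemma eventually_const_of_order_nonneg {f : ℂ → ℂ} (hf : ∀ z, MeromorphicAt f z)
    (per : ∀ l ∈ L.lattice, ∀ z, f (z + l) = f z) (ho : ∀ z, 0 ≤ meromorphicOrderAt f z) :
    ∃ c, ∀ z, f =ᶠ[𝓝[≠] z] fun _ => c := by
  have lim : ∀ z, ∃ c, Tendsto f (𝓝[≠] z) (𝓝 c) := fun z =>
    tendsto_nhds_of_meromorphicOrderAt_nonneg (hf z) (ho z)
  choose g hg using lim
  have hfg : ∀ z, f =ᶠ[𝓝[≠] z] g := by
    intro z
    filter_upwards [(hf z).eventually_analyticAt] with w hw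
    exact tendsto_nhds_unique (hw.continuousAt.tendsto.mono_left nhdsWithin_le_nhds) (hg w)
  have han : ∀ z, AnalyticAt ℂ g z := by
    intro z
    have hc : ContinuousAt g z := by
      rw [continuousAt_iff_punctured_nhds]
      exact (hg z).congr' (hfg z)
    exact MeromorphicAt.analyticAt ((hf z).congr (hfg z)) hc
  have hdiff : Differentiable ℂ g := fun z => (han z).differentiableAt
  have hper : ∀ z, ∀ l ∈ L.lattice, g (z + l) = g z := by
    intro z l hl
    refine tendsto_nhds_unique (hg (z + l)) ?_
    have h1 : Tendsto (fun w => w - l) (𝓝[≠] (z + l)) (𝓝[≠] z) := by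
      have h2 : Tendsto (fun w => w - l) (𝓝 (z + l)) (𝓝 (z + l - l)) :=
        (continuous_id.sub continuous_const).continuousAt
      rw [add_sub_cancel_right] at h2
      refine tendsto_nhdsWithin_iff.2 ⟨h2.mono_left nhdsWithin_le_nhds, ?_⟩
      filter_upwards [self_mem_nhdsWithin] with w hw
      intro h
      exact hw (by rw [Set.mem_singleton_iff] at h ⊢; rw [← h]; ring)
    refine ((hg z).comp h1).congr fun w => ?_
    have := per l hl (w - l)
    simpa using this.symm
  refine ⟨g 0, fun z => (hfg z).trans (Eventually.of_forall fun x => ?_)⟩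
  exact hdiff.apply_eq_apply_of_bounded (IsZLattice.isCompact_range_of_periodic L.lattice _
    hdiff.continuous hper).isBounded x 0

lemma order_ne_neg_odd {f : ℂ → ℂ} (hf : MeromorphicAt f 0) (even : ∀ z, f (-z) = f z) (n : ℤ)
    (h : meromorphicOrderAt f 0 = ((2 * n + 1 : ℤ) : WithTop ℤ)) : False := by
  obtain ⟨g, hg, hg0, hfg⟩ := (meromorphicOrderAt_eq_int_iff hf).1 h
  have hneg : Tendsto (fun z : ℂ => -z) (𝓝[≠] 0) (𝓝[≠] 0) := by
    refine tendsto_nhdsWithin_iff.2 ⟨?_, ?_⟩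
    · have : Tendsto (fun z : ℂ => -z) (𝓝 0) (𝓝 (-0)) := continuous_neg.continuousAt
      rw [neg_zero] at this
      exact this.mono_left nhdsWithin_le_nhds
    · filter_upwards [self_mem_nhdsWithin] with w hw
      simpa using hw
  have h2 : ∀ᶠ z in 𝓝[≠] (0 : ℂ), g (-z) = - g z := by
    filter_upwards [hfg, hneg.eventually hfg, self_mem_nhdsWithin] with z h1 h2 h3
    have h3 : z ≠ 0 := h3
    rw [even, h1] at h2
    simp only [sub_zero, smul_eq_mul] at h2
    rw [zpow_add₀ h3, zpow_add₀ (neg_ne_zero.2 h3), Even.neg_zpow (even_two_mul n)] at h2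
    have h4 : z ^ (2 * n) ≠ 0 := zpow_ne_zero _ h3
    simp only [zpow_one] at h2
    have h5 : z ^ (2 * n) * z * (g (-z) + g z) = 0 := by linear_combination h2
    have h6 := (mul_eq_zero.1 h5).resolve_left (mul_ne_zero h4 h3)
    linear_combination h6
  have t1 : Tendsto g (𝓝[≠] 0) (𝓝 (g 0)) := hg.continuousAt.tendsto.mono_left nhdsWithin_le_nhds
  have t2 : Tendsto (fun z => g (-z)) (𝓝[≠] 0) (𝓝 (g 0)) := t1.comp hneg
  have t3 := tendsto_nhds_unique (t2.congr' h2) t1.neg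
  apply hg0
  have : (2 : ℂ) * g 0 = 0 := by linear_combination t3
  simpa using this

lemma meromorphicAt_weierstrassP (z : ℂ) : MeromorphicAt ℘[L] z := L.meromorphic_weierstrassP z

lemma order_weierstrassP_zero : meromorphicOrderAt ℘[L] 0 = -2 :=
  L.order_weierstrassP 0 (zero_mem _)

lemma order_weierstrassP_ge (z : ℂ) : ((-2 : ℤ) : WithTop ℤ) ≤ meromorphicOrderAt ℘[L] z := by
  by_cases h : z ∈ L.lattice
  · rw [L.order_weierstrassP z h]; rfl
  · refine le_trans ?_ (L.analyticOnNhd_weierstrassP z h).meromorphicOrderAt_nonneg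
    exact_mod_cast (by norm_num : (-2 : ℤ) ≤ 0)

lemma order_add_of_periodic {f : ℂ → ℂ} {l : ℂ} (per : ∀ z, f (z + l) = f z) (z : ℂ) :
    meromorphicOrderAt f (z + l) = meromorphicOrderAt f z := by
  rw [← meromorphicOrderAt_comp_add_const_eq_meromorphicOrderAt]
  congr 1
  ext w
  exact per w

lemma order_weierstrassP_pow (n : ℕ) :
    meromorphicOrderAt (fun z => ℘[L] z ^ n) 0 = ((-(2 * n) : ℤ) : WithTop ℤ) := by
  rw [fun_meromorphicOrderAt_pow (L.meromorphicAt_weierstrassP 0), L.order_weierstrassP_zero]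
  have : (-2 : WithTop ℤ) = ((-2 : ℤ) : WithTop ℤ) := rfl
  rw [this]
  norm_cast
  push_cast
  ring

/-- An even elliptic function with poles only at lattice points is a polynomial in `℘`. -/
lemma exists_polynomial (n : ℕ) : ∀ {f : ℂ → ℂ} (_ : ∀ z, MeromorphicAt f z)
    (_ : ∀ l ∈ L.lattice, ∀ z, f (z + l) = f z) (_ : ∀ z, f (-z) = f z)
    (_ : ∀ z ∉ L.lattice, 0 ≤ meromorphicOrderAt f z)
    (_ : ((-(2 * n) : ℤ) : WithTop ℤ) ≤ meromorphicOrderAt f 0),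
    ∃ P : Polynomial ℂ, P.natDegree ≤ n ∧ (∀ z, f =ᶠ[𝓝[≠] z] fun w => P.eval (℘[L] w)) ∧
      Tendsto (fun z => f z / ℘[L] z ^ n) (𝓝[≠] 0) (𝓝 (P.coeff n)) := by
  induction n with
  | zero =>
    intro f hf per even ho h0
    obtain ⟨c, hc⟩ := L.eventually_const_of_order_nonneg hf per (by
      intro z
      by_cases hz : z ∈ L.lattice
      · have h1 := order_add_of_periodic (per z hz) 0
        rw [zero_add] at h1
        rw [h1]
        simpa using h0
      · exact ho z hz)
    refine ⟨Polynomial.C c, by simp, by simpa using hc, ?_⟩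
    simp only [pow_zero, div_one, Polynomial.coeff_C_zero]
    exact tendsto_const_nhds.congr' ((hc 0).mono fun _ h => h.symm)
  | succ n ih =>
    intro f hf per even ho h0
    have hp := L.meromorphicAt_weierstrassP
    have ordP := L.order_weierstrassP_pow (n + 1)
    have hdivord : ∀ g : ℂ → ℂ, MeromorphicAt g 0 →
        meromorphicOrderAt (fun z => g z / ℘[L] z ^ (n + 1)) 0 =
          meromorphicOrderAt g 0 + ((2 * (n + 1) : ℤ) : WithTop ℤ) := by
      intro g hg
      have h1 : (fun z => g z / ℘[L] z ^ (n + 1)) =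
          fun z => g z * (fun w => ℘[L] w ^ (n + 1))⁻¹ z := by
        ext z; rw [Pi.inv_apply, div_eq_mul_inv]
      rw [h1, fun_meromorphicOrderAt_mul hg ((hp 0).fun_pow _).inv, meromorphicOrderAt_inv, ordP]
      congr 1
    obtain ⟨a, ha⟩ : ∃ a, Tendsto (fun z => f z / ℘[L] z ^ (n + 1)) (𝓝[≠] 0) (𝓝 a) := by
      refine tendsto_nhds_of_meromorphicOrderAt_nonneg ?_ ?_
      · exact (hf 0).fun_div ((hp 0).fun_pow _)
      · rw [hdivord f (hf 0)]
        refine le_trans ?_ (add_le_add_left h0 _)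
        rw [← WithTop.coe_add]
        exact_mod_cast (by push_cast; linarith)
    have hne : ∀ᶠ z in 𝓝[≠] (0 : ℂ), ℘[L] z ≠ 0 := by
      refine (meromorphicOrderAt_ne_top_iff_eventually_ne_zero (hp 0)).1 ?_
      rw [L.order_weierstrassP_zero]
      exact WithTop.coe_ne_top (a := (-2 : ℤ))
    set f' : ℂ → ℂ := fun z => f z - a * ℘[L] z ^ (n + 1) with hf'
    have hf'm : ∀ z, MeromorphicAt f' z := fun z =>
      (hf z).fun_sub ((MeromorphicAt.const a z).fun_mul ((hp z).fun_pow _))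
    obtain ⟨P, hP, hPe, -⟩ := ih hf'm (fun l hl z => by
        simp only [hf', per l hl z]
        rw [L.weierstrassP_add_coe z ⟨l, hl⟩]) (fun z => by simp [hf', even z]) (fun z hz => by
        have h1 : AnalyticAt ℂ (fun z => -(a * ℘[L] z ^ (n + 1))) z := by
          have := L.analyticOnNhd_weierstrassP z hz
          fun_prop
        have h2 := meromorphicOrderAt_add (hf z) h1.meromorphicAt
        refine le_trans ?_ (h2.trans_eq ?_)
        · exact le_min (ho z hz) h1.meromorphicOrderAt_nonneg
        · simp only [hf', sub_eq_add_neg]; rfl) (by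
        have h1 : 0 < meromorphicOrderAt (fun z => f' z / ℘[L] z ^ (n + 1)) 0 := by
          refine (tendsto_zero_iff_meromorphicOrderAt_pos
            ((hf'm 0).fun_div ((hp 0).fun_pow _))).1 ?_
          have h2 := ha.sub (tendsto_const_nhds (x := a))
          rw [sub_self] at h2
          refine h2.congr' ?_
          filter_upwards [hne] with z hz
          simp only [hf']
          field_simp
        rw [hdivord f' (hf'm 0)] at h1
        have h3 := order_ne_neg_odd (hf'm 0) (fun z => by simp [hf', even z]) (-n - 1)
        revert h1 h3
        cases meromorphicOrderAt f' 0 with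
        | top => intros; exact le_top
        | coe m =>
          intro h1 h3
          have h4 : (0 : ℤ) < m + 2 * (n + 1) := by exact_mod_cast h1
          have h5 : m ≠ 2 * (-n - 1) + 1 := fun h => h3 (by rw [h])
          exact_mod_cast (by omega : -(2 * (n : ℤ)) ≤ m))
    refine ⟨P + Polynomial.C a * Polynomial.X ^ (n + 1), ?_, fun z => ?_, ?_⟩
    · refine (Polynomial.natDegree_add_le _ _).trans (max_le (hP.trans (Nat.le_succ n)) ?_)
      exact Polynomial.natDegree_C_mul_X_pow_le a (n + 1)
    · filter_upwards [hPe z] with w hw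
      simp only [Polynomial.eval_add, Polynomial.eval_mul, Polynomial.eval_C, Polynomial.eval_pow,
        Polynomial.eval_X, ← hw, hf']
      ring
    · rw [Polynomial.coeff_add, Polynomial.coeff_C_mul_X_pow, if_pos rfl,
        Polynomial.coeff_eq_zero_of_natDegree_lt (Nat.lt_succ_of_le hP), zero_add]
      exact ha

end PeriodPair

namespace PeriodPair

variable (L : PeriodPair)

lemma eq_of_eventuallyEq_punctured {f g : ℂ → ℂ} {z : ℂ} (hf : ContinuousAt f z)
    (hg : ContinuousAt g z) (h : f =ᶠ[𝓝[≠] z] g) : f z = g z :=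
  tendsto_nhds_unique (hf.tendsto.mono_left nhdsWithin_le_nhds)
    ((hg.tendsto.mono_left nhdsWithin_le_nhds).congr' h.symm)

lemma weierstrassP_add_mem {l : ℂ} (hl : l ∈ L.lattice) (z : ℂ) : ℘[L] (z + l) = ℘[L] z :=
  L.weierstrassP_add_coe z ⟨l, hl⟩

lemma continuousAt_weierstrassP {z : ℂ} (hz : z ∉ L.lattice) : ContinuousAt ℘[L] z :=
  (L.analyticOnNhd_weierstrassP z hz).continuousAt

lemma tendsto_weierstrassP_cobounded :
    Tendsto ℘[L] (𝓝[≠] 0) (Bornology.cobounded ℂ) := by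
  refine tendsto_cobounded_of_meromorphicOrderAt_neg ?_
  rw [L.order_weierstrassP_zero]
  exact WithTop.coe_lt_coe.2 (by norm_num : (-2 : ℤ) < 0)

lemma tendsto_sub_div_weierstrassP (C : ℂ) :
    Tendsto (fun z => (℘[L] z - C) / ℘[L] z) (𝓝[≠] 0) (𝓝 1) := by
  have h1 : Tendsto (fun z => (℘[L] z)⁻¹) (𝓝[≠] 0) (𝓝 0) :=
    tendsto_inv₀_cobounded.comp L.tendsto_weierstrassP_cobounded
  have h2 := (h1.const_mul C).const_sub 1
  rw [mul_zero, sub_zero] at h2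
  refine h2.congr' ?_
  have hne : ∀ᶠ z in 𝓝[≠] (0 : ℂ), ℘[L] z ≠ 0 :=
    L.tendsto_weierstrassP_cobounded.eventually (Bornology.eventually_ne_cobounded 0)
  filter_upwards [hne] with z hz
  field_simp

lemma not_eventually_const (c : ℂ) : ¬ ℘[L] =ᶠ[𝓝[≠] 0] fun _ => c := by
  intro h
  have h1 := L.tendsto_weierstrassP_cobounded.congr' h
  have h2 := h1.eventually (Bornology.eventually_ne_cobounded c)
  obtain ⟨z, hz⟩ := h2.exists
  exact hz rfl

lemma exists_weierstrassP_eq (c : ℂ) : ∃ z ∉ L.lattice, ℘[L] z = c := by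
  by_contra! hcon
  have hm : ∀ z, MeromorphicAt (fun z => ℘[L] z - c) z := fun z =>
    (L.meromorphicAt_weierstrassP z).fun_sub (MeromorphicAt.const c z)
  obtain ⟨K, hK⟩ := L.eventually_const_of_order_nonneg (f := fun z => (℘[L] z - c)⁻¹)
    (fun z => (hm z).fun_inv) (fun l hl z => by rw [L.weierstrassP_add_mem hl]) (fun z => by
      refine (tendsto_nhds_iff_meromorphicOrderAt_nonneg (hm z).fun_inv).1 ?_
      by_cases hz : z ∈ L.lattice
      · refine ⟨0, tendsto_inv₀_cobounded.comp ?_⟩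
        have h1 : Tendsto ℘[L] (𝓝[≠] z) (Bornology.cobounded ℂ) := by
          refine tendsto_cobounded_of_meromorphicOrderAt_neg ?_
          rw [L.order_weierstrassP z hz]
          exact WithTop.coe_lt_coe.2 (by norm_num : (-2 : ℤ) < 0)
        have h2 : Tendsto (fun x : ℂ => x - c) (Bornology.cobounded ℂ) (Bornology.cobounded ℂ) :=
          tendsto_sub_const_cobounded c
        exact h2.comp h1
      · refine ⟨(℘[L] z - c)⁻¹, ContinuousAt.tendsto ?_ |>.mono_left nhdsWithin_le_nhds⟩
        exact ((L.continuousAt_weierstrassP hz).sub continuousAt_const).inv₀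
          (sub_ne_zero.2 (hcon z hz)))
  apply L.not_eventually_const (c + K⁻¹)
  filter_upwards [hK 0] with z hz
  rw [← hz, inv_inv]; ring

lemma order_sub_self_pos {z : ℂ} (hz : z ∉ L.lattice) :
    ((1 : ℤ) : WithTop ℤ) ≤ meromorphicOrderAt (fun w => ℘[L] w - ℘[L] z) z := by
  have h1 : MeromorphicAt (fun w => ℘[L] w - ℘[L] z) z :=
    (L.meromorphicAt_weierstrassP z).fun_sub (MeromorphicAt.const _ z)
  have h2 : 0 < meromorphicOrderAt (fun w => ℘[L] w - ℘[L] z) z := by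
    rw [← tendsto_zero_iff_meromorphicOrderAt_pos h1]
    have h3 : ContinuousAt (fun w => ℘[L] w - ℘[L] z) z :=
      (L.continuousAt_weierstrassP hz).sub continuousAt_const
    have := h3.tendsto.mono_left (nhdsWithin_le_nhds (s := {z}ᶜ))
    rwa [sub_self] at this
  revert h2
  cases meromorphicOrderAt (fun w => ℘[L] w - ℘[L] z) z with
  | top => intros; exact le_top
  | coe m => intro h; have h : 0 < m := by exact_mod_cast h
             exact_mod_cast h

lemma order_sub_self_ge_two {z : ℂ} (hz : z ∉ L.lattice) (h2z : z + z ∈ L.lattice) :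
    ((2 : ℤ) : WithTop ℤ) ≤ meromorphicOrderAt (fun w => ℘[L] w - ℘[L] z) z := by
  have h1 := L.order_sub_self_pos hz
  have h2 := order_ne_neg_odd (f := fun w => ℘[L] (w + z) - ℘[L] z) (by
    have h3 : MeromorphicAt (fun w => ℘[L] w - ℘[L] z) (0 + z) :=
      (L.meromorphicAt_weierstrassP _).fun_sub (MeromorphicAt.const _ _)
    exact meromorphicAt_fun_comp_add_const_iff_meromorphicAt.2 h3) (fun w => by
      rw [← L.weierstrassP_neg, ← L.weierstrassP_add_mem h2z]
      congr 2; ring) 0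
  have h4 := meromorphicOrderAt_fun_comp_add_const_eq_meromorphicOrderAt (x := 0) (c := z)
    (f := fun w => ℘[L] w - ℘[L] z)
  rw [h4, zero_add] at h2
  revert h1 h2
  cases meromorphicOrderAt (fun w => ℘[L] w - ℘[L] z) z with
  | top => intros; exact le_top
  | coe m =>
    intro h h'
    have h : 1 ≤ m := by exact_mod_cast h
    have h' : m ≠ 1 := fun h => h' (by rw [h]; rfl)
    exact_mod_cast (by omega : 2 ≤ m)

lemma order_comp_add_weierstrassP (z c : ℂ) :
    meromorphicOrderAt (fun w => ℘[L] (w + c)) z = meromorphicOrderAt ℘[L] (z + c) :=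
  meromorphicOrderAt_fun_comp_add_const_eq_meromorphicOrderAt

lemma order_comp_add_nonneg {z c : ℂ} (h : z + c ∉ L.lattice) :
    0 ≤ meromorphicOrderAt (fun w => ℘[L] (w + c)) z := by
  rw [order_comp_add_weierstrassP]
  exact (L.analyticOnNhd_weierstrassP _ h).meromorphicOrderAt_nonneg

lemma order_comp_add_ge (z c : ℂ) :
    ((-2 : ℤ) : WithTop ℤ) ≤ meromorphicOrderAt (fun w => ℘[L] (w + c)) z := by
  rw [order_comp_add_weierstrassP]
  exact L.order_weierstrassP_ge _

lemma meromorphicAt_comp_add (z c : ℂ) : MeromorphicAt (fun w => ℘[L] (w + c)) z :=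
  meromorphicAt_fun_comp_add_const_iff_meromorphicAt.2 (L.meromorphicAt_weierstrassP _)

lemma continuousAt_comp_add {z c : ℂ} (h : z + c ∉ L.lattice) :
    ContinuousAt (fun w => ℘[L] (w + c)) z :=
  ContinuousAt.comp (f := fun w => w + c) (g := ℘[L]) (L.continuousAt_weierstrassP h)
    (by fun_prop)

lemma weierstrassP_eq_of_add_mem {z c : ℂ} (h : z + c ∈ L.lattice) : ℘[L] z = ℘[L] c := by
  rw [← L.weierstrassP_neg c, ← L.weierstrassP_add_mem h (-c)]
  congr 1; ring

lemma weierstrassP_eq_of_sub_mem {z c : ℂ} (h : z - c ∈ L.lattice) : ℘[L] z = ℘[L] c := by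
  rw [← L.weierstrassP_add_mem h c]
  congr 1; ring

/-- A general form of the addition formula. -/
lemma exists_quadratic {c : ℂ} (hc : c ∉ L.lattice) {h : ℂ → ℂ} (hm : ∀ z, MeromorphicAt h z)
    (per : ∀ l ∈ L.lattice, ∀ z, h (z + l) = h z) (even : ∀ z, h (-z) = h z)
    (cont : ∀ z, z + c ∉ L.lattice → z - c ∉ L.lattice → ContinuousAt h z)
    (ord2 : c + c ∉ L.lattice → ∀ z, ((-2 : ℤ) : WithTop ℤ) ≤ meromorphicOrderAt h z)
    (ord4 : ∀ z, ((-4 : ℤ) : WithTop ℤ) ≤ meromorphicOrderAt h z) :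
    ∃ α β : ℂ, ∀ z, z ∉ L.lattice → z + c ∉ L.lattice → z - c ∉ L.lattice →
      (℘[L] z - ℘[L] c) ^ 2 * h z = h 0 * ℘[L] z ^ 2 + α * ℘[L] z + β := by
  have hsm : ∀ z, MeromorphicAt (fun w => ℘[L] w - ℘[L] c) z := fun z =>
    (L.meromorphicAt_weierstrassP z).fun_sub (MeromorphicAt.const _ z)
  have hcont : ∀ z, z ∉ L.lattice → z + c ∉ L.lattice → z - c ∉ L.lattice →
      ContinuousAt (fun z => (℘[L] z - ℘[L] c) ^ 2 * h z) z := fun z hz h1 h2 =>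
    (((L.continuousAt_weierstrassP hz).sub continuousAt_const).pow 2).mul (cont z h1 h2)
  have hsq : ∀ z, meromorphicOrderAt (fun w => (℘[L] w - ℘[L] c) ^ 2) z =
      meromorphicOrderAt (fun w => ℘[L] w - ℘[L] c) z +
        meromorphicOrderAt (fun w => ℘[L] w - ℘[L] c) z := fun z => by
    simp only [pow_two]
    exact fun_meromorphicOrderAt_mul (hsm z) (hsm z)
  have h0c : ContinuousAt h 0 := cont 0 (by simpa using hc) (by simpa using hc)
  obtain ⟨P, hPd, hP, hlim⟩ := L.exists_polynomial 2
    (f := fun z => (℘[L] z - ℘[L] c) ^ 2 * h z)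
    (fun z => ((hsm z).fun_pow 2).fun_mul (hm z))
    (fun l hl z => by rw [per l hl, L.weierstrassP_add_mem hl])
    (fun z => by rw [even, L.weierstrassP_neg]) (by
      intro z hz
      by_cases h12 : z + c ∉ L.lattice ∧ z - c ∉ L.lattice
      · refine (tendsto_nhds_iff_meromorphicOrderAt_nonneg
          (((hsm z).fun_pow 2).fun_mul (hm z))).1 ⟨(℘[L] z - ℘[L] c) ^ 2 * h z, ?_⟩
        exact (hcont z hz h12.1 h12.2).tendsto.mono_left nhdsWithin_le_nhds
      · rw [fun_meromorphicOrderAt_mul ((hsm z).fun_pow 2) (hm z), hsq]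
        have hzc : ℘[L] c = ℘[L] z ∧ (c + c ∈ L.lattice → z + z ∈ L.lattice) := by
          rw [not_and_or, not_not, not_not] at h12
          rcases h12 with h1 | h1
          · refine ⟨(L.weierstrassP_eq_of_add_mem h1).symm, fun h2 => ?_⟩
            have := sub_mem (add_mem h1 h1) h2
            rwa [show z + c + (z + c) - (c + c) = z + z by ring] at this
          · refine ⟨(L.weierstrassP_eq_of_sub_mem h1).symm, fun h2 => ?_⟩
            have := add_mem (add_mem h1 h1) h2
            rwa [show z - c + (z - c) + (c + c) = z + z by ring] at this
        have e1 := L.order_sub_self_pos hz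
        have e2 := L.order_sub_self_ge_two hz
        rw [hzc.1]
        have o2 := fun h => ord2 h z
        have o4 := ord4 z
        revert e1 e2 o2 o4
        cases meromorphicOrderAt h z with
        | top =>
          intros
          simp
        | coe b =>
          cases meromorphicOrderAt (fun w => ℘[L] w - ℘[L] z) z with
          | top =>
            intros
            exact le_top
          | coe a =>
            intro e1 e2 o2 o4
            have e1 : 1 ≤ a := by exact_mod_cast e1
            have o4 : -4 ≤ b := by exact_mod_cast o4
            have : 0 ≤ a + a + b := by
              by_cases hcc : c + c ∈ L.lattice
              · have e2 : 2 ≤ a := by exact_mod_cast e2 (hzc.2 hcc)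
                omega
              · have o2 : -2 ≤ b := by exact_mod_cast o2 hcc
                omega
            exact_mod_cast this) (by
      rw [fun_meromorphicOrderAt_mul ((hsm 0).fun_pow 2) (hm 0), hsq]
      have e1 : ((-2 : ℤ) : WithTop ℤ) ≤ meromorphicOrderAt (fun w => ℘[L] w - ℘[L] c) 0 := by
        have h1 := meromorphicOrderAt_add (L.meromorphicAt_weierstrassP 0)
          (MeromorphicAt.const (-℘[L] c) (0 : ℂ))
        refine le_trans (le_min (L.order_weierstrassP_ge 0) ?_) (h1.trans_eq ?_)
        · exact le_trans (by exact_mod_cast (by norm_num : (-2 : ℤ) ≤ 0))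
            (analyticAt_const.meromorphicOrderAt_nonneg)
        · simp only [sub_eq_add_neg]; rfl
      have e2 : 0 ≤ meromorphicOrderAt h 0 :=
        (tendsto_nhds_iff_meromorphicOrderAt_nonneg (hm 0)).1
          ⟨_, h0c.tendsto.mono_left nhdsWithin_le_nhds⟩
      revert e1 e2
      cases meromorphicOrderAt h 0 with
      | top =>
        intros
        simp
      | coe b =>
        cases meromorphicOrderAt (fun w => ℘[L] w - ℘[L] c) 0 with
        | top =>
          intros
          exact le_top
        | coe a =>
          intro e1 e2
          have e1 : -2 ≤ a := by exact_mod_cast e1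
          have e2 : 0 ≤ b := by exact_mod_cast e2
          exact_mod_cast (by push_cast; omega : -(2 * ((2 : ℕ) : ℤ)) ≤ a + a + b))
  have hc2 : P.coeff 2 = h 0 := by
    refine tendsto_nhds_unique hlim ?_
    have h1 := ((L.tendsto_sub_div_weierstrassP (℘[L] c)).pow 2).mul
      (h0c.tendsto.mono_left (nhdsWithin_le_nhds (s := {0}ᶜ)))
    rw [one_pow, one_mul] at h1
    refine h1.congr fun z => ?_
    rw [div_pow]; ring
  refine ⟨P.coeff 1, P.coeff 0, fun z hz h1 h2 => ?_⟩
  have h3 := eq_of_eventuallyEq_punctured (hcont z hz h1 h2) (by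
    have := L.continuousAt_weierstrassP hz
    exact ContinuousAt.comp (f := ℘[L]) (g := fun w => P.eval w) P.continuous.continuousAt this)
    (hP z)
  rw [h3, Polynomial.eval_eq_sum_range' (Nat.lt_succ_of_le hPd), Finset.sum_range_succ,
    Finset.sum_range_succ, Finset.sum_range_one, hc2]
  ring

lemma exists_sum_formula {c : ℂ} (hc : c ∉ L.lattice) :
    ∃ α β : ℂ, ∀ z, z ∉ L.lattice → z + c ∉ L.lattice → z - c ∉ L.lattice →
      (℘[L] z - ℘[L] c) ^ 2 * (℘[L] (z + c) + ℘[L] (z - c)) =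
        2 * ℘[L] c * ℘[L] z ^ 2 + α * ℘[L] z + β := by
  have ord : ∀ z, ((-2 : ℤ) : WithTop ℤ) ≤
      meromorphicOrderAt (fun z => ℘[L] (z + c) + ℘[L] (z + -c)) z := fun z =>
    le_trans (le_min (L.order_comp_add_ge z c) (L.order_comp_add_ge z (-c)))
      (meromorphicOrderAt_add (L.meromorphicAt_comp_add z c) (L.meromorphicAt_comp_add z (-c)))
  obtain ⟨α, β, h⟩ := L.exists_quadratic hc (h := fun z => ℘[L] (z + c) + ℘[L] (z + -c))
    (fun z => (L.meromorphicAt_comp_add z c).fun_add (L.meromorphicAt_comp_add z (-c)))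
    (fun l hl z => by
      rw [add_right_comm, L.weierstrassP_add_mem hl, add_right_comm, L.weierstrassP_add_mem hl])
    (fun z => by
      rw [← L.weierstrassP_neg (-z + c), ← L.weierstrassP_neg (-z + -c)]
      ring_nf)
    (fun z h1 h2 => (L.continuousAt_comp_add h1).add
      (L.continuousAt_comp_add (by rwa [← sub_eq_add_neg])))
    (fun _ => ord) (fun z => le_trans (by exact_mod_cast (by norm_num : (-4 : ℤ) ≤ -2)) (ord z))
  refine ⟨α, β, fun z h1 h2 h3 => ?_⟩
  have := h z h1 h2 h3
  simp only [← sub_eq_add_neg, zero_add, zero_sub, L.weierstrassP_neg] at this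
  rw [this]; ring

lemma exists_prod_formula {c : ℂ} (hc : c ∉ L.lattice) :
    ∃ α β : ℂ, ∀ z, z ∉ L.lattice → z + c ∉ L.lattice → z - c ∉ L.lattice →
      (℘[L] z - ℘[L] c) ^ 2 * (℘[L] (z + c) * ℘[L] (z - c)) =
        ℘[L] c ^ 2 * ℘[L] z ^ 2 + α * ℘[L] z + β := by
  have key : ∀ z, meromorphicOrderAt (fun z => ℘[L] (z + c) * ℘[L] (z + -c)) z =
      meromorphicOrderAt (fun z => ℘[L] (z + c)) z +
        meromorphicOrderAt (fun z => ℘[L] (z + -c)) z := fun z =>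
    fun_meromorphicOrderAt_mul (L.meromorphicAt_comp_add z c) (L.meromorphicAt_comp_add z (-c))
  obtain ⟨α, β, h⟩ := L.exists_quadratic hc (h := fun z => ℘[L] (z + c) * ℘[L] (z + -c))
    (fun z => (L.meromorphicAt_comp_add z c).fun_mul (L.meromorphicAt_comp_add z (-c)))
    (fun l hl z => by
      rw [add_right_comm, L.weierstrassP_add_mem hl, add_right_comm, L.weierstrassP_add_mem hl])
    (fun z => by
      rw [← L.weierstrassP_neg (-z + c), ← L.weierstrassP_neg (-z + -c)]
      ring_nf)
    (fun z h1 h2 => (L.continuousAt_comp_add h1).mul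
      (L.continuousAt_comp_add (by rwa [← sub_eq_add_neg])))
    (fun hcc z => by
      rw [key]
      by_cases h1 : z + c ∈ L.lattice
      · have h2 : z + -c ∉ L.lattice := fun h2 => hcc (by
          have := sub_mem h1 h2
          rwa [show z + c - (z + -c) = c + c by ring] at this)
        exact le_trans (by simp) (add_le_add (L.order_comp_add_ge z c) (L.order_comp_add_nonneg h2))
      · exact le_trans (by simp) (add_le_add (L.order_comp_add_nonneg h1)
          (L.order_comp_add_ge z (-c))))
    (fun z => by
      rw [key]
      refine le_trans ?_ (add_le_add (L.order_comp_add_ge z c) (L.order_comp_add_ge z (-c)))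
      exact_mod_cast (by norm_num : (-4 : ℤ) ≤ -2 + -2))
  refine ⟨α, β, fun z h1 h2 h3 => ?_⟩
  have := h z h1 h2 h3
  simp only [← sub_eq_add_neg, zero_add, zero_sub, L.weierstrassP_neg] at this
  rw [this]; ring

end PeriodPair

/-- A family of affine functions that is symmetric is given by a symmetric bilinear form. -/
lemma exists_symmetric_form {S K : Type*} [Field K] [Infinite K] (x a b : S → K)
    (hx : Function.Surjective x)
    (h : ∀ s t, x s ≠ x t → a s * x t + b s = a t * x s + b t) :
    ∃ k l m, ∀ s, a s = k * x s + l ∧ b s = l * x s + m := by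
  classical
  obtain ⟨s0, h0⟩ := hx 0
  obtain ⟨s1, h1⟩ := hx 1
  have e0 : ∀ t, x t ≠ 0 → b t = a s0 * x t + b s0 := fun t ht => by
    have := h s0 t (by rw [h0]; exact ht.symm)
    rw [h0] at this
    linear_combination -this
  have e1 : ∀ t, x t ≠ 0 → x t ≠ 1 → a t = (a s1 - a s0) * x t + (b s1 - b s0) := fun t ht ht' => by
    have := h s1 t (by rw [h1]; exact ht'.symm)
    rw [h1] at this
    linear_combination -this - e0 t ht
  have ex : ∀ F : Finset K, ∃ t, x t ∉ F := fun F => by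
    obtain ⟨c, hc⟩ := Infinite.exists_notMem_finset F
    obtain ⟨t, rfl⟩ := hx c
    exact ⟨t, hc⟩
  have el : b s1 - b s0 = a s0 := by
    obtain ⟨t, ht⟩ := ex {0, 1}
    obtain ⟨t', ht'⟩ := ex {0, 1, x t}
    simp only [Finset.mem_insert, Finset.mem_singleton, not_or] at ht ht'
    have := h t t' (fun h => ht'.2.2 h.symm)
    rw [e0 t ht.1, e0 t' ht'.1, e1 t ht.1 ht.2, e1 t' ht'.1 ht'.2.1] at this
    have h2 : (x t' - x t) * (b s1 - b s0 - a s0) = 0 := by linear_combination this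
    exact sub_eq_zero.1 ((mul_eq_zero.1 h2).resolve_left (sub_ne_zero.2 ht'.2.2))
  refine ⟨a s1 - a s0, a s0, b s0, fun s => ?_⟩
  obtain ⟨t, ht⟩ := ex {0, 1, x s}
  obtain ⟨t', ht'⟩ := ex {0, 1, x s, x t}
  simp only [Finset.mem_insert, Finset.mem_singleton, not_or] at ht ht'
  have k1 := h s t (fun h => ht.2.2 h.symm)
  have k2 := h s t' (fun h => ht'.2.2.1 h.symm)
  rw [e0 t ht.1, e1 t ht.1 ht.2.1, el] at k1
  rw [e0 t' ht'.1, e1 t' ht'.1 ht'.2.1, el] at k2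
  have h2 : (x t' - x t) * (a s - ((a s1 - a s0) * x s + a s0)) = 0 := by
    linear_combination k2 - k1
  have h3 := sub_eq_zero.1 ((mul_eq_zero.1 h2).resolve_left (sub_ne_zero.2 ht'.2.2.2))
  refine ⟨h3, ?_⟩
  rw [h3] at k1
  linear_combination k1

namespace PeriodPair

variable (L : PeriodPair)

/-- The points of the lattice complement. -/
abbrev NonLattice := {z : ℂ // z ∉ L.lattice}

lemma surjective_nonLattice : Function.Surjective fun z : L.NonLattice => ℘[L] z := fun c => by
  obtain ⟨z, hz, h⟩ := L.exists_weierstrassP_eq c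
  exact ⟨⟨z, hz⟩, h⟩

lemma exists_sum_form : ∃ k l m : ℂ, ∀ c z, c ∉ L.lattice → z ∉ L.lattice → z + c ∉ L.lattice →
    z - c ∉ L.lattice → (℘[L] z - ℘[L] c) ^ 2 * (℘[L] (z + c) + ℘[L] (z - c)) =
      2 * ℘[L] z * ℘[L] c * (℘[L] z + ℘[L] c) + k * (℘[L] z * ℘[L] c) + l * (℘[L] z + ℘[L] c) +
        m := by
  have h := fun c : L.NonLattice => L.exists_sum_formula c.2
  choose α β h using h
  obtain ⟨k, l, m, hk⟩ := exists_symmetric_form (fun z : L.NonLattice => ℘[L] z)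
    (fun z => α z - 2 * ℘[L] z ^ 2) β L.surjective_nonLattice (fun s t hst => by
      have h1 : (t : ℂ) + s ∉ L.lattice := fun h => hst (L.weierstrassP_eq_of_add_mem h).symm
      have h2 : (t : ℂ) - s ∉ L.lattice := fun h => hst (L.weierstrassP_eq_of_sub_mem h).symm
      have h3 : (s : ℂ) + t ∉ L.lattice := by rwa [add_comm]
      have h4 : (s : ℂ) - t ∉ L.lattice := fun h => h2 (by rw [← neg_sub]; exact neg_mem h)
      have e1 := h s t t.2 h1 h2
      have e2 := h t s s.2 h3 h4
      rw [add_comm (s : ℂ) t, ← neg_sub (t : ℂ) s, L.weierstrassP_neg] at e2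
      linear_combination e2 - e1)
  refine ⟨k, l, m, fun c z hc hz h1 h2 => ?_⟩
  rw [h ⟨c, hc⟩ z hz h1 h2, (hk ⟨c, hc⟩).2]
  have := (hk ⟨c, hc⟩).1
  simp only at this ⊢
  linear_combination ℘[L] z * this

lemma exists_prod_form : ∃ k l m : ℂ, ∀ c z, c ∉ L.lattice → z ∉ L.lattice → z + c ∉ L.lattice →
    z - c ∉ L.lattice → (℘[L] z - ℘[L] c) ^ 2 * (℘[L] (z + c) * ℘[L] (z - c)) =
      (℘[L] z * ℘[L] c) ^ 2 + k * (℘[L] z * ℘[L] c) + l * (℘[L] z + ℘[L] c) + m := by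
  have h := fun c : L.NonLattice => L.exists_prod_formula c.2
  choose α β h using h
  obtain ⟨k, l, m, hk⟩ := exists_symmetric_form (fun z : L.NonLattice => ℘[L] z)
    α β L.surjective_nonLattice (fun s t hst => by
      have h1 : (t : ℂ) + s ∉ L.lattice := fun h => hst (L.weierstrassP_eq_of_add_mem h).symm
      have h2 : (t : ℂ) - s ∉ L.lattice := fun h => hst (L.weierstrassP_eq_of_sub_mem h).symm
      have h3 : (s : ℂ) + t ∉ L.lattice := by rwa [add_comm]
      have h4 : (s : ℂ) - t ∉ L.lattice := fun h => h2 (by rw [← neg_sub]; exact neg_mem h)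
      have e1 := h s t t.2 h1 h2
      have e2 := h t s s.2 h3 h4
      rw [add_comm (s : ℂ) t, ← neg_sub (t : ℂ) s, L.weierstrassP_neg] at e2
      linear_combination e2 - e1)
  refine ⟨k, l, m, fun c z hc hz h1 h2 => ?_⟩
  rw [h ⟨c, hc⟩ z hz h1 h2, (hk ⟨c, hc⟩).2]
  have := (hk ⟨c, hc⟩).1
  simp only at this ⊢
  linear_combination ℘[L] z * this

lemma eventually_add_notMem (w c : ℂ) : ∀ᶠ z in 𝓝[≠] w, z + c ∉ L.lattice := by
  have h1 : Tendsto (fun z => z + c) (𝓝 w) (𝓝 (w + c)) := by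
    exact (continuous_id.add continuous_const).continuousAt
  have h2 := h1.eventually (L.compl_lattice_sdiff_singleton_mem_nhds (w + c))
  filter_upwards [h2.filter_mono nhdsWithin_le_nhds, self_mem_nhdsWithin] with z hz hzw hmem
  exact hz ⟨hmem, fun h => hzw (by simpa using h)⟩

lemma eventually_sub_notMem (w c : ℂ) : ∀ᶠ z in 𝓝[≠] w, z - c ∉ L.lattice := by
  simpa [sub_eq_add_neg] using L.eventually_add_notMem w (-c)

lemma eventually_notMem (w : ℂ) : ∀ᶠ z in 𝓝[≠] w, z ∉ L.lattice := by
  simpa using L.eventually_add_notMem w 0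

lemma eventually_ne (w c : ℂ) : ∀ᶠ z in 𝓝[≠] w, ℘[L] z ≠ c := by
  have hm : ∀ z, MeromorphicAt (fun z => ℘[L] z - c) z := fun z =>
    (L.meromorphicAt_weierstrassP z).fun_sub (MeromorphicAt.const c z)
  have h0 : meromorphicOrderAt (fun z => ℘[L] z - c) 0 ≠ ⊤ := by
    intro h
    rw [meromorphicOrderAt_eq_top_iff] at h
    apply L.not_eventually_const c
    filter_upwards [h] with z hz
    exact sub_eq_zero.1 hz
  have h1 : meromorphicOrderAt (fun z => ℘[L] z - c) w ≠ ⊤ :=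
    MeromorphicOn.meromorphicOrderAt_ne_top_of_isPreconnected (U := Set.univ)
      (fun z _ => hm z) isPreconnected_univ (Set.mem_univ _) (Set.mem_univ w) h0
  filter_upwards [(meromorphicOrderAt_ne_top_iff_eventually_ne_zero (hm w)).1 h1] with z hz
  exact sub_ne_zero.1 hz

lemma weierstrassP_injective {c d : ℂ} (hc : c ∉ L.lattice) (hd : d ∉ L.lattice)
    (h : ℘[L] c = ℘[L] d) : c - d ∈ L.lattice ∨ c + d ∈ L.lattice := by
  by_contra! hcon
  obtain ⟨k, l, m, hk⟩ := L.exists_sum_form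
  have hcd : ∀ᶠ z in 𝓝[≠] (-c), ℘[L] (z + c) + ℘[L] (z + -c) = ℘[L] (z + d) + ℘[L] (z + -d) := by
    filter_upwards [L.eventually_notMem (-c), L.eventually_add_notMem (-c) c,
      L.eventually_sub_notMem (-c) c, L.eventually_add_notMem (-c) d,
      L.eventually_sub_notMem (-c) d, L.eventually_ne (-c) (℘[L] c)] with z h1 h2 h3 h4 h5 h6
    have e1 := hk c z hc h1 h2 h3
    have e2 := hk d z hd h1 h4 h5
    rw [← h] at e2
    rw [← e2] at e1
    simpa only [sub_eq_add_neg] using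
      mul_left_cancel₀ (pow_ne_zero 2 (sub_ne_zero.2 h6)) e1
  have hreg : 0 ≤ meromorphicOrderAt (fun z => ℘[L] (z + d) + ℘[L] (z + -d)) (-c) := by
    refine le_trans (le_min ?_ ?_)
      (meromorphicOrderAt_add (L.meromorphicAt_comp_add _ d) (L.meromorphicAt_comp_add _ (-d)))
    · exact L.order_comp_add_nonneg (fun h => hcon.1 (by
        rw [← neg_sub]; rw [neg_add_eq_sub] at h; exact neg_mem h))
    · exact L.order_comp_add_nonneg (fun h => hcon.2 (by
        have := neg_mem h
        rwa [← neg_add, neg_neg] at this))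
  rw [← meromorphicOrderAt_congr hcd] at hreg
  have hpole : meromorphicOrderAt (fun z => ℘[L] (z + c)) (-c) = ((-2 : ℤ) : WithTop ℤ) := by
    rw [order_comp_add_weierstrassP, neg_add_cancel, L.order_weierstrassP_zero]; rfl
  by_cases h2c : c + c ∈ L.lattice
  · have h1 : (fun z => ℘[L] (z + c) + ℘[L] (z + -c)) = fun z => 2 * ℘[L] (z + c) := by
      ext z
      have := L.weierstrassP_add_mem h2c (z + -c)
      rw [← this, show z + -c + (c + c) = z + c by ring]; ring
    rw [h1, fun_meromorphicOrderAt_mul (MeromorphicAt.const 2 _) (L.meromorphicAt_comp_add _ c),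
      hpole, (tendsto_ne_zero_iff_meromorphicOrderAt_eq_zero (MeromorphicAt.const (2 : ℂ) (-c))).1
        ⟨2, two_ne_zero, tendsto_const_nhds⟩, zero_add] at hreg
    exact absurd hreg (by exact_mod_cast (by norm_num : ¬ (0 : ℤ) ≤ -2))
  · have h2 : -c + -c ∉ L.lattice := fun h => h2c (by
      have := neg_mem h
      rwa [← neg_add, neg_neg] at this)
    have h3 := L.order_comp_add_nonneg h2
    have h4 := meromorphicOrderAt_add_eq_left_of_lt (f₁ := fun z => ℘[L] (z + c))
      (L.meromorphicAt_comp_add (-c) (-c)) (by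
        rw [hpole]
        exact lt_of_lt_of_le (by exact_mod_cast (by norm_num : (-2 : ℤ) < 0)) h3)
    have h5 : meromorphicOrderAt (fun z => ℘[L] (z + c) + ℘[L] (z + -c)) (-c) =
      ((-2 : ℤ) : WithTop ℤ) := h4.trans hpole
    rw [h5] at hreg
    exact absurd hreg (by exact_mod_cast (by norm_num : ¬ (0 : ℤ) ≤ -2))

end PeriodPair

namespace PeriodPair

variable (L : PeriodPair)

lemma eventually_punctured_of_notMem {f : ℂ → ℂ} {w : ℂ} (hf : ContinuousAt f w)
    (h : f w ∉ L.lattice) : ∀ᶠ z in 𝓝[≠] w, f z ∉ L.lattice :=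
  (hf.eventually (L.isClosed_lattice.isOpen_compl.mem_nhds h)).filter_mono nhdsWithin_le_nhds

/-- The coefficients governing the addition law of `℘`. -/
lemma exists_addition_law : ∃ b2 b4 b6 b8 : ℂ, 4 * b8 = b2 * b6 - b4 ^ 2 ∧
    (∀ c z, c ∉ L.lattice → z ∉ L.lattice → z + c ∉ L.lattice → z - c ∉ L.lattice →
      (℘[L] z - ℘[L] c) ^ 2 * (℘[L] (z + c) + ℘[L] (z - c)) =
        2 * ℘[L] z * ℘[L] c * (℘[L] z + ℘[L] c) + b2 * (℘[L] z * ℘[L] c) +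
          b4 * (℘[L] z + ℘[L] c) + b6) ∧
    (∀ c z, c ∉ L.lattice → z ∉ L.lattice → z + c ∉ L.lattice → z - c ∉ L.lattice →
      (℘[L] z - ℘[L] c) ^ 2 * (℘[L] (z + c) * ℘[L] (z - c)) =
        (℘[L] z * ℘[L] c) ^ 2 - b4 * (℘[L] z * ℘[L] c) - b6 * (℘[L] z + ℘[L] c) - b8) ∧
    (∀ c, c ∉ L.lattice → c + c ∈ L.lattice →
      4 * ℘[L] c ^ 3 + b2 * ℘[L] c ^ 2 + 2 * b4 * ℘[L] c + b6 = 0) := by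
  obtain ⟨k, l, m, hs⟩ := L.exists_sum_form
  obtain ⟨k', l', m', hp⟩ := L.exists_prod_form
  have hy : ∀ y, y ∉ L.lattice → (l + k') * ℘[L] y + (m + l') = 0 := by
    intro y hy
    have h2y : ∀ᶠ z in 𝓝[≠] (0 : ℂ), z + z + y ∉ L.lattice :=
      L.eventually_punctured_of_notMem (f := fun z => z + z + y) (by fun_prop) (by simpa using hy)
    obtain ⟨z, h1, h2, h3, h4, h5⟩ := ((L.eventually_notMem 0).and
      ((L.eventually_add_notMem 0 y).and ((L.eventually_sub_notMem 0 y).and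
      ((L.eventually_add_notMem 0 (y + y)).and h2y)))).exists
    have hne : ℘[L] z ≠ ℘[L] (z + y) := by
      intro h
      rcases L.weierstrassP_injective h1 h2 h with h | h
      · rw [show z - (z + y) = -y by ring] at h
        exact hy (by simpa using h)
      · exact h5 (by rwa [show z + z + y = z + (z + y) by ring])
    have a1 := hs y z hy h1 h2 h3
    have p1 := hp y z hy h1 h2 h3
    have a2 := hs y (z + y) hy h2 (by rwa [add_assoc]) (by simpa using h1)
    have p2 := hp y (z + y) hy h2 (by rwa [add_assoc]) (by simpa using h1)
    rw [add_sub_cancel_right] at a2 p2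
    have key : (℘[L] z - ℘[L] (z + y)) * ((l + k') * ℘[L] y + (m + l')) = 0 := by
      linear_combination ℘[L] (z + y) * a1 - p1 - ℘[L] z * a2 + p2
    exact (mul_eq_zero.1 key).resolve_left (sub_ne_zero.2 hne)
  obtain ⟨y0, hy0, e0⟩ := L.exists_weierstrassP_eq 0
  obtain ⟨y1, hy1, e1⟩ := L.exists_weierstrassP_eq 1
  have hl' : m + l' = 0 := by simpa [e0] using hy y0 hy0
  have hk' : l + k' = 0 := by simpa [e1, hl'] using hy y1 hy1
  obtain rfl : k' = -l := by linear_combination hk'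
  obtain rfl : l' = -m := by linear_combination hl'
  have htwo : ∀ e, e ∉ L.lattice → e + e ∈ L.lattice →
      4 * ℘[L] e ^ 3 + k * ℘[L] e ^ 2 + 2 * l * ℘[L] e + m = 0 ∧ 4 * (-m') = k * m - l ^ 2 := by
    intro e he h2e
    set E := ℘[L] e with hE
    set q := 4 * E ^ 3 + k * E ^ 2 + 2 * l * E + m with hq
    set r := k * m - l ^ 2 + 4 * m' with hr
    have h1 : ∀ X, X ≠ E → q * (4 * X ^ 3 + k * X ^ 2 + 2 * l * X + m) - r * (X - E) ^ 2 = 0 := by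
      intro X hX
      obtain ⟨z, hz, rfl⟩ := L.exists_weierstrassP_eq X
      have h1 : z + e ∉ L.lattice := fun h => hX (L.weierstrassP_eq_of_add_mem h)
      have h2 : z - e ∉ L.lattice := fun h => hX (L.weierstrassP_eq_of_sub_mem h)
      have a1 := hs e z he hz h1 h2
      have p1 := hp e z he hz h1 h2
      have h3 : ℘[L] (z + e) = ℘[L] (z - e) := by
        rw [← L.weierstrassP_add_mem h2e (z - e)]
        congr 1; ring
      rw [h3, ← hE] at a1 p1
      have a2 : (2 * ℘[L] z * E * (℘[L] z + E) + k * (℘[L] z * E) + l * (℘[L] z + E) + m) ^ 2 =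
          4 * (℘[L] z - E) ^ 2 * ((℘[L] z * E) ^ 2 + -l * (℘[L] z * E) + -m * (℘[L] z + E) + m') := by
        rw [← a1, ← p1]; ring
      rw [hq, hr]
      linear_combination a2
    have g1 := h1 (E + 1) (by simp)
    have g2 := h1 (E - 1) (by simp)
    have g3 := h1 (E + 2) (by simp)
    have g4 := h1 (E - 2) (by simp)
    have hq0 : q = 0 := by
      have : 48 * q = 0 := by linear_combination g3 - g4 - 2 * g1 + 2 * g2
      simpa using this
    rw [hq0] at g1
    exact ⟨hq0, by linear_combination g1⟩
  have hhalf := htwo (L.ω₁ / 2) L.ω₁_div_two_notMem_lattice (by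
    rw [add_halves]; exact L.ω₁_mem_lattice)
  refine ⟨k, l, m, -m', hhalf.2, hs, fun c z h1 h2 h3 h4 => ?_, fun c h1 h2 => (htwo c h1 h2).1⟩
  rw [hp c z h1 h2 h3 h4]
  ring

/-- The `x`-coordinate on the complex torus. -/
noncomputable def xcoord (P : ℂ ⧸ L.lattice) : ℂ :=
  ℘[L] P.out

lemma xcoord_mk (z : ℂ) : L.xcoord (Submodule.Quotient.mk z) = ℘[L] z := by
  unfold xcoord
  have h : (Submodule.Quotient.mk (Quotient.out (Submodule.Quotient.mk z : ℂ ⧸ L.lattice)) :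
    ℂ ⧸ L.lattice) = Submodule.Quotient.mk z := Quotient.out_eq _
  rw [Submodule.Quotient.eq] at h
  have := L.weierstrassP_add_mem h z
  rw [← this]
  congr 1; ring

lemma mk_eq_zero' {z : ℂ} : (Submodule.Quotient.mk z : ℂ ⧸ L.lattice) = 0 ↔ z ∈ L.lattice :=
  Submodule.Quotient.mk_eq_zero _

lemma disc_eq {b2 b4 b6 b8 x y z : ℂ} (rel : 4 * b8 = b2 * b6 - b4 ^ 2) (hxy : x ≠ y) (hxz : x ≠ z)
    (hyz : y ≠ z) (hx : 4 * x ^ 3 + b2 * x ^ 2 + 2 * b4 * x + b6 = 0)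
    (hy : 4 * y ^ 3 + b2 * y ^ 2 + 2 * b4 * y + b6 = 0)
    (hz : 4 * z ^ 3 + b2 * z ^ 2 + 2 * b4 * z + b6 = 0) :
    -b2 ^ 2 * b8 - 8 * b4 ^ 3 - 27 * b6 ^ 2 + 9 * b2 * b4 * b6 ≠ 0 := by
  have h1 : 4 * (x ^ 2 + x * y + y ^ 2) + b2 * (x + y) + 2 * b4 = 0 :=
    mul_left_cancel₀ (sub_ne_zero.2 hxy) (by linear_combination hx - hy)
  have h2 : 4 * (x ^ 2 + x * z + z ^ 2) + b2 * (x + z) + 2 * b4 = 0 :=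
    mul_left_cancel₀ (sub_ne_zero.2 hxz) (by linear_combination hx - hz)
  have h3 : 4 * (x + y + z) + b2 = 0 :=
    mul_left_cancel₀ (sub_ne_zero.2 hyz) (by linear_combination h1 - h2)
  obtain rfl : b2 = -4 * (x + y + z) := by linear_combination h3
  obtain rfl : b4 = 2 * (x * y + x * z + y * z) := by linear_combination h1 / 2
  obtain rfl : b6 = -4 * (x * y * z) := by linear_combination hx
  obtain rfl : b8 = 4 * (x + y + z) * (x * y * z) - (x * y + x * z + y * z) ^ 2 := by
    linear_combination rel / 4
  have h4 : (4 * ((x - y) * (x - z) * (y - z))) ^ 2 ≠ 0 :=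
    pow_ne_zero _ (mul_ne_zero (by norm_num : (4 : ℂ) ≠ 0)
      (mul_ne_zero (mul_ne_zero (sub_ne_zero.2 hxy) (sub_ne_zero.2 hxz)) (sub_ne_zero.2 hyz)))
  intro h
  apply h4
  linear_combination h

/-- The complex torus as a `KummerModel`. -/
lemma exists_kummerModel : ∃ D : KummerModel (ℂ ⧸ L.lattice) ℂ, D.x = L.xcoord := by
  obtain ⟨b2, b4, b6, b8, rel, hs, hp, ht⟩ := L.exists_addition_law
  refine ⟨{ x := L.xcoord, b2 := b2, b4 := b4, b6 := b6, b8 := b8, rel := rel, disc := ?_,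
            x_eq := ?_, surj := ?_, sum_eq := ?_, prod_eq := ?_, dup := ?_, two_tors := ?_ }, rfl⟩
  · have m1 := L.ω₁_div_two_notMem_lattice
    have m2 := L.ω₂_div_two_notMem_lattice
    have key : ∀ a b : ℚ, ¬(a.den = 1 ∧ b.den = 1) → (a : ℂ) * L.ω₁ + b * L.ω₂ ∉ L.lattice :=
      fun a b h h' => h (L.mul_ω₁_add_mul_ω₂_mem_lattice.1 h')
    have m3 : L.ω₁ / 2 + L.ω₂ / 2 ∉ L.lattice := by
      have := key (1 / 2) (1 / 2) (by norm_num)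
      push_cast at this
      rwa [show (1 / 2 : ℂ) * L.ω₁ + 1 / 2 * L.ω₂ = L.ω₁ / 2 + L.ω₂ / 2 by ring] at this
    have m4 : L.ω₁ / 2 - L.ω₂ / 2 ∉ L.lattice := fun h => m3 (by
      have := add_mem h L.ω₂_mem_lattice
      rwa [show L.ω₁ / 2 - L.ω₂ / 2 + L.ω₂ = L.ω₁ / 2 + L.ω₂ / 2 by ring] at this)
    have d1 := ht _ m1 (by rw [add_halves]; exact L.ω₁_mem_lattice)
    have d2 := ht _ m2 (by rw [add_halves]; exact L.ω₂_mem_lattice)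
    have d3 := ht _ m3 (by
      have := add_mem L.ω₁_mem_lattice L.ω₂_mem_lattice
      rwa [show L.ω₁ / 2 + L.ω₂ / 2 + (L.ω₁ / 2 + L.ω₂ / 2) = L.ω₁ + L.ω₂ by ring])
    refine disc_eq rel ?_ ?_ ?_ d1 d2 d3
    · intro h
      rcases L.weierstrassP_injective m1 m2 h with h | h
      exacts [m4 h, m3 h]
    · intro h
      rcases L.weierstrassP_injective m1 m3 h with h | h
      · exact m2 (by simpa using h)
      · exact m2 (by
          have := sub_mem h L.ω₁_mem_lattice
          rwa [show L.ω₁ / 2 + (L.ω₁ / 2 + L.ω₂ / 2) - L.ω₁ = L.ω₂ / 2 by ring] at this)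
    · intro h
      rcases L.weierstrassP_injective m2 m3 h with h | h
      · exact m1 (by simpa using h)
      · exact m1 (by
          have := sub_mem h L.ω₂_mem_lattice
          rwa [show L.ω₂ / 2 + (L.ω₁ / 2 + L.ω₂ / 2) - L.ω₂ = L.ω₁ / 2 by ring] at this)
  · intro P S
    obtain ⟨z, rfl⟩ := Submodule.Quotient.mk_surjective _ P
    obtain ⟨c, rfl⟩ := Submodule.Quotient.mk_surjective _ S
    intro hz hc
    rw [ne_eq, mk_eq_zero'] at hz hc
    rw [xcoord_mk, xcoord_mk, ← Submodule.Quotient.mk_neg, Submodule.Quotient.eq,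
      Submodule.Quotient.eq, sub_neg_eq_add]
    exact ⟨L.weierstrassP_injective hz hc,
      fun h => h.elim L.weierstrassP_eq_of_sub_mem L.weierstrassP_eq_of_add_mem⟩
  · intro c
    obtain ⟨z, hz, rfl⟩ := L.exists_weierstrassP_eq c
    exact ⟨Submodule.Quotient.mk z, fun h => hz (L.mk_eq_zero'.1 h), L.xcoord_mk z⟩
  · intro P S
    obtain ⟨z, rfl⟩ := Submodule.Quotient.mk_surjective _ P
    obtain ⟨c, rfl⟩ := Submodule.Quotient.mk_surjective _ S
    rw [← Submodule.Quotient.mk_add, ← Submodule.Quotient.mk_sub]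
    simp only [ne_eq, mk_eq_zero', xcoord_mk]
    exact fun hz hc => hs c z hc hz
  · intro P S
    obtain ⟨z, rfl⟩ := Submodule.Quotient.mk_surjective _ P
    obtain ⟨c, rfl⟩ := Submodule.Quotient.mk_surjective _ S
    rw [← Submodule.Quotient.mk_add, ← Submodule.Quotient.mk_sub]
    simp only [ne_eq, mk_eq_zero', xcoord_mk]
    exact fun hz hc => hp c z hc hz
  · intro P
    obtain ⟨c, rfl⟩ := Submodule.Quotient.mk_surjective _ P
    rw [← Submodule.Quotient.mk_add]
    simp only [ne_eq, mk_eq_zero', xcoord_mk]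
    intro h2c
    have hc : c ∉ L.lattice := fun h => h2c (add_mem h h)
    have cp := L.continuousAt_weierstrassP hc
    have ca := L.continuousAt_comp_add (z := c) (c := c) h2c
    have key := eq_of_eventuallyEq_punctured (z := c)
      (f := fun z => (2 * ℘[L] z * ℘[L] c * (℘[L] z + ℘[L] c) + b2 * (℘[L] z * ℘[L] c) +
        b4 * (℘[L] z + ℘[L] c) + b6) * ℘[L] (z + c) -
        ((℘[L] z * ℘[L] c) ^ 2 - b4 * (℘[L] z * ℘[L] c) - b6 * (℘[L] z + ℘[L] c) - b8))
      (g := fun z => (℘[L] z - ℘[L] c) ^ 2 * ℘[L] (z + c) ^ 2)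
      (by fun_prop) (by fun_prop) (by
        filter_upwards [L.eventually_punctured_of_notMem continuousAt_id hc,
          L.eventually_add_notMem c c, L.eventually_sub_notMem c c] with z h1 h2 h3
        rw [← hs c z hc h1 h2 h3, ← hp c z hc h1 h2 h3]
        ring)
    linear_combination key
  · intro P
    obtain ⟨c, rfl⟩ := Submodule.Quotient.mk_surjective _ P
    rw [← Submodule.Quotient.mk_add]
    simp only [ne_eq, mk_eq_zero', xcoord_mk]
    exact fun hc h2c => ht c hc h2c

end PeriodPair

namespace PeriodPair

variable (L : PeriodPair)

lemma tendsto_sq_mul_weierstrassP : Tendsto (fun z => z ^ 2 * ℘[L] z) (𝓝[≠] 0) (𝓝 1) := by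
  have h1 : ContinuousAt (L.weierstrassPExcept 0) 0 := by
    refine ((L.differentiableOn_weierstrassPExcept 0).differentiableAt ?_).continuousAt
    exact L.compl_lattice_sdiff_singleton_mem_nhds 0
  have h2 : ContinuousAt (fun z : ℂ => z ^ 2 * (L.weierstrassPExcept 0) z + 1) 0 := by fun_prop
  have h3 : Tendsto (fun z : ℂ => z ^ 2 * (L.weierstrassPExcept 0) z + 1) (𝓝[≠] 0) (𝓝 1) := by
    simpa [ContinuousAt] using h2.tendsto.mono_left nhdsWithin_le_nhds
  refine h3.congr' ?_
  filter_upwards [self_mem_nhdsWithin] with z hz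
  have hz : z ≠ 0 := hz
  have := L.weierstrassPExcept_add 0 z
  rw [← this]
  simp
  field_simp

lemma tendsto_comp_mul_div {γ : ℂ} (hγ : γ ≠ 0) :
    Tendsto (fun z => ℘[L] (γ * z) / ℘[L] z) (𝓝[≠] 0) (𝓝 (1 / γ ^ 2)) := by
  have h1 : Tendsto (fun z : ℂ => γ * z) (𝓝[≠] 0) (𝓝[≠] 0) := by
    refine tendsto_nhdsWithin_iff.2 ⟨?_, ?_⟩
    · have : ContinuousAt (fun z : ℂ => γ * z) 0 := by fun_prop
      simpa [ContinuousAt] using this.tendsto.mono_left nhdsWithin_le_nhds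
    · filter_upwards [self_mem_nhdsWithin] with z hz
      exact mul_ne_zero hγ hz
  have h2 := (L.tendsto_sq_mul_weierstrassP.comp h1).div
    (L.tendsto_sq_mul_weierstrassP.const_mul (γ ^ 2)) (by simpa using hγ)
  rw [mul_one] at h2
  refine h2.congr' ?_
  filter_upwards [self_mem_nhdsWithin] with z hz
  have hz : z ≠ 0 := hz
  simp only [Function.comp, Pi.div_apply]
  by_cases h : ℘[L] z = 0
  · simp [h]
  · field_simp

lemma order_comp_mul {γ : ℂ} (hγ : γ ≠ 0) (z : ℂ) :
    meromorphicOrderAt (fun z => ℘[L] (γ * z)) z = meromorphicOrderAt ℘[L] (γ * z) := by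
  refine meromorphicOrderAt_comp_of_deriv_ne_zero (f := ℘[L]) (g := fun z => γ * z) (by fun_prop) ?_
  rw [deriv_const_mul _ differentiableAt_id]
  simpa using hγ

lemma order_sub_nonneg {z : ℂ} (hz : z ∉ L.lattice) (c : ℂ) :
    0 ≤ meromorphicOrderAt (fun w => ℘[L] w - c) z :=
  ((L.analyticOnNhd_weierstrassP z hz).sub analyticAt_const).meromorphicOrderAt_nonneg

lemma order_sub_ge (z c : ℂ) :
    ((-2 : ℤ) : WithTop ℤ) ≤ meromorphicOrderAt (fun w => ℘[L] w - c) z := by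
  have h := meromorphicOrderAt_add (L.meromorphicAt_weierstrassP z) (MeromorphicAt.const (-c) z)
  refine le_trans (le_min (L.order_weierstrassP_ge z) ?_) (h.trans_eq ?_)
  · refine le_trans ?_ (analyticAt_const (v := -c) (𝕜 := ℂ) (x := z)).meromorphicOrderAt_nonneg
    exact_mod_cast (by norm_num : (-2 : ℤ) ≤ 0)
  · congr 1

lemma meromorphicAt_sub (z c : ℂ) : MeromorphicAt (fun w => ℘[L] w - c) z :=
  (L.meromorphicAt_weierstrassP z).fun_sub (MeromorphicAt.const c z)

lemma mk_out (P : ℂ ⧸ L.lattice) : (Submodule.Quotient.mk P.out : ℂ ⧸ L.lattice) = P :=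
  Quotient.out_eq _

lemma xcoord_mk_add (z : ℂ) (P : ℂ ⧸ L.lattice) :
    L.xcoord (Submodule.Quotient.mk z + P) = ℘[L] (z + P.out) := by
  conv_lhs => rw [← L.mk_out P, ← Submodule.Quotient.mk_add]
  exact L.xcoord_mk _

/-- `℘ (γ z)` times the product clearing its poles is a polynomial in `℘`. -/
lemma exists_mul_polynomial {γ : ℂ} (hγ : γ ≠ 0) (hL : ∀ l ∈ L.lattice, γ * l ∈ L.lattice)
    (C : Finset (ℂ ⧸ L.lattice))
    (hC : ∀ z : ℂ, (Submodule.Quotient.mk z : ℂ ⧸ L.lattice) ∈ C ↔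
      z ∉ L.lattice ∧ γ * z ∈ L.lattice) :
    ∃ U : Polynomial ℂ, U.natDegree ≤ C.card + 1 ∧ U.coeff (C.card + 1) = 1 / γ ^ 2 ∧
      ∀ z, z ∉ L.lattice → γ * z ∉ L.lattice →
        ℘[L] (γ * z) * ∏ u ∈ C, (℘[L] z - L.xcoord u) = U.eval (℘[L] z) := by
  classical
  have hmγ : ∀ z, MeromorphicAt (fun z => ℘[L] (γ * z)) z := fun z =>
    (L.meromorphicAt_weierstrassP (γ * z)).comp_analyticAt (g := fun z => γ * z) (by fun_prop)
  have hms : ∀ u z, MeromorphicAt (fun z => ℘[L] z - L.xcoord u) z := fun u z =>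
    L.meromorphicAt_sub z _
  have hmp : ∀ (S : Finset (ℂ ⧸ L.lattice)) z,
      MeromorphicAt (fun z => ∏ u ∈ S, (℘[L] z - L.xcoord u)) z := fun S z => by
    exact MeromorphicAt.fun_prod (fun u _ => hms u z)
  have hop : ∀ (S : Finset (ℂ ⧸ L.lattice)) z, z ∉ L.lattice →
      0 ≤ meromorphicOrderAt (fun z => ∏ u ∈ S, (℘[L] z - L.xcoord u)) z := fun S z hz => by
    rw [meromorphicOrderAt_fun_prod (fun u _ => hms u z)]
    exact Finset.sum_nonneg fun u _ => L.order_sub_nonneg hz _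
  have hof : ∀ z, meromorphicOrderAt
      (fun z => ℘[L] (γ * z) * ∏ u ∈ C, (℘[L] z - L.xcoord u)) z =
      meromorphicOrderAt ℘[L] (γ * z) +
        meromorphicOrderAt (fun z => ∏ u ∈ C, (℘[L] z - L.xcoord u)) z := fun z => by
    rw [fun_meromorphicOrderAt_mul (hmγ z) (hmp C z), L.order_comp_mul hγ]
  obtain ⟨U, hU, hUe, hUt⟩ := L.exists_polynomial (C.card + 1)
    (f := fun z => ℘[L] (γ * z) * ∏ u ∈ C, (℘[L] z - L.xcoord u))
    (fun z => (hmγ z).fun_mul (hmp C z))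
    (fun l hl z => by
      simp only [mul_add, L.weierstrassP_add_mem (hL l hl), L.weierstrassP_add_mem hl])
    (fun z => by simp [mul_neg])
    (fun z hz => by
      rw [hof]
      by_cases hγz : γ * z ∈ L.lattice
      · have hu : (Submodule.Quotient.mk z : ℂ ⧸ L.lattice) ∈ C := (hC z).2 ⟨hz, hγz⟩
        have hux : L.xcoord (Submodule.Quotient.mk z) = ℘[L] z := L.xcoord_mk z
        have h2 : ((2 : ℤ) : WithTop ℤ) ≤
            meromorphicOrderAt (fun z => ∏ u ∈ C, (℘[L] z - L.xcoord u)) z := by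
          by_cases h2z : z + z ∈ L.lattice
          · have h1 : (fun w => ∏ u ∈ C, (℘[L] w - L.xcoord u)) =
                fun w => (℘[L] w - ℘[L] z) *
                  ∏ u ∈ C.erase (Submodule.Quotient.mk z), (℘[L] w - L.xcoord u) := by
              ext w
              rw [← Finset.mul_prod_erase C _ hu, hux]
            rw [h1, fun_meromorphicOrderAt_mul (L.meromorphicAt_sub _ _) (hmp _ _)]
            exact le_add_of_le_of_nonneg (L.order_sub_self_ge_two hz h2z) (hop _ z hz)
          · have hnz : -z ∉ L.lattice := by simpa using hz
            have hv : (Submodule.Quotient.mk (-z) : ℂ ⧸ L.lattice) ∈ 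
                C.erase (Submodule.Quotient.mk z) := by
              refine Finset.mem_erase.2 ⟨fun h => h2z ?_, (hC _).2 ⟨hnz, by simpa using hγz⟩⟩
              rw [Submodule.Quotient.eq] at h
              have := neg_mem h
              rwa [show -(-z - z) = z + z by ring] at this
            have hvx : L.xcoord (Submodule.Quotient.mk (-z)) = ℘[L] z := by
              rw [L.xcoord_mk, L.weierstrassP_neg]
            have h1 : (fun w => ∏ u ∈ C, (℘[L] w - L.xcoord u)) =
                fun w => (℘[L] w - ℘[L] z) * ((℘[L] w - ℘[L] z) *
                  ∏ u ∈ (C.erase (Submodule.Quotient.mk z)).erase (Submodule.Quotient.mk (-z)),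
                    (℘[L] w - L.xcoord u)) := by
              ext w
              rw [← Finset.mul_prod_erase C _ hu, ← Finset.mul_prod_erase _ _ hv, hux, hvx]
            rw [h1, fun_meromorphicOrderAt_mul (L.meromorphicAt_sub _ _)
              ((L.meromorphicAt_sub _ _).fun_mul (hmp _ _)),
              fun_meromorphicOrderAt_mul (L.meromorphicAt_sub _ _) (hmp _ _)]
            refine le_trans ?_ (add_le_add (L.order_sub_self_pos hz)
              (le_add_of_le_of_nonneg (L.order_sub_self_pos hz) (hop _ z hz)))
            exact_mod_cast le_rfl
        refine le_trans ?_ (add_le_add (L.order_weierstrassP_ge (γ * z)) h2)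
        exact_mod_cast le_rfl
      · exact add_nonneg (L.analyticOnNhd_weierstrassP _ hγz).meromorphicOrderAt_nonneg
          (hop C z hz))
    (by
      rw [hof]
      have h1 : ((-(2 * (C.card : ℤ)) : ℤ) : WithTop ℤ) ≤
          meromorphicOrderAt (fun z => ∏ u ∈ C, (℘[L] z - L.xcoord u)) 0 := by
        rw [meromorphicOrderAt_fun_prod (fun u _ => hms u 0)]
        have h2 := Finset.card_nsmul_le_sum C
          (fun u => meromorphicOrderAt (fun z => ℘[L] z - L.xcoord u) 0) ((-2 : ℤ) : WithTop ℤ)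
          (fun u _ => L.order_sub_ge 0 _)
        refine le_trans (le_of_eq ?_) h2
        rw [← WithTop.coe_nsmul]
        congr 1
        simp
        ring
      refine le_trans (le_of_eq ?_) (add_le_add (L.order_weierstrassP_ge (γ * 0)) h1)
      rw [← WithTop.coe_add]
      congr 1
      push_cast
      ring)
  refine ⟨U, hU, ?_, fun z hz hγz => ?_⟩
  · have h1 := (L.tendsto_comp_mul_div hγ).mul
      (tendsto_finsetProd C fun u _ => L.tendsto_sub_div_weierstrassP (L.xcoord u))
    rw [Finset.prod_const_one, mul_one] at h1
    refine tendsto_nhds_unique hUt (h1.congr fun z => ?_)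
    rw [Finset.prod_div_distrib, Finset.prod_const, pow_succ' , mul_div_mul_comm]
  · have c1 := L.continuousAt_weierstrassP hz
    have c2 : ContinuousAt (fun z => ℘[L] (γ * z)) z :=
      ContinuousAt.comp (f := fun w => γ * w) (g := ℘[L]) (L.continuousAt_weierstrassP hγz)
        (by fun_prop)
    refine eq_of_eventuallyEq_punctured (f := fun z => ℘[L] (γ * z) *
      ∏ u ∈ C, (℘[L] z - L.xcoord u)) (g := fun z => U.eval (℘[L] z)) ?_ ?_ (hUe z)
    · exact c2.mul (tendsto_finsetProd C fun u _ => (c1.sub continuousAt_const))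
    · exact U.continuous.continuousAt.comp c1

end PeriodPair

namespace PeriodPair

variable (L : PeriodPair)

/-- Multiplication by a complex number preserving the lattice. -/
noncomputable def mulHom (γ : ℂ) (hL : ∀ l ∈ L.lattice, γ * l ∈ L.lattice) :
    (ℂ ⧸ L.lattice) →+ (ℂ ⧸ L.lattice) :=
  (Submodule.mapQ L.lattice L.lattice (LinearMap.mulLeft ℤ γ) hL).toAddMonoidHom

@[simp] lemma mulHom_mk (γ : ℂ) (hL : ∀ l ∈ L.lattice, γ * l ∈ L.lattice) (z : ℂ) :
    L.mulHom γ hL (Submodule.Quotient.mk z) = Submodule.Quotient.mk (γ * z) := rfl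

lemma mulHom_surjective {γ : ℂ} (hγ : γ ≠ 0) (hL : ∀ l ∈ L.lattice, γ * l ∈ L.lattice) :
    Function.Surjective (L.mulHom γ hL) := fun P => by
  obtain ⟨z, rfl⟩ := Submodule.Quotient.mk_surjective _ P
  exact ⟨Submodule.Quotient.mk (z / γ), by rw [mulHom_mk]; congr 1; field_simp⟩

lemma isMult {D : KummerModel (ℂ ⧸ L.lattice) ℂ} (hD : D.x = L.xcoord) {γ : ℂ} (hγ : γ ≠ 0)
    (hL : ∀ l ∈ L.lattice, γ * l ∈ L.lattice) {C : Finset (ℂ ⧸ L.lattice)}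
    (hC : ∀ u, u ∈ C ↔ u ≠ 0 ∧ L.mulHom γ hL u = 0) : D.IsMult (L.mulHom γ hL) C γ := by
  classical
  refine ⟨hC, hγ, ?_⟩
  rw [hD]
  have hC' : ∀ z : ℂ, (Submodule.Quotient.mk z : ℂ ⧸ L.lattice) ∈ C ↔
      z ∉ L.lattice ∧ γ * z ∈ L.lattice := fun z => by
    rw [hC, mulHom_mk, ne_eq, mk_eq_zero', mk_eq_zero']
  obtain ⟨U, hU, hUc, hUe⟩ := L.exists_mul_polynomial hγ hL C hC'
  have hzγ : ∀ z, γ * z ∉ L.lattice → z ∉ L.lattice := fun z h h' => h (hL z h')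
  have hout : ∀ u ∈ C, u.out ∉ L.lattice ∧ γ * u.out ∈ L.lattice := fun u hu => by
    rw [← hC', L.mk_out]; exact hu
  have houtinj : ∀ u v : ℂ ⧸ L.lattice, u.out - v.out ∈ L.lattice → u = v := fun u v h => by
    rw [← L.mk_out u, ← L.mk_out v, Submodule.Quotient.eq]; exact h
  have hsout : ∀ s, γ * s ∉ L.lattice → ∀ u ∈ C, s + u.out ∉ L.lattice := fun s hs u hu h => hs (by
    have := sub_mem (hL _ h) (hout u hu).2
    rwa [mul_add, add_sub_cancel_right] at this)
  set V : Polynomial ℂ := ∏ u ∈ C, (Polynomial.X - Polynomial.C (L.xcoord u)) with hV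
  have hVe : ∀ x, V.eval x = ∏ u ∈ C, (x - L.xcoord u) := fun x => by
    simp [hV, Polynomial.eval_prod]
  have hVd : V.natDegree = C.card := by
    rw [hV, Polynomial.natDegree_finsetProd_X_sub_C_eq_card]
  have hgen : ∀ s, γ * s ∉ L.lattice → γ * (s + s) ∉ L.lattice → ∀ z, γ * z ∉ L.lattice →
      (℘[L] (γ * z) - ℘[L] (γ * s)) * (γ ^ 2 * ∏ u ∈ C, (℘[L] z - L.xcoord u)) =
        (℘[L] z - ℘[L] s) * ∏ u ∈ C, (℘[L] z - ℘[L] (s + u.out)) := by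
    intro s hs h2s z hz
    set W : Polynomial ℂ := Polynomial.C (γ ^ 2) * (U - Polynomial.C (℘[L] (γ * s)) * V) with hW
    set R : Polynomial ℂ := (Polynomial.X - Polynomial.C (℘[L] s)) *
      ∏ u ∈ C, (Polynomial.X - Polynomial.C (℘[L] (s + u.out))) with hR
    have hRm : R.Monic := (Polynomial.monic_X_sub_C _).mul
      (Polynomial.monic_prod_of_monic _ _ fun u _ => Polynomial.monic_X_sub_C _)
    have hRd : R.natDegree = C.card + 1 := by
      rw [hR, Polynomial.Monic.natDegree_mul (Polynomial.monic_X_sub_C _)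
        (Polynomial.monic_prod_of_monic _ _ fun u _ => Polynomial.monic_X_sub_C _),
        Polynomial.natDegree_X_sub_C, Polynomial.natDegree_finsetProd_X_sub_C_eq_card, add_comm]
    have hWd : W.natDegree ≤ C.card + 1 := by
      refine (Polynomial.natDegree_C_mul_le _ _).trans
        ((Polynomial.natDegree_sub_le _ _).trans (max_le hU ?_))
      exact (Polynomial.natDegree_C_mul_le _ _).trans (hVd.le.trans (Nat.le_succ _))
    have hWc : W.coeff (C.card + 1) = 1 := by
      rw [hW, Polynomial.coeff_C_mul, Polynomial.coeff_sub, hUc, Polynomial.coeff_C_mul,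
        Polynomial.coeff_eq_zero_of_natDegree_lt (by omega : V.natDegree < C.card + 1)]
      field_simp
      simp
    have hWe : ∀ z, γ * z ∉ L.lattice → W.eval (℘[L] z) =
        (℘[L] (γ * z) - ℘[L] (γ * s)) * (γ ^ 2 * ∏ u ∈ C, (℘[L] z - L.xcoord u)) := by
      intro z hz
      rw [hW, Polynomial.eval_mul, Polynomial.eval_C, Polynomial.eval_sub, Polynomial.eval_mul,
        Polynomial.eval_C, ← hUe z (hzγ z hz) hz, hVe]
      ring
    have hWR : W = R := by
      by_contra hne
      have hlt : (W - R).degree < ((C.card + 1 : ℕ) : WithBot ℕ) := by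
        rw [Polynomial.degree_lt_iff_coeff_zero]
        intro m hm
        rcases hm.lt_or_eq with hm | rfl
        · rw [Polynomial.coeff_sub, Polynomial.coeff_eq_zero_of_natDegree_lt (hWd.trans_lt hm),
            Polynomial.coeff_eq_zero_of_natDegree_lt (hRd.trans_lt hm), sub_zero]
        · rw [Polynomial.coeff_sub, hWc, ← hRd, hRm.coeff_natDegree, sub_self]
      refine hne (sub_eq_zero.1 (Polynomial.eq_zero_of_degree_lt_of_eval_finset_eq_zero
        (insert (℘[L] s) (C.image fun u => ℘[L] (s + u.out))) ?_ ?_))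
      · rw [Finset.card_insert_of_notMem, Finset.card_image_of_injOn]
        · exact hlt
        · intro u hu v hv huv
          rcases L.weierstrassP_injective (hsout s hs u hu) (hsout s hs v hv) huv with h | h
          · exact houtinj u v (by rwa [add_sub_add_left_eq_sub] at h)
          · refine absurd ?_ h2s
            have := sub_mem (sub_mem (hL _ h) (hout u hu).2) (hout v hv).2
            rwa [show γ * (s + u.out + (s + v.out)) - γ * u.out - γ * v.out =
              γ * (s + s) by ring] at this
        · intro hmem
          obtain ⟨u, hu, h⟩ := Finset.mem_image.1 hmem
          rcases L.weierstrassP_injective (hsout s hs u hu) (hzγ s hs) h with h | h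
          · exact (hout u hu).1 (by rwa [add_sub_cancel_left] at h)
          · refine h2s ?_
            have := sub_mem (hL _ h) (hout u hu).2
            rwa [show γ * (s + u.out + s) - γ * u.out = γ * (s + s) by ring] at this
      · intro x hx
        have hval : ∀ w, γ * w ∉ L.lattice → ℘[L] (γ * w) = ℘[L] (γ * s) →
            R.eval (℘[L] w) = 0 → (W - R).eval (℘[L] w) = 0 := by
          intro w hw h1 h2
          rw [Polynomial.eval_sub, h2, hWe w hw, h1]
          ring
        rcases Finset.mem_insert.1 hx with rfl | hx
        · exact hval s hs rfl (by simp [hR])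
        · obtain ⟨u, hu, rfl⟩ := Finset.mem_image.1 hx
          have h1 : γ * (s + u.out) = γ * s + γ * u.out := mul_add _ _ _
          refine hval _ (fun h => hs ?_) (by rw [h1, L.weierstrassP_add_mem (hout u hu).2]) ?_
          · have := sub_mem h (hout u hu).2
            rwa [h1, add_sub_cancel_right] at this
          · rw [hR, Polynomial.eval_mul, Polynomial.eval_prod,
              Finset.prod_eq_zero hu (by simp), mul_zero]
    rw [← hWe z hz, hWR, hR]
    simp [Polynomial.eval_prod]
  intro P S
  obtain ⟨z, rfl⟩ := Submodule.Quotient.mk_surjective _ P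
  obtain ⟨s, rfl⟩ := Submodule.Quotient.mk_surjective _ S
  simp only [mulHom_mk, ne_eq, mk_eq_zero', xcoord_mk, xcoord_mk_add]
  intro hz hs
  have c1 : ContinuousAt (fun s => ℘[L] (γ * s)) s :=
    ContinuousAt.comp (f := fun w => γ * w) (g := ℘[L]) (L.continuousAt_weierstrassP hs)
      (by fun_prop)
  refine eq_of_eventuallyEq_punctured (f := fun s => (℘[L] (γ * z) - ℘[L] (γ * s)) *
    (γ ^ 2 * ∏ u ∈ C, (℘[L] z - L.xcoord u))) (g := fun s => (℘[L] z - ℘[L] s) *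
      ∏ u ∈ C, (℘[L] z - ℘[L] (s + u.out))) (z := s) ?_ ?_ ?_
  · exact (continuousAt_const.sub c1).mul continuousAt_const
  · exact (continuousAt_const.sub (L.continuousAt_weierstrassP (hzγ s hs))).mul
      (tendsto_finsetProd C fun u hu =>
        continuousAt_const.sub (L.continuousAt_comp_add (hsout s hs u hu)))
  · have hmap : Tendsto (fun s : ℂ => γ * (s + s)) (𝓝[≠] s) (𝓝[≠] (γ * (s + s))) := by
      refine tendsto_nhdsWithin_iff.2 ⟨?_, ?_⟩
      · have : ContinuousAt (fun s : ℂ => γ * (s + s)) s := by fun_prop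
        exact this.tendsto.mono_left nhdsWithin_le_nhds
      · filter_upwards [self_mem_nhdsWithin] with w hw h
        refine hw ?_
        have h1 := mul_left_cancel₀ hγ h
        have : 2 * w = 2 * s := by linear_combination h1
        simpa using this
    filter_upwards [L.eventually_punctured_of_notMem (f := fun s => γ * s) (by fun_prop) hs,
      hmap.eventually (L.eventually_notMem _)] with w h1 h2
    exact hgen w h1 h2 z hz

end PeriodPair

namespace PeriodPair

lemma exists_kernel (L : PeriodPair) (h0L : (1 : ℂ) ∈ L.lattice) {γ : ℂ} (hγ : γ ≠ 0) 
    (hL : ∀ l ∈ L.lattice, γ * l ∈ L.lattice)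
    (h1 : ∀ l ∈ L.lattice, ∃ a : ℤ, ∃ l' ∈ L.lattice, l = a + γ * l') {n : ℕ} (hn : 0 < n)
    (h2 : ∀ a : ℤ, (∃ l ∈ L.lattice, (a : ℂ) = γ * l) ↔ (n : ℤ) ∣ a) :
    ∃ w : ℂ ⧸ L.lattice, (L.mulHom γ hL w = 0 ∧
      ∀ u, L.mulHom γ hL u = 0 → ∃ m : ℤ, m • w = u) ∧
      ∃ C : Finset (ℂ ⧸ L.lattice), C.card + 1 = n ∧ ∀ u, u ∈ C ↔ u ≠ 0 ∧ L.mulHom γ hL u = 0 := by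
  classical
  set w : ℂ ⧸ L.lattice := Submodule.Quotient.mk (1 / γ) with hw
  have hmw : ∀ m : ℤ, m • w = Submodule.Quotient.mk (m / γ) := fun m => by
    rw [hw, ← Submodule.Quotient.mk_smul, zsmul_eq_mul]
    congr 1; ring
  have hw0 : ∀ m : ℤ, m • w = 0 ↔ (n : ℤ) ∣ m := fun m => by
    rw [hmw, mk_eq_zero', ← h2]
    constructor
    · intro h
      exact ⟨_, h, by field_simp⟩
    · rintro ⟨l, hl, h⟩
      rw [h]
      rwa [mul_div_cancel_left₀ _ hγ]
  have hgen : ∀ u, L.mulHom γ hL u = 0 → ∃ m : ℤ, m • w = u := by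
    intro u hu
    obtain ⟨z, rfl⟩ := Submodule.Quotient.mk_surjective _ u
    rw [mulHom_mk, mk_eq_zero'] at hu
    obtain ⟨a, l', hl', h⟩ := h1 _ hu
    refine ⟨a, ?_⟩
    rw [hmw, Submodule.Quotient.eq]
    have : (a : ℂ) / γ - z = -l' := by field_simp; linear_combination -h
    rw [this]
    exact neg_mem hl'
  refine ⟨w, ⟨?_, hgen⟩, (Finset.Ioo (0 : ℤ) n).image fun m => m • w, ?_, fun u => ?_⟩
  · rw [hw, mulHom_mk, mk_eq_zero', mul_one_div_cancel hγ]
    exact h0L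
  · rw [Finset.card_image_of_injOn, Int.card_Ioo]
    · omega
    · intro a ha b hb hab
      have h3 : (n : ℤ) ∣ a - b := by
        rw [← hw0, sub_smul, sub_eq_zero]
        exact hab
      rw [Finset.coe_Ioo, Set.mem_Ioo] at ha hb
      have := Int.eq_zero_of_abs_lt_dvd h3 (abs_lt.2 ⟨by omega, by omega⟩)
      omega
  · constructor
    · intro hu
      obtain ⟨m, hm, rfl⟩ := Finset.mem_image.1 hu
      rw [Finset.mem_Ioo] at hm
      refine ⟨fun h => ?_, ?_⟩
      · rw [hw0] at h
        have := Int.le_of_dvd hm.1 h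
        omega
      · rw [hmw, mulHom_mk, mk_eq_zero', mul_div_cancel₀ _ hγ]
        rw [← mul_one (m : ℂ), ← zsmul_eq_mul]
        exact zsmul_mem h0L m
    · rintro ⟨h0, hu⟩
      obtain ⟨m, rfl⟩ := hgen u hu
      have h3 : (m % n) • w = m • w := by
        have := (hw0 (m % n - m)).2 ⟨-(m / n), by
          have := Int.emod_add_mul_ediv m n
          linear_combination this⟩
        rwa [sub_smul, sub_eq_zero] at this
      refine Finset.mem_image.2 ⟨m % n, Finset.mem_Ioo.2 ⟨?_, Int.emod_lt_of_pos _ (by omega)⟩, h3⟩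
      refine lt_of_le_of_ne (Int.emod_nonneg _ (by omega)) fun h => h0 ?_
      rw [← h3, ← h, zero_smul]

variable {q : ℕ} {τ : ℂ}

lemma im_ne_zero_of_root (hq : 0 < q) (hτ : τ ^ 2 = τ - q) : τ.im ≠ 0 := by
  intro h
  have h1 := congrArg Complex.re hτ
  simp [pow_two, h] at h1
  have : (1 : ℝ) ≤ q := by exact_mod_cast hq
  nlinarith [sq_nonneg (τ.re - 1 / 2)]

/-- The lattice spanned by `1` and `τ`. -/
noncomputable def ofRoot (hq : 0 < q) (hτ : τ ^ 2 = τ - q) : PeriodPair where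
  ω₁ := 1
  ω₂ := τ
  indep := by
    rw [LinearIndependent.pair_iff]
    intro s t h
    have h1 := congrArg Complex.im h
    have h2 := congrArg Complex.re h
    simp [im_ne_zero_of_root hq hτ] at h1
    simp [h1] at h2
    exact ⟨h2, h1⟩

lemma mem_ofRoot (hq : 0 < q) (hτ : τ ^ 2 = τ - q) {z : ℂ} :
    z ∈ (ofRoot hq hτ).lattice ↔ ∃ a b : ℤ, z = a + b * τ := by
  rw [mem_lattice]
  simp [ofRoot, eq_comm]

lemma coeff_eq (hq : 0 < q) (hτ : τ ^ 2 = τ - q) {a b c d : ℤ}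
    (h : (a + b * τ : ℂ) = c + d * τ) : a = c ∧ b = d := by
  have h1 := congrArg Complex.im h
  have h2 := congrArg Complex.re h
  simp [im_ne_zero_of_root hq hτ] at h1
  subst h1
  simp at h2
  exact ⟨h2, rfl⟩

lemma exists_isCM (hq : 0 < q) (hτ : τ ^ 2 = τ - q) {p : ℕ} (hp : 0 < p) :
    ∃ (D : KummerModel (ℂ ⧸ (ofRoot hq hτ).lattice) ℂ)
      (Γ : (ℂ ⧸ (ofRoot hq hτ).lattice) →+ (ℂ ⧸ (ofRoot hq hτ).lattice)), D.IsCM Γ q p τ := by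
  classical
  set L := ofRoot hq hτ with hLdef
  have mem : ∀ {z : ℂ}, z ∈ L.lattice ↔ ∃ a b : ℤ, z = a + b * τ := mem_ofRoot hq hτ
  have him := im_ne_zero_of_root hq hτ
  have hτ0 : τ ≠ 0 := fun h => him (by simp [h])
  have h1τ : 1 - τ ≠ 0 := fun h => him (by rw [← sub_eq_zero.1 h]; simp)
  have h2τ : 2 * τ - 1 ≠ 0 := fun h => him (by
    have : τ = ((1 / 2 : ℝ) : ℂ) := by push_cast; linear_combination h / 2
    rw [this, Complex.ofReal_im])
  have hp0 : (p : ℂ) ≠ 0 := by exact_mod_cast hp.ne'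
  have L1 : ∀ l ∈ L.lattice, τ * l ∈ L.lattice := by
    intro l hl
    obtain ⟨a, b, rfl⟩ := mem.1 hl
    exact mem.2 ⟨-b * q, a + b, by push_cast; linear_combination b * hτ⟩
  have L2 : ∀ l ∈ L.lattice, (1 - τ) * l ∈ L.lattice := fun l hl => by
    have := sub_mem hl (L1 l hl)
    rwa [show l - τ * l = (1 - τ) * l by ring] at this
  have L3 : ∀ l ∈ L.lattice, (2 * τ - 1) * l ∈ L.lattice := fun l hl => by
    have := sub_mem (add_mem (L1 l hl) (L1 l hl)) hl
    rwa [show τ * l + τ * l - l = (2 * τ - 1) * l by ring] at this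
  have Lp : ∀ l ∈ L.lattice, (p : ℂ) * l ∈ L.lattice := fun l hl => by
    rw [← nsmul_eq_mul]; exact nsmul_mem hl p
  obtain ⟨D, hD⟩ := L.exists_kummerModel
  set Γ := L.mulHom τ L1 with hΓ
  have e2 : AddMonoidHom.id _ - Γ = L.mulHom (1 - τ) L2 := by
    ext P
    obtain ⟨z, rfl⟩ := Submodule.Quotient.mk_surjective _ P
    simp only [AddMonoidHom.sub_apply, AddMonoidHom.id_apply, hΓ, mulHom_mk,
      ← Submodule.Quotient.mk_sub]
    congr 1; ring
  have e3 : 2 • Γ - AddMonoidHom.id _ = L.mulHom (2 * τ - 1) L3 := by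
    ext P
    obtain ⟨z, rfl⟩ := Submodule.Quotient.mk_surjective _ P
    simp only [AddMonoidHom.sub_apply, AddMonoidHom.id_apply, hΓ, mulHom_mk,
      AddMonoidHom.nsmul_apply, ← Submodule.Quotient.mk_sub, ← Submodule.Quotient.mk_smul]
    congr 1
    rw [nsmul_eq_mul]; push_cast; ring
  have ep : p • AddMonoidHom.id _ = L.mulHom p Lp := by
    ext P
    obtain ⟨z, rfl⟩ := Submodule.Quotient.mk_surjective _ P
    simp only [AddMonoidHom.id_apply, mulHom_mk, AddMonoidHom.nsmul_apply,
      ← Submodule.Quotient.mk_smul, nsmul_eq_mul]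
  obtain ⟨w, hw, C1, hC1, hC1'⟩ := L.exists_kernel L.ω₁_mem_lattice hτ0 L1 (fun l hl => by
      obtain ⟨a, b, rfl⟩ := mem.1 hl
      exact ⟨a, b, mem.2 ⟨b, 0, by simp⟩, by ring⟩) hq (fun a => by
      constructor
      · rintro ⟨l, hl, h⟩
        obtain ⟨c, d, rfl⟩ := mem.1 hl
        have h3 : ((a : ℤ) + (0 : ℤ) * τ : ℂ) = ((-d * q : ℤ) : ℂ) + ((c + d : ℤ) : ℂ) * τ := by
          push_cast; linear_combination h + d * hτ
        exact ⟨-d, by rw [(coeff_eq hq hτ h3).1]; ring⟩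
      · rintro ⟨d, rfl⟩
        exact ⟨_, mem.2 ⟨d, -d, rfl⟩, by push_cast; linear_combination d * hτ⟩)
  obtain ⟨-, -, C2, hC2, hC2'⟩ := L.exists_kernel L.ω₁_mem_lattice h1τ L2 (fun l hl => by
      obtain ⟨a, b, rfl⟩ := mem.1 hl
      exact ⟨a + b, -b, mem.2 ⟨-b, 0, by simp⟩, by push_cast; ring⟩) hq (fun a => by
      constructor
      · rintro ⟨l, hl, h⟩
        obtain ⟨c, d, rfl⟩ := mem.1 hl
        have h3 : ((a : ℤ) + (0 : ℤ) * τ : ℂ) = ((c + d * q : ℤ) : ℂ) + ((-c : ℤ) : ℂ) * τ := by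
          push_cast; linear_combination h - d * hτ
        obtain ⟨h4, h5⟩ := coeff_eq hq hτ h3
        obtain rfl : c = 0 := by omega
        exact ⟨d, by rw [h4]; ring⟩
      · rintro ⟨d, rfl⟩
        exact ⟨_, mem.2 ⟨0, d, rfl⟩, by push_cast; linear_combination d * hτ⟩)
  obtain ⟨-, -, C3, hC3, hC3'⟩ := L.exists_kernel L.ω₁_mem_lattice h2τ L3 (fun l hl => by
      obtain ⟨a, b, rfl⟩ := mem.1 hl
      exact ⟨a + 2 * b * q, b * τ, mem.2 ⟨0, b, by simp⟩, by
        push_cast; linear_combination -2 * b * hτ⟩) (n := 4 * q - 1) (by omega) (fun a => by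
      have hc : ((4 * q - 1 : ℕ) : ℤ) = 4 * q - 1 := by omega
      rw [hc]
      constructor
      · rintro ⟨l, hl, h⟩
        obtain ⟨c, d, rfl⟩ := mem.1 hl
        have h3 : ((a : ℤ) + (0 : ℤ) * τ : ℂ) =
            ((-c - 2 * d * q : ℤ) : ℂ) + ((2 * c + d : ℤ) : ℂ) * τ := by
          push_cast; linear_combination h + 2 * d * hτ
        obtain ⟨h4, h5⟩ := coeff_eq hq hτ h3
        obtain rfl : d = -2 * c := by omega
        exact ⟨c, by rw [h4]; ring⟩
      · rintro ⟨d, rfl⟩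
        exact ⟨_, mem.2 ⟨d, -2 * d, rfl⟩, by push_cast; linear_combination 4 * d * hτ⟩)
  have hfin : {u : ℂ ⧸ L.lattice | u ≠ 0 ∧ L.mulHom p Lp u = 0}.Finite := by
    refine Set.Finite.subset (Set.Finite.image (fun x : ℤ × ℤ =>
      (Submodule.Quotient.mk ((x.1 + x.2 * τ) / p) : ℂ ⧸ L.lattice))
      ((Set.finite_Ico (0 : ℤ) p).prod (Set.finite_Ico (0 : ℤ) p))) ?_
    rintro u ⟨-, hu⟩
    obtain ⟨z, rfl⟩ := Submodule.Quotient.mk_surjective _ u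
    rw [mulHom_mk, mk_eq_zero'] at hu
    obtain ⟨a, b, h⟩ := mem.1 hu
    refine ⟨(a % p, b % p), ⟨⟨Int.emod_nonneg _ (by omega), Int.emod_lt_of_pos _ (by omega)⟩,
      ⟨Int.emod_nonneg _ (by omega), Int.emod_lt_of_pos _ (by omega)⟩⟩, ?_⟩
    rw [Submodule.Quotient.eq]
    refine mem.2 ⟨-(a / p), -(b / p), ?_⟩
    have ha : ((a % p : ℤ) : ℂ) = a - p * (a / p : ℤ) := by
      rw [Int.emod_def]; push_cast; ring
    have hb : ((b % p : ℤ) : ℂ) = b - p * (b / p : ℤ) := by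
      rw [Int.emod_def]; push_cast; ring
    simp only [ha, hb]
    field_simp
    push_cast
    linear_combination -h
  refine ⟨D, Γ, ?_⟩
  exact
  { root := hτ
    sq := fun P => by
      obtain ⟨z, rfl⟩ := Submodule.Quotient.mk_surjective _ P
      simp only [hΓ, mulHom_mk, ← Submodule.Quotient.mk_smul, ← Submodule.Quotient.mk_sub]
      congr 1
      rw [nsmul_eq_mul]
      linear_combination z * hτ
    surj := L.mulHom_surjective hτ0 L1
    surj_one_sub := by rw [e2]; exact L.mulHom_surjective h1τ L2
    surj_nsmul := by rw [ep]; exact L.mulHom_surjective hp0 Lp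
    mult := ⟨C1, L.isMult hD hτ0 L1 hC1', hC1⟩
    cyclic := ⟨w, hw⟩
    mult_one_sub := ⟨C2, by rw [e2]; exact L.isMult hD h1τ L2 hC2', hC2⟩
    mult_two_sub := ⟨C3, by rw [e3]; exact L.isMult hD h2τ L3 hC3', by omega⟩
    mult_nsmul := ⟨hfin.toFinset, by rw [ep]; exact L.isMult hD hp0 Lp (by simp)⟩
    infinite_order := by
      refine ⟨Submodule.Quotient.mk (√2 : ℝ), fun n hn h => ?_⟩
      rw [← Submodule.Quotient.mk_smul, mk_eq_zero', mem] at h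
      obtain ⟨a, b, h⟩ := h
      have h1 := congrArg Complex.im h
      have h2 := congrArg Complex.re h
      simp [him] at h1
      simp [h1] at h2
      exact (irrational_sqrt_two.natCast_mul hn).ne_int a h2
    two_torsion := by
      refine ⟨Submodule.Quotient.mk (1 / 2), ?_, ?_⟩
      · rw [ne_eq, mk_eq_zero']
        exact L.ω₁_div_two_notMem_lattice
      · rw [← Submodule.Quotient.mk_add, add_halves, mk_eq_zero']
        exact L.ω₁_mem_lattice }

end PeriodPair

end Analytic

section Arithmetic

open NNReal

universe u

set_option linter.unusedTactic false
set_option linter.unreachableTactic false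

/-- A model with integral coefficients and unit discriminant. -/
structure KummerModel.IsGood {G K : Type*} [AddCommGroup G] [Field K] (D : KummerModel G K)
    (v : Valuation K ℝ≥0) : Prop where
  b2 : D.b2 ∈ v.integer
  b4 : D.b4 ∈ v.integer
  b6 : D.b6 ∈ v.integer
  b8 : D.b8 ∈ v.integer
  disc : v D.Δ = 1

namespace Valuation

variable {K : Type*} [Field K] (v : Valuation K ℝ≥0)

lemma mul_lt_one_of_mem {a b : K} (ha : v a < 1) (hb : b ∈ v.integer) : v (a * b) < 1 := by
  rw [map_mul]
  exact mul_lt_one_of_lt_of_le ha hb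

lemma max_one_mul_max_one (a b : K) :
    max 1 (v a) * max 1 (v b) = max 1 (max (v (a + b)) (v (a * b))) := by
  wlog h : v b ≤ v a generalizing a b
  · rw [mul_comm, this b a (le_of_not_ge h), add_comm b a, mul_comm b a]
  rcases le_or_gt (v a) 1 with ha | ha
  · have hb := h.trans ha
    have h1 : v (a + b) ≤ 1 := v.map_add_le ha hb
    have h2 : v (a * b) ≤ 1 := by rw [map_mul]; exact mul_le_one' ha hb
    rw [max_eq_left ha, max_eq_left hb, max_eq_left (max_le h1 h2), one_mul]
  · rw [max_eq_right ha.le]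
    rcases le_or_gt (v b) 1 with hb | hb
    · have h1 : v (a + b) = v a := v.map_add_eq_of_lt_left (hb.trans_lt ha)
      have h2 : v (a * b) ≤ v a := by
        rw [map_mul]; exact mul_le_of_le_one_right' hb
      rw [max_eq_left hb, h1, max_eq_left h2, max_eq_right ha.le, mul_one]
    · have h1 : v (a + b) ≤ v (a * b) := by
        refine (v.map_add_le le_rfl h).trans ?_
        rw [map_mul]; exact le_mul_of_one_le_right' hb.le
      rw [max_eq_right hb.le, max_eq_right h1, ← map_mul, max_eq_right]
      rw [map_mul]; exact one_le_mul ha.le hb.le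

lemma inv_lt_one_of_one_lt {a : K} (ha : 1 < v a) : v a⁻¹ < 1 := by
  rw [map_inv₀]; exact inv_lt_one_of_one_lt₀ ha

lemma ne_zero_of_one_lt {a : K} (ha : 1 < v a) : a ≠ 0 := by
  rintro rfl
  simp at ha

lemma inv_mem_of_one_lt {a : K} (ha : 1 < v a) : a⁻¹ ∈ v.integer :=
  (v.inv_lt_one_of_one_lt ha).le

end Valuation

namespace KummerModel

variable {G K : Type*} [AddCommGroup G] [Field K] {D : KummerModel G K} {v : Valuation K ℝ≥0}

lemma IsGood.forms (h : D.IsGood v) {X Y : K} (hX : v X ≤ 1) (hY : v Y ≤ 1) :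
    max (v (X - Y) ^ 2) (max (v (D.sumForm X Y)) (v (D.prodForm X Y))) = 1 := by
  obtain ⟨h2, h4, h6, h8, hΔ⟩ := h
  have hX : X ∈ v.integer := hX
  have hY : Y ∈ v.integer := hY
  have m1 : X - Y ∈ v.integer := sub_mem hX hY
  have m2 : D.sumForm X Y ∈ v.integer := by unfold sumForm; aesop
  have m3 : D.prodForm X Y ∈ v.integer := by unfold prodForm; aesop
  refine le_antisymm (max_le (pow_le_one₀ zero_le m1) (max_le m2 m3)) ?_
  by_contra! hlt
  obtain ⟨l1, l2, l3⟩ : v ((X - Y) ^ 2) < 1 ∧ v (D.sumForm X Y) < 1 ∧ v (D.prodForm X Y) < 1 := by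
    rw [map_pow]
    simpa only [max_lt_iff] using hlt
  have := D.bezout_forms X Y
  refine hΔ.not_lt ?_
  rw [← this, mul_comm, mul_comm _ (D.sumForm X Y), mul_comm _ ((X - Y) ^ 2)]
  refine v.map_add_lt (v.map_add_lt ?_ ?_) ?_
  · exact v.mul_lt_one_of_mem l3 (by
      repeat' first | assumption | apply add_mem | apply sub_mem | apply mul_mem | apply pow_mem |
        apply neg_mem | apply ofNat_mem | apply one_mem)
  · exact v.mul_lt_one_of_mem l2 (by
      repeat' first | assumption | apply add_mem | apply sub_mem | apply mul_mem | apply pow_mem |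
        apply neg_mem | apply ofNat_mem | apply one_mem)
  · exact v.mul_lt_one_of_mem l1 (by
      repeat' first | assumption | apply add_mem | apply sub_mem | apply mul_mem | apply pow_mem |
        apply neg_mem | apply ofNat_mem | apply one_mem)

lemma IsGood.v_prodForm (h : D.IsGood v) {X Y : K} (hX : 1 < v X) (hY : 1 < v Y) :
    v (D.prodForm X Y) = v X ^ 2 * v Y ^ 2 := by
  obtain ⟨h2, h4, h6, h8, hΔ⟩ := h
  have x0 := v.ne_zero_of_one_lt hX
  have y0 := v.ne_zero_of_one_lt hY
  have m1 := v.inv_mem_of_one_lt hX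
  have m2 := v.inv_mem_of_one_lt hY
  have : D.prodForm X Y = (X * Y) ^ 2 * (1 - X⁻¹ * (D.b4 * Y⁻¹ +
      D.b6 * (Y⁻¹ ^ 2 + X⁻¹ * Y⁻¹) + D.b8 * (X⁻¹ * Y⁻¹ ^ 2))) := by
    unfold prodForm
    field_simp
    ring
  rw [this, map_mul, v.map_one_sub_of_lt, mul_one, map_pow, map_mul, mul_pow]
  exact v.mul_lt_one_of_mem (v.inv_lt_one_of_one_lt hX) (by
      repeat' first | assumption | apply add_mem | apply sub_mem | apply mul_mem | apply pow_mem |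
        apply neg_mem | apply ofNat_mem | apply one_mem)

lemma IsGood.v_prod (h : D.IsGood v) {P S : G} (hP : P ≠ 0) (hS : S ≠ 0) (h₁ : P + S ≠ 0)
    (h₂ : P - S ≠ 0) :
    max 1 (v (D.x (P + S))) * max 1 (v (D.x (P - S))) * v (D.x P - D.x S) ^ 2 =
      max 1 (v (D.x P)) ^ 2 * max 1 (v (D.x S)) ^ 2 := by
  have hs := D.sum_eq' hP hS h₁ h₂
  have hp := D.prod_eq' hP hS h₁ h₂
  have hform : max 1 (v (D.x (P + S))) * max 1 (v (D.x (P - S))) * v (D.x P - D.x S) ^ 2 =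
      max (v (D.x P - D.x S) ^ 2) (max (v (D.sumForm (D.x P) (D.x S)))
        (v (D.prodForm (D.x P) (D.x S)))) := by
    rw [v.max_one_mul_max_one, ← hs, ← hp, map_mul v ((_ - _) ^ 2), map_mul v ((_ - _) ^ 2), map_pow,
      mul_comm, mul_max, mul_max, mul_one]
  obtain ⟨h2, h4, h6, h8, -⟩ := id h
  rcases le_or_gt (v (D.x P)) 1 with a | a <;> rcases le_or_gt (v (D.x S)) 1 with b | b
  · rw [hform, h.forms a b, max_eq_left a, max_eq_left b]
    simp
  · have e1 : v (D.x P - D.x S) = v (D.x S) := v.map_sub_eq_of_lt_right (a.trans_lt b)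
    have x0 := v.ne_zero_of_one_lt b
    have m1 := v.inv_mem_of_one_lt b
    have a' : D.x P ∈ v.integer := a
    rw [hform, e1, max_eq_left a, max_eq_right b.le, one_pow, one_mul, max_eq_left]
    rw [← map_pow]
    have key : ∀ z, z * (D.x S)⁻¹ ^ 2 ∈ v.integer → v z ≤ v (D.x S ^ 2) := fun z hz => by
      have : z = D.x S ^ 2 * (z * (D.x S)⁻¹ ^ 2) := by field_simp
      rw [this, map_mul]
      exact mul_le_of_le_one_right' hz
    refine max_le (key _ ?_) (key _ ?_)
    · have : D.sumForm (D.x P) (D.x S) * (D.x S)⁻¹ ^ 2 = 2 * D.x P * (D.x P * (D.x S)⁻¹ + 1) +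
          D.b2 * (D.x P * (D.x S)⁻¹) + D.b4 * (D.x P * (D.x S)⁻¹ ^ 2 + (D.x S)⁻¹) +
          D.b6 * (D.x S)⁻¹ ^ 2 := by
        unfold sumForm
        field_simp
      rw [this]
      repeat' first | assumption | apply add_mem | apply sub_mem | apply mul_mem | apply pow_mem |
        apply neg_mem | apply ofNat_mem | apply one_mem
    · have : D.prodForm (D.x P) (D.x S) * (D.x S)⁻¹ ^ 2 = D.x P ^ 2 -
          D.b4 * (D.x P * (D.x S)⁻¹) - D.b6 * (D.x P * (D.x S)⁻¹ ^ 2 + (D.x S)⁻¹) -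
          D.b8 * (D.x S)⁻¹ ^ 2 := by
        unfold prodForm
        field_simp
      rw [this]
      repeat' first | assumption | apply add_mem | apply sub_mem | apply mul_mem | apply pow_mem |
        apply neg_mem | apply ofNat_mem | apply one_mem
  · have e1 : v (D.x P - D.x S) = v (D.x P) := v.map_sub_eq_of_lt_left (b.trans_lt a)
    have x0 := v.ne_zero_of_one_lt a
    have m1 := v.inv_mem_of_one_lt a
    have b' : D.x S ∈ v.integer := b
    rw [hform, e1, max_eq_left b, max_eq_right a.le, one_pow, mul_one, max_eq_left]
    rw [← map_pow]
    have key : ∀ z, z * (D.x P)⁻¹ ^ 2 ∈ v.integer → v z ≤ v (D.x P ^ 2) := fun z hz => by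
      have : z = D.x P ^ 2 * (z * (D.x P)⁻¹ ^ 2) := by field_simp
      rw [this, map_mul]
      exact mul_le_of_le_one_right' hz
    refine max_le (key _ ?_) (key _ ?_)
    · have : D.sumForm (D.x P) (D.x S) * (D.x P)⁻¹ ^ 2 = 2 * D.x S * (1 + D.x S * (D.x P)⁻¹) +
          D.b2 * (D.x S * (D.x P)⁻¹) + D.b4 * ((D.x P)⁻¹ + D.x S * (D.x P)⁻¹ ^ 2) +
          D.b6 * (D.x P)⁻¹ ^ 2 := by
        unfold sumForm
        field_simp
      rw [this]
      repeat' first | assumption | apply add_mem | apply sub_mem | apply mul_mem | apply pow_mem |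
        apply neg_mem | apply ofNat_mem | apply one_mem
    · have : D.prodForm (D.x P) (D.x S) * (D.x P)⁻¹ ^ 2 = D.x S ^ 2 -
          D.b4 * (D.x S * (D.x P)⁻¹) - D.b6 * ((D.x P)⁻¹ + D.x S * (D.x P)⁻¹ ^ 2) -
          D.b8 * (D.x P)⁻¹ ^ 2 := by
        unfold prodForm
        field_simp
      rw [this]
      repeat' first | assumption | apply add_mem | apply sub_mem | apply mul_mem | apply pow_mem |
        apply neg_mem | apply ofNat_mem | apply one_mem
  · rw [hform, h.v_prodForm a b, max_eq_right a.le, max_eq_right b.le, max_eq_right, max_eq_right]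
    · have x0 := v.ne_zero_of_one_lt a
      have y0 := v.ne_zero_of_one_lt b
      have m1 := v.inv_mem_of_one_lt a
      have m2 := v.inv_mem_of_one_lt b
      have : D.sumForm (D.x P) (D.x S) = (D.x P * D.x S) ^ 2 * (2 * ((D.x P)⁻¹ + (D.x S)⁻¹) +
          D.b2 * ((D.x P)⁻¹ * (D.x S)⁻¹) + D.b4 * ((D.x P)⁻¹ * (D.x S)⁻¹ ^ 2 +
          (D.x P)⁻¹ ^ 2 * (D.x S)⁻¹) + D.b6 * ((D.x P)⁻¹ ^ 2 * (D.x S)⁻¹ ^ 2)) := by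
        unfold sumForm
        field_simp
        ring
      rw [this, map_mul, map_pow, map_mul, mul_pow]
      exact mul_le_of_le_one_right' (show _ ∈ v.integer from by
        repeat' first | assumption | apply add_mem | apply sub_mem | apply mul_mem | apply pow_mem |
          apply neg_mem | apply ofNat_mem | apply one_mem)
    · rw [← mul_pow]
      refine le_max_of_le_right ?_
      refine pow_le_pow_left₀ zero_le (v.map_sub_le ?_ ?_) 2
      · exact le_mul_of_one_le_right' b.le
      · exact le_mul_of_one_le_left' a.le

/-- The kernel of reduction. -/
def IsGood.ker (h : D.IsGood v) : AddSubgroup G where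
  carrier := {P | P = 0 ∨ 1 < v (D.x P)}
  zero_mem' := Or.inl rfl
  neg_mem' := by
    rintro P (rfl | hP)
    · exact Or.inl neg_zero
    · exact Or.inr (by rwa [D.x_neg])
  add_mem' := by
    rintro P S (rfl | hP) (rfl | hS)
    · exact Or.inl (add_zero 0)
    · rw [zero_add]; exact Or.inr hS
    · rw [add_zero]; exact Or.inr hP
    · obtain ⟨h2, h4, h6, h8, -⟩ := id h
      have x0 := v.ne_zero_of_one_lt hP
      have y0 := v.ne_zero_of_one_lt hS
      have m1 := v.inv_mem_of_one_lt hP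
      have m2 := v.inv_mem_of_one_lt hS
      by_cases hPS : P + S = 0
      · exact Or.inl hPS
      right
      by_contra! hZ
      have hZ' : D.x (P + S) ∈ v.integer := hZ
      by_cases hsub : P - S = 0
      · obtain rfl := sub_eq_zero.1 hsub
        have hd := D.dup' hPS
        have : (1 : K) = (D.x P)⁻¹ * ((4 + D.b2 * (D.x P)⁻¹ + 2 * D.b4 * (D.x P)⁻¹ ^ 2 +
            D.b6 * (D.x P)⁻¹ ^ 3) * D.x (P + P) + (D.b4 * (D.x P)⁻¹ + 2 * D.b6 * (D.x P)⁻¹ ^ 2 +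
            D.b8 * (D.x P)⁻¹ ^ 3)) := by
          unfold psi phi at hd
          field_simp
          linear_combination -hd
        have h1 : v (1 : K) < 1 := by
          rw [this]
          exact v.mul_lt_one_of_mem (v.inv_lt_one_of_one_lt hP) (by
              repeat' first | assumption | apply add_mem | apply sub_mem | apply mul_mem | apply pow_mem |
                apply neg_mem | apply ofNat_mem | apply one_mem)
        simp at h1
      · have hP0 : P ≠ 0 := by
          rintro rfl
          rw [zero_add] at hZ; exact hS.not_ge hZ
        have hS0 : S ≠ 0 := by
          rintro rfl
          rw [add_zero] at hZ; exact hP.not_ge hZ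
        have ht := D.theta_eq hP0 hS0 hPS hsub (D.x (P + S))
        rw [sub_self, zero_mul, mul_zero] at ht
        have : (1 : K) = (D.x P)⁻¹ * (-((D.x P)⁻¹ - 2 * (D.x S)⁻¹) * D.x (P + S) ^ 2 +
            (2 + D.b2 * (D.x S)⁻¹ + D.b4 * ((D.x S)⁻¹ ^ 2 + (D.x P)⁻¹ * (D.x S)⁻¹) +
              D.b6 * ((D.x P)⁻¹ * (D.x S)⁻¹ ^ 2)) * D.x (P + S) + (D.b4 * (D.x S)⁻¹ +
              D.b6 * ((D.x P)⁻¹ * (D.x S)⁻¹ + (D.x S)⁻¹ ^ 2) +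
              D.b8 * ((D.x P)⁻¹ * (D.x S)⁻¹ ^ 2))) +
            (D.x S)⁻¹ * (2 * D.x (P + S) - (D.x S)⁻¹ * D.x (P + S) ^ 2) := by
          unfold theta sumForm prodForm at ht
          field_simp
          linear_combination ht
        have h1 : v (1 : K) < 1 := by
          rw [this]
          exact v.map_add_lt
            (v.mul_lt_one_of_mem (v.inv_lt_one_of_one_lt hP) (by
              repeat' first | assumption | apply add_mem | apply sub_mem | apply mul_mem |
                apply pow_mem | apply neg_mem | apply ofNat_mem))
            (v.mul_lt_one_of_mem (v.inv_lt_one_of_one_lt hS) (by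
                repeat' first | assumption | apply add_mem | apply sub_mem | apply mul_mem | apply pow_mem |
                  apply neg_mem | apply ofNat_mem | apply one_mem))
        simp at h1

lemma IsGood.mem_ker (h : D.IsGood v) {P : G} : P ∈ h.ker ↔ P = 0 ∨ 1 < v (D.x P) := Iff.rfl

lemma IsGood.notMem_ker (h : D.IsGood v) {P : G} : P ∉ h.ker ↔ P ≠ 0 ∧ v (D.x P) ≤ 1 := by
  rw [h.mem_ker]; push Not; rfl

lemma IsGood.v_sub_lt (h : D.IsGood v) {P S : G} (hP : P ∉ h.ker) (hS : S ∈ h.ker) :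
    v (D.x (P + S) - D.x P) < 1 := by
  have hPS : P + S ∉ h.ker := fun hh => hP (by simpa using sub_mem hh hS)
  have hPS' : P - S ∉ h.ker := fun hh => hP (by simpa using add_mem hh hS)
  obtain ⟨hP0, hPx⟩ := h.notMem_ker.1 hP
  obtain ⟨hPS0, hZ⟩ := h.notMem_ker.1 hPS
  by_cases hS0 : S = 0
  · simp [hS0]
  have hSx := (h.mem_ker.1 hS).resolve_left hS0
  obtain ⟨h2, h4, h6, h8, -⟩ := id h
  have y0 := v.ne_zero_of_one_lt hSx
  have m1 := v.inv_mem_of_one_lt hSx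
  have m2 : D.x P ∈ v.integer := hPx
  have m3 : D.x (P + S) ∈ v.integer := hZ
  have ht := D.theta_eq hP0 hS0 hPS0 (h.notMem_ker.1 hPS').1 (D.x (P + S))
  rw [sub_self, zero_mul, mul_zero] at ht
  have : (D.x (P + S) - D.x P) ^ 2 = (D.x S)⁻¹ * (
      -(D.x P ^ 2 * (D.x S)⁻¹ - 2 * D.x P) * D.x (P + S) ^ 2 +
      (2 * D.x P ^ 2 + D.b2 * D.x P + D.b4 * (D.x P * (D.x S)⁻¹ + 1) + D.b6 * (D.x S)⁻¹) *
        D.x (P + S) + (D.b4 * D.x P + D.b6 * (D.x P * (D.x S)⁻¹ + 1) + D.b8 * (D.x S)⁻¹)) := by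
    unfold theta sumForm prodForm at ht
    field_simp
    linear_combination ht
  have h1 : v ((D.x (P + S) - D.x P) ^ 2) < 1 := by
    rw [this]
    exact v.mul_lt_one_of_mem (v.inv_lt_one_of_one_lt hSx) (by
      repeat' first | assumption | apply add_mem | apply sub_mem | apply mul_mem |
        apply pow_mem | apply neg_mem | apply ofNat_mem | apply one_mem)
  rw [map_pow] at h1
  exact (pow_lt_one_iff two_ne_zero).1 h1

lemma IsGood.mem_ker_of_v_sub_lt (h : D.IsGood v) {P S : G} (hP : P ∉ h.ker) (hS : S ∉ h.ker)
    (hv : v (D.x P - D.x S) < 1) : P - S ∈ h.ker ∨ P + S ∈ h.ker := by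
  by_contra! hcon
  obtain ⟨a1, a2⟩ := h.notMem_ker.1 hP
  obtain ⟨b1, b2⟩ := h.notMem_ker.1 hS
  obtain ⟨c1, c2⟩ := h.notMem_ker.1 hcon.1
  obtain ⟨d1, d2⟩ := h.notMem_ker.1 hcon.2
  have := h.v_prod a1 b1 d1 c1
  rw [max_eq_left a2, max_eq_left b2, max_eq_left c2, max_eq_left d2] at this
  simp only [one_pow, mul_one, one_mul] at this
  exact ((pow_lt_one_iff two_ne_zero).2 hv).ne this

end KummerModel

section Height

variable {G : Type*} [AddCommGroup G] {Z : AddSubgroup G} {H : G → ℝ≥0}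

lemma height_two_nsmul (hpos : ∀ P ∉ Z, H P ≠ 0)
    (hlaw : ∀ P S, P ∉ Z → S ∉ Z → P + S ∉ Z → P - S ∉ Z →
      H (P + S) * H (P - S) = H P ^ 2 * H S ^ 2)
    {P : G} (hP : ∀ n : ℕ, n ≠ 0 → n • P ∉ Z) : H (2 • P) = H P ^ 4 := by
  have hn (a b : ℕ) (hb : b ≠ 0) (hab : b < a) :
      H ((a + b) • P) * H ((a - b) • P) = H (a • P) ^ 2 * H (b • P) ^ 2 := by
    have e1 : (a + b) • P = a • P + b • P := add_nsmul _ _ _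
    have e2 : (a - b) • P = a • P - b • P := by
      rw [eq_sub_iff_add_eq, ← add_nsmul, Nat.sub_add_cancel hab.le]
    rw [e1, e2]
    exact hlaw _ _ (hP a (by omega)) (hP b hb) (e1 ▸ hP _ (by omega)) (e2 ▸ hP _ (by omega))
  have h1 := hpos _ (hP 1 (by norm_num))
  have h2 := hpos _ (hP 2 (by norm_num))
  have h3 := hpos _ (hP 3 (by norm_num))
  have r1 := hn 2 1 (by norm_num) (by norm_num)
  have r2 := hn 3 1 (by norm_num) (by norm_num)
  have r3 := hn 4 1 (by norm_num) (by norm_num)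
  have r4 := hn 3 2 (by norm_num) (by norm_num)
  norm_num at r1 r2 r3 r4 h1
  set x := H P
  set y := H (2 • P)
  set z := H (3 • P)
  set t := H (4 • P)
  set w := H (5 • P)
  have e3 : z = y ^ 2 * x := mul_right_cancel₀ h1 (by rw [r1]; ring)
  have e4 : t = y ^ 3 * x ^ 4 := mul_right_cancel₀ h2 (by rw [r2, e3]; ring)
  have e5 : w = y ^ 6 * x := mul_right_cancel₀ h1 (by rw [r4, e3]; ring)
  have : y ^ 2 * (y ^ 6 * x ^ 2) = (x ^ 4) ^ 2 * (y ^ 6 * x ^ 2) := by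
    rw [e3, e4, e5] at r3
    linear_combination r3
  exact (pow_left_inj₀ zero_le zero_le two_ne_zero).1
    (mul_right_cancel₀ (by positivity) this)

lemma height_eq_one (hpos : ∀ P ∉ Z, H P ≠ 0)
    (hlaw : ∀ P S, P ∉ Z → S ∉ Z → P + S ∉ Z → P - S ∉ Z →
      H (P + S) * H (P - S) = H P ^ 2 * H S ^ 2)
    {a b : ℝ≥0} (ha : 0 < a) (hab : ∀ P ∉ Z, a ≤ H P ∧ H P ≤ b)
    {P₀ : G} (hP₀ : ∀ n : ℕ, n ≠ 0 → n • P₀ ∉ Z) {P : G} (hP : P ∉ Z) : H P = 1 := by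
  have hinf (P : G) (hP : ∀ n : ℕ, n ≠ 0 → n • P ∉ Z) : H P = 1 := by
    have hpow (k : ℕ) : H (2 ^ k • P) = H P ^ 4 ^ k := by
      induction k with
      | zero => simp
      | succ k ih =>
        rw [pow_succ', mul_nsmul', height_two_nsmul hpos hlaw (P := 2 ^ k • P), ih, ← pow_mul, pow_succ]
        intro n hn
        rw [← mul_nsmul']
        exact hP _ (by positivity)
    have h4 (k : ℕ) : k ≤ 4 ^ k := (Nat.lt_pow_self (by norm_num)).le
    rcases lt_trichotomy (H P) 1 with h | h | h
    · obtain ⟨k, hk⟩ := NNReal.exists_pow_lt_of_lt_one ha h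
      have := (hab _ (hP (2 ^ k) (by positivity))).1
      rw [hpow] at this
      exact absurd (this.trans (pow_le_pow_of_le_one zero_le h.le (h4 k))) hk.not_ge
    · exact h
    · obtain ⟨k, hk⟩ := pow_unbounded_of_one_lt b h
      have := (hab _ (hP (2 ^ k) (by positivity))).2
      rw [hpow] at this
      exact absurd ((pow_le_pow_right₀ h.le (h4 k)).trans this) hk.not_ge
  by_cases h : ∀ n : ℕ, n ≠ 0 → n • P ∉ Z
  · exact hinf P h
  push Not at h
  obtain ⟨n, hn, hnP⟩ := h
  have h1 : ∀ m : ℕ, m ≠ 0 → m • (P + P₀) ∉ Z := fun m hm hmem => by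
    refine hP₀ (n * m) (by positivity) ?_
    have e : (n * m) • P₀ = n • (m • (P + P₀)) - m • (n • P) := by
      rw [← mul_nsmul', ← mul_nsmul', nsmul_add, mul_comm m n]; abel
    rw [e]
    exact sub_mem (nsmul_mem hmem _) (nsmul_mem hnP _)
  have h2 : ∀ m : ℕ, m ≠ 0 → m • (P - P₀) ∉ Z := fun m hm hmem => by
    refine hP₀ (n * m) (by positivity) ?_
    have e : (n * m) • P₀ = m • (n • P) - n • (m • (P - P₀)) := by
      rw [← mul_nsmul', ← mul_nsmul', nsmul_sub, mul_comm m n]; abel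
    rw [e]
    exact sub_mem (nsmul_mem hnP _) (nsmul_mem hmem _)
  have := hlaw P P₀ hP (by simpa using hP₀ 1 one_ne_zero) (by simpa using h1 1 one_ne_zero)
    (by simpa using h2 1 one_ne_zero)
  rw [hinf _ h1, hinf _ h2, hinf _ hP₀, one_pow, mul_one, mul_one] at this
  exact (pow_left_inj₀ zero_le zero_le two_ne_zero).1 (by rw [← this, one_pow])

end Height

section BoundedBelow

variable {X ι : Type*}

/-- A function that is bounded below by a positive constant. -/
def IsBelow (f : X → ℝ≥0) : Prop := ∃ c, 0 < c ∧ ∀ x, c ≤ f x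

lemma IsBelow.mul {f f' g : X → ℝ≥0} (h : IsBelow (f ⊔ g)) (h' : IsBelow (f' ⊔ g)) :
    IsBelow ((f * f') ⊔ g) := by
  obtain ⟨c, hc, h⟩ := h
  obtain ⟨c', hc', h'⟩ := h'
  refine ⟨min (min c c') (c * c'), by positivity, fun x => ?_⟩
  rcases le_sup_iff.1 (h x) with h1 | h1
  · rcases le_sup_iff.1 (h' x) with h2 | h2
    · exact le_sup_of_le_left ((min_le_right _ _).trans (mul_le_mul' h1 h2))
    · exact le_sup_of_le_right ((min_le_left _ _).trans ((min_le_right _ _).trans h2))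
  · exact le_sup_of_le_right ((min_le_left _ _).trans ((min_le_left _ _).trans h1))

lemma IsBelow.prod {s : Finset ι} {f : ι → X → ℝ≥0} {g : X → ℝ≥0}
    (h : ∀ i ∈ s, IsBelow (f i ⊔ g)) : IsBelow ((∏ i ∈ s, f i) ⊔ g) := by
  classical
  induction s using Finset.induction_on with
  | empty => exact ⟨1, one_pos, fun x => le_sup_of_le_left (by simp)⟩
  | insert a s ha ih =>
    rw [Finset.prod_insert ha]
    exact (h a (by simp)).mul (ih fun i hi => h i (by simp [hi]))

end BoundedBelow

namespace Valuation

variable {K : Type*} [Field K] (v : Valuation K ℝ≥0)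

lemma one_le_max (x : K) : 1 ≤ max 1 (v x) := le_max_left _ _

lemma v_sub_le_max_mul (x a : K) : v (x - a) ≤ max 1 (v a) * max 1 (v x) := by
  refine v.map_sub_le ?_ ?_
  · exact (le_max_right _ _).trans (le_mul_of_one_le_left' (le_max_left _ _))
  · exact (le_max_right _ _).trans (le_mul_of_one_le_right' (le_max_left _ _))

lemma isBelow_sub_sub {a b : K} (hab : a ≠ b) :
    IsBelow ((fun x => v (x - a) / max 1 (v x)) ⊔ fun x => v (x - b) / max 1 (v x)) := by
  have h0 : 0 < v (a - b) := (v.pos_iff).2 (sub_ne_zero.2 hab)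
  refine ⟨min 1 (v (a - b) / max 1 (v a)), by positivity, fun x => ?_⟩
  rcases le_or_gt (v x) (max 1 (v a)) with h | h
  · refine (min_le_right _ _).trans ?_
    have h1 : v (a - b) ≤ max (v (x - a)) (v (x - b)) := by
      rw [max_comm, ← sub_sub_sub_cancel_left b a x]
      exact v.map_sub _ _
    have h2 : max 1 (v x) ≤ max 1 (v a) := max_le (le_max_left _ _) h
    have h3 : v (a - b) / max 1 (v a) ≤ max (v (x - a)) (v (x - b)) / max 1 (v x) := by
      gcongr
    refine h3.trans ?_
    rcases max_cases (v (x - a)) (v (x - b)) with ⟨h, -⟩ | ⟨h, -⟩ <;> rw [h]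
    · exact le_sup_left
    · exact le_sup_right
  · refine (min_le_left _ _).trans (le_sup_of_le_left ?_)
    obtain ⟨h1, h2⟩ := max_lt_iff.1 h
    show 1 ≤ v (x - a) / max 1 (v x)
    rw [v.map_sub_eq_of_lt_left h2, max_eq_right h1.le, div_self (by positivity)]

lemma isBelow_one_sub (a : K) :
    IsBelow ((fun x => 1 / max 1 (v x)) ⊔ fun x => v (x - a) / max 1 (v x)) := by
  refine ⟨1 / max 1 (v a), by positivity, fun x => ?_⟩
  rcases le_or_gt (v x) (max 1 (v a)) with h | h
  · refine le_sup_of_le_left ?_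
    have h2 : max 1 (v x) ≤ max 1 (v a) := max_le (le_max_left _ _) h
    show 1 / max 1 (v a) ≤ 1 / max 1 (v x)
    gcongr
  · refine le_sup_of_le_right ?_
    obtain ⟨h1, h2⟩ := max_lt_iff.1 h
    show 1 / max 1 (v a) ≤ v (x - a) / max 1 (v x)
    rw [v.map_sub_eq_of_lt_left h2, max_eq_right h1.le, div_self (by positivity)]
    exact div_le_one_of_le₀ (le_max_left _ _) zero_le

end Valuation

namespace KummerModel

variable {G K : Type*} [AddCommGroup G] [Field K] {D : KummerModel G K} {v : Valuation K ℝ≥0}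
  {Γ : G →+ G} {C : Finset G} {g : K}

lemma IsMult.map_eq_zero (h : D.IsMult Γ C g) {u : G} (hu : u ∈ C) : Γ u = 0 :=
  ((h.mem u).1 hu).2

lemma IsMult.ne_zero (h : D.IsMult Γ C g) {u : G} (hu : u ∈ C) : u ≠ 0 := ((h.mem u).1 hu).1

lemma ne_zero_of_map {P : G} (hP : Γ P ≠ 0) : P ≠ 0 := by
  rintro rfl
  exact hP (map_zero Γ)

lemma IsMult.prod_neg {M : Type*} [CommMonoid M] (h : D.IsMult Γ C g) (f : G → M) :
    ∏ u ∈ C, f (-u) = ∏ u ∈ C, f u := by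
  refine Finset.prod_nbij' (fun u => -u) (fun u => -u) ?_ ?_ ?_ ?_ ?_ <;>
    simp +contextual [h.mem]

lemma IsMult.add_ne (h : D.IsMult Γ C g) {P u : G} (hP : Γ P ≠ 0) (hu : u ∈ C) :
    P + u ≠ 0 := ne_zero_of_map (Γ := Γ) (by rwa [map_add, h.map_eq_zero hu, add_zero])

lemma IsMult.sub_ne (h : D.IsMult Γ C g) {P u : G} (hP : Γ P ≠ 0) (hu : u ∈ C) :
    P - u ≠ 0 := ne_zero_of_map (Γ := Γ) (by rwa [map_sub, h.map_eq_zero hu, sub_zero])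

lemma IsMult.x_ne (h : D.IsMult Γ C g) {P u : G} (hP : Γ P ≠ 0) (hu : u ∈ C) :
    D.x P ≠ D.x u :=
  D.x_ne (ne_zero_of_map hP) (h.ne_zero hu) (h.add_ne hP hu) (h.sub_ne hP hu)

/-- The polynomial vanishing at the abscissas of the kernel. -/
def kerPoly (D : KummerModel G K) (C : Finset G) (g : K) (P : G) : K :=
  g ^ 2 * ∏ u ∈ C, (D.x P - D.x u)

lemma IsMult.kerPoly_add_mul_sub (h : D.IsMult Γ C g) {P S : G} (hP : Γ P ≠ 0) (hS : Γ S ≠ 0)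
    (h₁ : Γ (P + S) ≠ 0) (h₂ : Γ (P - S) ≠ 0) :
    ((D.x P - D.x S) ^ 2) ^ (C.card + 1) * (D.kerPoly C g (P + S) * D.kerPoly C g (P - S)) =
      D.kerPoly C g P ^ 2 * D.kerPoly C g S ^ 2 * (D.x (Γ P) - D.x (Γ S)) ^ 2 := by
  have hu (u : G) (hu : u ∈ C) : (D.x P - D.x S) ^ 2 *
      ((D.x (P + S) - D.x u) * (D.x (P - S) - D.x u)) =
      (D.x P - D.x u) ^ 2 * ((D.x S - D.x (P + u)) * (D.x S - D.x (P + -u))) := by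
    rw [← sub_eq_add_neg, ← D.theta_eq (ne_zero_of_map hP) (h.ne_zero hu) (h.add_ne hP hu)
      (h.sub_ne hP hu), D.theta_rotate, D.theta_swap, D.theta_eq (ne_zero_of_map hP)
      (ne_zero_of_map hS) (ne_zero_of_map h₁) (ne_zero_of_map h₂)]
    ring
  have hprod := Finset.prod_congr (rfl : C = C) hu
  simp only [Finset.prod_mul_distrib, Finset.prod_const, Finset.prod_pow] at hprod
  rw [h.prod_neg (fun u => D.x S - D.x (P + u))] at hprod
  have := h.eq S P hS hP
  unfold kerPoly
  set A := ∏ u ∈ C, (D.x P - D.x u)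
  set B := ∏ u ∈ C, (D.x S - D.x u)
  set A₁ := ∏ u ∈ C, (D.x (P + S) - D.x u)
  set A₂ := ∏ u ∈ C, (D.x (P - S) - D.x u)
  set Q := ∏ u ∈ C, (D.x S - D.x (P + u))
  rw [pow_succ]
  linear_combination g ^ 4 * (D.x P - D.x S) ^ 2 * hprod -
    g ^ 4 * A ^ 2 * ((D.x (Γ S) - D.x (Γ P)) * (g ^ 2 * B) + (D.x S - D.x P) * Q) * this

/-- The local distortion of the `x`-coordinate height. -/
noncomputable def height (D : KummerModel G K) (v : Valuation K ℝ≥0) (Γ : G →+ G) (C : Finset G)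
    (g : K) (P : G) : ℝ≥0 :=
  v (D.kerPoly C g P) * max 1 (v (D.x (Γ P))) / max 1 (v (D.x P)) ^ (C.card + 1)

lemma IsMult.height_law (h : D.IsMult Γ C g) (hD : D.IsGood v) {P S : G} (hP : Γ P ≠ 0)
    (hS : Γ S ≠ 0) (h₁ : Γ (P + S) ≠ 0) (h₂ : Γ (P - S) ≠ 0) :
    D.height v Γ C g (P + S) * D.height v Γ C g (P - S) =
      D.height v Γ C g P ^ 2 * D.height v Γ C g S ^ 2 := by
  have r1 := congrArg v (h.kerPoly_add_mul_sub hP hS h₁ h₂)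
  have r2 := hD.v_prod (ne_zero_of_map hP) (ne_zero_of_map hS) (ne_zero_of_map h₁)
    (ne_zero_of_map h₂)
  have r3 := hD.v_prod hP hS (by rwa [← map_add]) (by rwa [← map_sub])
  simp only [map_mul, map_pow] at r1
  rw [← map_add, ← map_sub] at r3
  have d1 : v (D.x P - D.x S) ≠ 0 := v.ne_zero_iff.2 <| sub_ne_zero.2 <|
    D.x_ne (ne_zero_of_map hP) (ne_zero_of_map hS) (ne_zero_of_map h₁) (ne_zero_of_map h₂)
  have d2 : v (D.x (Γ P) - D.x (Γ S)) ≠ 0 := v.ne_zero_iff.2 <| sub_ne_zero.2 <|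
    D.x_ne hP hS (by rwa [← map_add]) (by rwa [← map_sub])
  unfold height
  have m1 : max 1 (v (D.x P)) ≠ 0 := by positivity
  have m2 : max 1 (v (D.x S)) ≠ 0 := by positivity
  have m3 : max 1 (v (D.x (P + S))) ≠ 0 := by positivity
  have m4 : max 1 (v (D.x (P - S))) ≠ 0 := by positivity
  generalize v (D.x P - D.x S) = d at *
  generalize v (D.x (Γ P) - D.x (Γ S)) = d' at *
  generalize max 1 (v (D.x P)) = a at *
  generalize max 1 (v (D.x S)) = b at *
  generalize max 1 (v (D.x (P + S))) = a₁ at *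
  generalize max 1 (v (D.x (P - S))) = a₂ at *
  generalize max 1 (v (D.x (Γ P))) = a' at *
  generalize max 1 (v (D.x (Γ S))) = b' at *
  generalize max 1 (v (D.x (Γ (P + S)))) = a₁' at *
  generalize max 1 (v (D.x (Γ (P - S)))) = a₂' at *
  generalize v (D.kerPoly C g P) = V at *
  generalize v (D.kerPoly C g S) = W at *
  generalize v (D.kerPoly C g (P + S)) = V₁ at *
  generalize v (D.kerPoly C g (P - S)) = V₂ at *
  generalize C.card + 1 = n at *
  have r2' : (a₁ * a₂) ^ n * (d ^ 2) ^ n = (a ^ n) ^ 2 * (b ^ n) ^ 2 := by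
    rw [← mul_pow, r2, mul_pow, pow_right_comm a, pow_right_comm b]
  rw [div_mul_div_comm, div_pow, div_pow, div_mul_div_comm, ← mul_pow a₁ a₂ n, ← r2',
    div_eq_div_iff (by positivity) (by positivity)]
  have : (V₁ * a₁' * (V₂ * a₂') * ((a₁ * a₂) ^ n * (d ^ 2) ^ n)) * d' ^ 2 =
      ((V * a') ^ 2 * (W * b') ^ 2 * (a₁ * a₂) ^ n) * d' ^ 2 := by
    calc _ = ((d ^ 2) ^ n * (V₁ * V₂)) * (a₁' * a₂' * d' ^ 2) * (a₁ * a₂) ^ n := by ring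
      _ = _ := by rw [r1, r3]; ring
  exact mul_right_cancel₀ (by positivity) this

lemma IsMult.height_bounds (h : D.IsMult Γ C g) {S : G} (hS : Γ S ≠ 0) :
    ∃ a b, 0 < a ∧ ∀ P, Γ P ≠ 0 → a ≤ D.height v Γ C g P ∧ D.height v Γ C g P ≤ b := by
  have hg : 0 < v g := v.pos_iff.2 h.ne
  have hSu (u : G) (hu : u ∈ C) : Γ (S + u) ≠ 0 := by rwa [map_add, h.map_eq_zero hu, add_zero]
  have hA (b : K) (hb : ∀ u ∈ C, D.x u ≠ b) :
      IsBelow (((∏ u ∈ C, fun x => v (x - D.x u) / max 1 (v x)) * fun x => 1 / max 1 (v x)) ⊔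
        fun x => v (x - b) / max 1 (v x)) :=
    (IsBelow.prod fun u hu => v.isBelow_sub_sub (hb u hu)).mul (v.isBelow_one_sub b)
  have hAB : IsBelow (((∏ u ∈ C, fun x => v (x - D.x (S + u)) / max 1 (v x)) *
      fun x => v (x - D.x S) / max 1 (v x)) ⊔
      ((∏ u ∈ C, fun x => v (x - D.x u) / max 1 (v x)) * fun x => 1 / max 1 (v x))) := by
    refine (IsBelow.prod fun u hu => ?_).mul ?_ <;> rw [sup_comm]
    · exact hA _ fun u' hu' => (h.x_ne (hSu u hu) hu').symm
    · exact hA _ fun u' hu' => (h.x_ne hS hu').symm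
  obtain ⟨c, hc, hAB⟩ := hAB
  set RA := ∏ u ∈ C, max 1 (v (D.x u))
  set RB := (∏ u ∈ C, max 1 (v (D.x (S + u)))) * max 1 (v (D.x S))
  refine ⟨min (v g ^ 2 * c) (c / max 1 (v (D.x (Γ S)))),
    max (v g ^ 2 * RA * max 1 (v (D.x (Γ S)))) RB, by positivity, fun P hP => ?_⟩
  have heq := congrArg v (h.eq P S hP hS)
  simp only [map_mul, map_pow, map_prod] at heq
  have hAB := hAB (D.x P)
  simp only [Pi.sup_apply, Pi.mul_apply, Finset.prod_apply, Finset.prod_div_distrib,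
    Finset.prod_const, div_mul_div_comm, ← pow_succ, mul_one] at hAB
  have hRA : ∏ u ∈ C, v (D.x P - D.x u) ≤ RA * max 1 (v (D.x P)) ^ C.card := by
    rw [← Finset.prod_const, ← Finset.prod_mul_distrib]
    exact Finset.prod_le_prod' fun u _ => v.v_sub_le_max_mul _ _
  have hRB : v (D.x P - D.x S) * ∏ u ∈ C, v (D.x P - D.x (S + u)) ≤
      RB * max 1 (v (D.x P)) ^ (C.card + 1) := by
    rw [pow_succ, mul_mul_mul_comm, mul_comm, ← Finset.prod_const (s := C),
      ← Finset.prod_mul_distrib]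
    exact mul_le_mul' (Finset.prod_le_prod' fun u _ => v.v_sub_le_max_mul _ _)
      (v.v_sub_le_max_mul _ _)
  have e : v (D.kerPoly C g P) = v g ^ 2 * ∏ u ∈ C, v (D.x P - D.x u) := by
    simp [kerPoly]
  have e' : D.height v Γ C g P = v g ^ 2 * ((∏ u ∈ C, v (D.x P - D.x u)) *
      max 1 (v (D.x (Γ P)))) / max 1 (v (D.x P)) ^ (C.card + 1) := by
    rw [height, e]; ring
  have hsub := v.v_sub_le_max_mul (D.x (Γ P)) (D.x (Γ S))
  rw [e']
  have hM := v.one_le_max (D.x P)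
  have hM' : 1 ≤ max 1 (v (D.x (Γ P))) := v.one_le_max _
  have hMS : 1 ≤ max 1 (v (D.x (Γ S))) := v.one_le_max _
  have hmax : max 1 (v (D.x (Γ P))) ≤ max (max 1 (v (D.x (Γ S)))) (v (D.x (Γ P) - D.x (Γ S))) := by
    refine max_le (le_max_of_le_left (v.one_le_max _)) ?_
    have := v.map_add (D.x (Γ P) - D.x (Γ S)) (D.x (Γ S))
    rw [sub_add_cancel] at this
    exact this.trans (max_le (le_max_right _ _) (le_max_of_le_left (le_max_right _ _)))
  generalize hMM : max 1 (v (D.x P)) = M at *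
  generalize max 1 (v (D.x (Γ P))) = M' at *
  generalize max 1 (v (D.x (Γ S))) = MS at *
  generalize v (D.x (Γ P) - D.x (Γ S)) = d at *
  generalize ∏ u ∈ C, v (D.x P - D.x u) = A at *
  generalize ∏ u ∈ C, v (D.x P - D.x (S + u)) = B at *
  generalize v (D.x P - D.x S) = e at *
  have hMn : 0 < M ^ (C.card + 1) := by positivity
  constructor
  · rw [le_div_iff₀ hMn]
    rcases le_sup_iff.1 hAB with h1 | h1 <;> rw [le_div_iff₀ hMn] at h1
    · refine (mul_le_mul_left (min_le_right _ _) _).trans ?_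
      rw [div_mul_eq_mul_div, div_le_iff₀ (by positivity)]
      refine h1.trans ?_
      rw [mul_comm B, ← heq]
      calc _ ≤ (MS * M') * (v g ^ 2 * A) := by gcongr
        _ = _ := by ring
    · refine (mul_le_mul_left (min_le_left _ _) _).trans ?_
      rw [mul_assoc]
      refine mul_le_mul_right ?_ _
      exact h1.trans (le_mul_of_one_le_right' hM')
  · rw [div_le_iff₀ hMn]
    rcases le_max_iff.1 hmax with h1 | h1
    · refine le_trans ?_ (mul_le_mul_left (le_max_left _ _) _)
      calc _ ≤ v g ^ 2 * ((RA * M ^ C.card) * MS) := by gcongr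
        _ ≤ v g ^ 2 * ((RA * M ^ (C.card + 1)) * MS) := by
            gcongr
            omega
        _ = _ := by ring
    · refine le_trans ?_ (mul_le_mul_left (le_max_right _ _) _)
      calc _ ≤ v g ^ 2 * (A * d) := by gcongr
        _ = e * B := by rw [← heq]; ring
        _ ≤ _ := hRB

lemma IsMult.height_eq_one (h : D.IsMult Γ C g) (hD : D.IsGood v) {P₀ : G}
    (hP₀ : ∀ n : ℕ, n ≠ 0 → n • P₀ ≠ 0) {P : G} (hP : Γ P ≠ 0) : D.height v Γ C g P = 1 := by
  have hmem (u : G) : u ∉ Γ.ker ↔ Γ u ≠ 0 := by rw [AddMonoidHom.mem_ker]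
  have hfin : (Γ.ker : Set G).Finite := by
    classical
    refine (insert 0 C).finite_toSet.subset fun u hu => ?_
    have hu : Γ u = 0 := hu
    by_cases hu0 : u = 0 <;> simp [hu0, h.mem, hu]
  have hP₀' : ∀ n : ℕ, n ≠ 0 → n • P₀ ∉ Γ.ker := fun n hn hmem => by
    have : Finite Γ.ker := hfin
    have h1 := isOfFinAddOrder_of_finite (⟨n • P₀, hmem⟩ : Γ.ker)
    obtain ⟨m, hm, h2⟩ := isOfFinAddOrder_iff_nsmul_eq_zero.1 h1
    have h3 : m • (n • P₀) = 0 := congrArg Subtype.val h2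
    rw [← mul_nsmul'] at h3
    exact hP₀ _ (by positivity) h3
  obtain ⟨a, b, ha, hab⟩ := h.height_bounds (v := v) (S := P₀)
    ((hmem _).1 (by simpa using hP₀' 1 one_ne_zero))
  refine _root_.height_eq_one (Z := Γ.ker) ?_ ?_ ha (fun P hP => hab P hP) hP₀' hP
  · exact fun P hP => (ha.trans_le (hab P hP).1).ne'
  · exact fun P S hP hS h₁ h₂ => h.height_law hD hP hS h₁ h₂

end KummerModel

namespace Valuation

variable {K ι : Type*} [Field K] (v : Valuation K ℝ≥0)

lemma exists_sub_eq_one [IsAlgClosed K] (s : Finset ι) (f : ι → K) (hf : ∀ i ∈ s, v (f i) ≤ 1) :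
    ∃ c, v c ≤ 1 ∧ ∀ i ∈ s, v (c - f i) = 1 := by
  classical
  open Polynomial in
  obtain ⟨c, hc⟩ := IsAlgClosed.exists_root (X * ∏ i ∈ s, (X - C (f i)) - 1) (by
    have hm : (X * ∏ i ∈ s, (X - C (f i))).Monic :=
      monic_X.mul (monic_prod_of_monic _ _ fun i _ => monic_X_sub_C _)
    have hd : (X * ∏ i ∈ s, (X - C (f i))).natDegree = s.card + 1 := by
      rw [monic_X.natDegree_mul (monic_prod_of_monic _ _ fun i _ => monic_X_sub_C _),
        natDegree_X, natDegree_prod_of_monic _ _ fun i _ => monic_X_sub_C _]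
      simp [add_comm]
    have : (X * ∏ i ∈ s, (X - C (f i)) - 1).natDegree = s.card + 1 := by
      rw [← hd]
      exact natDegree_sub_C (a := 1)
    intro h
    have := natDegree_eq_zero_iff_degree_le_zero.2 h.le
    omega)
  have hc' : v c * ∏ i ∈ s, v (c - f i) = 1 := by
    rw [Polynomial.IsRoot, Polynomial.eval_sub, Polynomial.eval_mul, Polynomial.eval_prod] at hc
    simp only [Polynomial.eval_X, Polynomial.eval_sub, Polynomial.eval_C, Polynomial.eval_one] at hc
    rw [← map_prod, ← map_mul, sub_eq_zero.1 hc, map_one]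
  have h1 : v c ≤ 1 := by
    by_contra! h
    have : ∀ i ∈ s, 1 ≤ v (c - f i) := fun i hi => by
      rw [v.map_sub_eq_of_lt_left ((hf i hi).trans_lt h)]
      exact h.le
    have h2 : 1 ≤ ∏ i ∈ s, v (c - f i) := Finset.one_le_prod' this
    exact hc'.not_gt (h.trans_le (le_mul_of_one_le_right' h2))
  refine ⟨c, h1, fun i hi => ?_⟩
  have h2 : ∀ i ∈ s, v (c - f i) ≤ 1 := fun i hi => v.map_sub_le h1 (hf i hi)
  refine le_antisymm (h2 i hi) ?_
  rw [← Finset.mul_prod_erase _ _ hi] at hc'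
  by_contra! h
  refine hc'.not_lt ((mul_le_of_le_one_left' h1).trans_lt ?_)
  exact mul_lt_one_of_lt_of_le h (Finset.prod_le_one' fun j hj => h2 j (Finset.mem_of_mem_erase hj))

lemma prod_sub_prod_lt {s : Finset ι} {f g : ι → K} (hf : ∀ i ∈ s, v (f i) ≤ 1)
    (hg : ∀ i ∈ s, v (g i) ≤ 1) (hfg : ∀ i ∈ s, v (f i - g i) < 1) :
    v (∏ i ∈ s, f i - ∏ i ∈ s, g i) < 1 := by
  classical
  induction s using Finset.induction_on with
  | empty => simp
  | insert a s ha ih =>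
    rw [Finset.prod_insert ha, Finset.prod_insert ha]
    have e : f a * ∏ i ∈ s, f i - g a * ∏ i ∈ s, g i = f a * (∏ i ∈ s, f i - ∏ i ∈ s, g i) +
      (f a - g a) * ∏ i ∈ s, g i := by ring
    rw [e]
    refine v.map_add_lt ?_ ?_ <;> rw [map_mul]
    · exact (mul_le_of_le_one_left' (hf a (by simp))).trans_lt (ih (fun i hi => hf i (by simp [hi]))
        (fun i hi => hg i (by simp [hi])) fun i hi => hfg i (by simp [hi]))
    · refine mul_lt_one_of_lt_of_le (hfg a (by simp)) ?_
      rw [map_prod]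
      exact Finset.prod_le_one' fun i hi => hg i (by simp [hi])

end Valuation

namespace KummerModel

variable {G K : Type*} [AddCommGroup G] [Field K] {D : KummerModel G K} {v : Valuation K ℝ≥0}
  {Γ : G →+ G} {C : Finset G} {g : K}

lemma IsMult.neg_mem (h : D.IsMult Γ C g) {u : G} (hu : u ∈ C) : -u ∈ C := by
  rw [h.mem] at hu ⊢
  simpa using hu

lemma IsMult.mem_iff' (h : D.IsMult Γ C g) {u : G} : Γ u = 0 ↔ u = 0 ∨ u ∈ C := by
  rw [h.mem]
  by_cases hu : u = 0 <;> simp [hu]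

lemma IsGood.max_eq_one (hD : D.IsGood v) {P : G} (hP : P ∉ hD.ker) : max 1 (v (D.x P)) = 1 :=
  max_eq_left (hD.notMem_ker.1 hP).2

lemma IsGood.v_sub_eq (hD : D.IsGood v) {P S : G} (hP : P ∉ hD.ker) (hS : S ≠ 0)
    (h₁ : P + S ∉ hD.ker) (h₂ : P - S ∉ hD.ker) : v (D.x P - D.x S) = max 1 (v (D.x S)) := by
  have hPx := (hD.notMem_ker.1 hP).2
  by_cases hSk : S ∈ hD.ker
  · have := (hD.mem_ker.1 hSk).resolve_left hS
    rw [max_eq_right this.le, v.map_sub_eq_of_lt_right (hPx.trans_lt this)]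
  · rw [hD.max_eq_one hSk]
    refine le_antisymm (v.map_sub_le hPx (hD.notMem_ker.1 hSk).2) ?_
    by_contra! h
    exact (hD.mem_ker_of_v_sub_lt hP hSk h).elim h₂ h₁

lemma IsMult.star (h : D.IsMult Γ C g) (hD : D.IsGood v)
    (hinf : ∃ P₀ : G, ∀ n : ℕ, n ≠ 0 → n • P₀ ≠ 0) {P : G} (hP : Γ P ≠ 0) :
    v (D.kerPoly C g P) * max 1 (v (D.x (Γ P))) = max 1 (v (D.x P)) ^ (C.card + 1) := by
  obtain ⟨P₀, hP₀⟩ := hinf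
  have := h.height_eq_one hD hP₀ hP
  rwa [height, div_eq_one_iff_eq (by positivity)] at this

lemma IsMult.v_kerPoly (h : D.IsMult Γ C g) (hD : D.IsGood v) {P : G} (hP : P ∉ hD.ker)
    (hPC : ∀ u ∈ C, P - u ∉ hD.ker) :
    v (D.kerPoly C g P) = v g ^ 2 * ∏ u ∈ C, max 1 (v (D.x u)) := by
  rw [kerPoly, map_mul, map_pow, map_prod]
  congr 1
  refine Finset.prod_congr rfl fun u hu => hD.v_sub_eq hP (h.ne_zero hu) ?_ (hPC u hu)
  simpa using hPC _ (h.neg_mem hu)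

lemma IsMult.v_sq_mul_prod [IsAlgClosed K] (h : D.IsMult Γ C g) (hD : D.IsGood v)
    (hinf : ∃ P₀ : G, ∀ n : ℕ, n ≠ 0 → n • P₀ ≠ 0) (hΓ : Function.Surjective Γ) :
    v g ^ 2 * ∏ u ∈ C, max 1 (v (D.x u)) = 1 := by
  classical
  have hgood (P : G) (hP : P ∉ hD.ker) (hPC : ∀ u ∈ C, P - u ∉ hD.ker) :
      (v g ^ 2 * ∏ u ∈ C, max 1 (v (D.x u))) * max 1 (v (D.x (Γ P))) = 1 := by
    have h0 : Γ P ≠ 0 := fun h0 => by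
      rcases h.mem_iff'.1 h0 with h0 | h0
      · exact hP (h0 ▸ zero_mem _)
      · exact hPC P h0 (by simp)
    rw [← h.v_kerPoly hD hP hPC, h.star hD hinf h0, hD.max_eq_one hP, one_pow]
  obtain ⟨c, hc, hcu⟩ := v.exists_sub_eq_one (C.filter fun u => u ∉ hD.ker) (fun u => D.x u)
    fun u hu => (hD.notMem_ker.1 (Finset.mem_filter.1 hu).2).2
  obtain ⟨P, hP0, rfl⟩ := D.surj c
  have hP : P ∉ hD.ker := hD.notMem_ker.2 ⟨hP0, hc⟩
  have hPC : ∀ u ∈ C, P - u ∉ hD.ker := fun u hu hmem => by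
    by_cases huk : u ∈ hD.ker
    · exact hP (by simpa using add_mem hmem huk)
    · have := hD.v_sub_lt huk hmem
      rw [add_sub_cancel] at this
      exact this.ne (hcu u (Finset.mem_filter.2 ⟨hu, huk⟩))
  have hPg := hgood P hP hPC
  by_cases hΓP : Γ P ∈ hD.ker
  swap
  · rwa [hD.max_eq_one hΓP, mul_one] at hPg
  have key (Q : G) (hQ : Q ∉ hD.ker) : ∃ R ∈ hD.ker, Γ R = Q := by
    obtain ⟨R, rfl⟩ := hΓ Q
    by_cases hR : R ∈ hD.ker
    · exact ⟨R, hR, rfl⟩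
    by_cases hRC : ∀ u ∈ C, R - u ∉ hD.ker
    · have := hgood R hR hRC
      rw [hD.max_eq_one hQ, mul_one] at this
      rw [this, one_mul] at hPg
      rcases hD.mem_ker.1 hΓP with h1 | h1
      · rcases h.mem_iff'.1 h1 with h0 | h0
        · exact (hP0 h0).elim
        · exact (hPC P h0 (by simp)).elim
      · rw [max_eq_right h1.le] at hPg
        exact (h1.ne' hPg).elim
    · push Not at hRC
      obtain ⟨u, hu, hRu⟩ := hRC
      exact ⟨R - u, hRu, by rw [map_sub, h.map_eq_zero hu, sub_zero]⟩
  obtain ⟨R₁, hR₁, e₁⟩ := key P hP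
  obtain ⟨R₂, hR₂, e₂⟩ := key (P + Γ P) fun hmem => hP (by simpa using sub_mem hmem hΓP)
  have : Γ (P - (R₂ - R₁)) = 0 := by rw [map_sub, map_sub, e₁, e₂]; abel
  rcases h.mem_iff'.1 this with h0 | h0
  · exact (hP (by rw [sub_eq_zero.1 h0]; exact sub_mem hR₂ hR₁)).elim
  · refine (hPC _ h0 ?_).elim
    rw [sub_sub_cancel]
    exact sub_mem hR₂ hR₁

lemma IsMult.map_mem_ker [IsAlgClosed K] (h : D.IsMult Γ C g) (hD : D.IsGood v)
    (hinf : ∃ P₀ : G, ∀ n : ℕ, n ≠ 0 → n • P₀ ≠ 0) (hΓ : Function.Surjective Γ) {P : G}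
    (hP : P ∈ hD.ker) : Γ P ∈ hD.ker := by
  by_cases h0 : Γ P = 0
  · rw [h0]; exact zero_mem _
  have hx := (hD.mem_ker.1 hP).resolve_left (ne_zero_of_map h0)
  have hstar := h.star hD hinf h0
  have hG := h.v_sq_mul_prod hD hinf hΓ
  have hle : v (D.kerPoly C g P) ≤ max 1 (v (D.x P)) ^ C.card := by
    rw [kerPoly, map_mul, map_pow, map_prod]
    calc _ ≤ v g ^ 2 * ∏ u ∈ C, (max 1 (v (D.x u)) * max 1 (v (D.x P))) := by
          gcongr
          exact v.v_sub_le_max_mul _ _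
      _ = _ := by rw [Finset.prod_mul_distrib, Finset.prod_const, ← mul_assoc, hG, one_mul]
  refine hD.mem_ker.2 (Or.inr ?_)
  rw [max_eq_right hx.le] at hstar hle
  by_contra! hcon
  rw [max_eq_left hcon, mul_one] at hstar
  rw [hstar] at hle
  exact hle.not_gt (pow_lt_pow_right₀ hx (Nat.lt_succ_self _))

lemma IsMult.exists_sub_mem_ker [IsAlgClosed K] (h : D.IsMult Γ C g) (hD : D.IsGood v)
    (hinf : ∃ P₀ : G, ∀ n : ℕ, n ≠ 0 → n • P₀ ≠ 0) (hΓ : Function.Surjective Γ) {P : G}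
    (hP : Γ P ∈ hD.ker) : ∃ u, Γ u = 0 ∧ P - u ∈ hD.ker := by
  by_contra! hcon
  have h0 : Γ P ≠ 0 := fun h0 => hcon P h0 (by simp)
  have hPk : P ∉ hD.ker := by simpa using hcon 0 (map_zero _)
  have := h.star hD hinf h0
  rw [h.v_kerPoly hD hPk fun u hu => hcon u (h.map_eq_zero hu), h.v_sq_mul_prod hD hinf hΓ,
    one_mul, hD.max_eq_one hPk, one_pow] at this
  rcases hD.mem_ker.1 hP with h1 | h1
  · exact h0 h1
  · rw [max_eq_right h1.le] at this
    exact h1.ne' this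

lemma IsMult.notMem_ker_of_v_eq_one [IsAlgClosed K] (h : D.IsMult Γ C g) (hD : D.IsGood v)
    (hinf : ∃ P₀ : G, ∀ n : ℕ, n ≠ 0 → n • P₀ ≠ 0) (hΓ : Function.Surjective Γ) (hg : v g = 1)
    {u : G} (hu : Γ u = 0) (huk : u ∈ hD.ker) : u = 0 := by
  have := h.v_sq_mul_prod hD hinf hΓ
  rw [hg, one_pow, one_mul, Finset.prod_eq_one_iff_of_one_le' fun _ _ => v.one_le_max _] at this
  by_contra h0
  have h1 := this u ((h.mem u).2 ⟨h0, hu⟩)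
  have h2 := (hD.mem_ker.1 huk).resolve_left h0
  rw [max_eq_right h2.le] at h1
  exact h2.ne' h1

lemma IsMult.exists_mem_ker_of_v_lt_one [IsAlgClosed K] (h : D.IsMult Γ C g) (hD : D.IsGood v)
    (hinf : ∃ P₀ : G, ∀ n : ℕ, n ≠ 0 → n • P₀ ≠ 0) (hΓ : Function.Surjective Γ) (hg : v g < 1) :
    ∃ u, u ≠ 0 ∧ Γ u = 0 ∧ u ∈ hD.ker := by
  have := h.v_sq_mul_prod hD hinf hΓ
  by_contra! hcon
  rw [Finset.prod_eq_one fun u hu => hD.max_eq_one (hcon u (h.ne_zero hu) (h.map_eq_zero hu)),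
    mul_one] at this
  exact this.not_lt ((pow_lt_one_iff two_ne_zero).2 hg)

/-- If the kernel reduces to zero then the map on `x`-coordinates reduces to a power map, up to
affine transformations. -/
lemma IsMult.exists_v_sub_lt [IsAlgClosed K] (h : D.IsMult Γ C g) (hD : D.IsGood v)
    (hinf : ∃ P₀ : G, ∀ n : ℕ, n ≠ 0 → n • P₀ ≠ 0) (hΓ : Function.Surjective Γ)
    (hker : ∀ u, Γ u = 0 → u ∈ hD.ker) :
    ∃ c a d, v c = 1 ∧ v a ≤ 1 ∧ v d ≤ 1 ∧ ∀ P, P ∉ hD.ker →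
      v (c * D.x (Γ P) - ((D.x P - a) ^ (C.card + 1) + d)) < 1 := by
  obtain ⟨S, hS0, hSx⟩ := D.surj 0
  have hmap (P : G) (hP : P ∉ hD.ker) : Γ P ∉ hD.ker := fun hmem => by
    obtain ⟨u, hu, hPu⟩ := h.exists_sub_mem_ker hD hinf hΓ hmem
    exact hP (by simpa using add_mem hPu (hker u hu))
  have hS : S ∉ hD.ker := hD.notMem_ker.2 ⟨hS0, by simp [hSx]⟩
  have hΓS := hD.notMem_ker.1 (hmap S hS)
  have hu1 (u : G) (hu : u ∈ C) : 1 < v (D.x u) :=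
    (hD.mem_ker.1 (hker u (h.map_eq_zero hu))).resolve_left (h.ne_zero hu)
  set c := g ^ 2 * ∏ u ∈ C, (-D.x u)
  have hc : v c = 1 := by
    rw [← h.v_sq_mul_prod hD hinf hΓ]
    simp only [c, map_mul, map_pow, map_prod, Valuation.map_neg]
    congr 1
    exact Finset.prod_congr rfl fun u hu => (max_eq_right (hu1 u hu).le).symm
  refine ⟨c, D.x S, c * D.x (Γ S), hc, by simp [hSx], by rw [map_mul, hc, one_mul]; exact hΓS.2,
    fun P hP => ?_⟩
  have hPx := (hD.notMem_ker.1 hP).2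
  have hΓP := hD.notMem_ker.1 (hmap P hP)
  have heq := h.eq P S hΓP.1 hΓS.1
  have e1 : g ^ 2 * ∏ u ∈ C, (D.x P - D.x u) = c * ∏ u ∈ C, (1 - D.x P * (D.x u)⁻¹) := by
    rw [mul_assoc, ← Finset.prod_mul_distrib]
    congr 1
    refine Finset.prod_congr rfl fun u hu => ?_
    have := v.ne_zero_of_one_lt (hu1 u hu)
    field_simp
    ring
  have hsm (u : G) (hu : u ∈ C) : v (D.x P * (D.x u)⁻¹) < 1 := by
    rw [mul_comm]
    exact v.mul_lt_one_of_mem (v.inv_lt_one_of_one_lt (hu1 u hu)) hPx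
  have h1 : v (∏ u ∈ C, (1 - D.x P * (D.x u)⁻¹) - ∏ u ∈ C, (1 : K)) < 1 := by
    refine v.prod_sub_prod_lt (fun u hu => (v.map_one_sub_of_lt (hsm u hu)).le) (by simp)
      fun u hu => ?_
    rw [sub_sub_cancel_left, Valuation.map_neg]
    exact hsm u hu
  have hSu (u : G) (hu : u ∈ C) := hker u (h.map_eq_zero hu)
  have hSu' (u : G) (hu : u ∈ C) : v (D.x (S + u)) ≤ 1 := (hD.notMem_ker.1
    fun hmem => hS (by simpa using sub_mem hmem (hSu u hu))).2
  have h2 : v (∏ u ∈ C, (D.x P - D.x (S + u)) - ∏ u ∈ C, (D.x P - D.x S)) < 1 := by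
    refine v.prod_sub_prod_lt (fun u hu => v.map_sub_le hPx (hSu' u hu))
      (fun u hu => v.map_sub_le hPx (by simp [hSx])) fun u hu => ?_
    rw [sub_sub_sub_cancel_left, Valuation.map_sub_swap]
    exact hD.v_sub_lt hS (hSu u hu)
  rw [e1] at heq
  rw [Finset.prod_const] at h2
  rw [Finset.prod_const_one] at h1
  generalize ∏ u ∈ C, (1 - D.x P * (D.x u)⁻¹) = A at *
  generalize ∏ u ∈ C, (D.x P - D.x (S + u)) = B at *
  have e2 : c * D.x (Γ P) - ((D.x P - D.x S) ^ (C.card + 1) + c * D.x (Γ S)) =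
      (B - (D.x P - D.x S) ^ C.card) * (D.x P - D.x S) -
        (A - 1) * (c * (D.x (Γ P) - D.x (Γ S))) := by
    linear_combination heq
  rw [e2]
  refine (v.map_sub _ _).trans_lt (max_lt (v.mul_lt_one_of_mem h2 ?_) (v.mul_lt_one_of_mem h1 ?_))
  · exact v.map_sub_le hPx (by simp [hSx])
  · refine mul_mem (le_of_eq hc) (v.map_sub_le hΓP.2 hΓS.2)

end KummerModel

lemma exists_zsmul_eq_of_prime_nsmul {G : Type*} [AddCommGroup G] {p n : ℕ} (hp : p.Prime)
    {w₀ : G} (h₀ : p ^ n • w₀ = 0) {a b : ℤ} (ha : a • w₀ ≠ 0) (hpa : p • a • w₀ = 0)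
    (hpb : p • b • w₀ = 0) : ∃ c : ℤ, c • a • w₀ = b • w₀ := by
  obtain ⟨k, -, hk⟩ := (Nat.dvd_prime_pow hp).1 (addOrderOf_dvd_iff_nsmul_eq_zero.2 h₀)
  have hz (m : ℤ) : m • w₀ = 0 ↔ (p : ℤ) ^ k ∣ m := by
    rw [← addOrderOf_dvd_iff_zsmul_eq_zero, hk]
    push_cast
    rfl
  have hp0 : (p : ℤ) ≠ 0 := by exact_mod_cast hp.ne_zero
  rw [← natCast_zsmul, ← mul_zsmul, hz] at hpa hpb
  rw [Ne, hz] at ha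
  cases k with
  | zero => simp at ha
  | succ k =>
    rw [pow_succ', mul_dvd_mul_iff_left hp0] at hpa hpb
    obtain ⟨a', rfl⟩ := hpa
    obtain ⟨b', rfl⟩ := hpb
    have hcop : IsCoprime (p : ℤ) a' := (Nat.prime_iff_prime_int.1 hp).coprime_iff_not_dvd.2
      fun hdvd => ha (by rw [pow_succ]; exact mul_dvd_mul_left _ hdvd)
    obtain ⟨y, x, hxy⟩ := hcop
    refine ⟨b' * x, ?_⟩
    rw [← mul_zsmul', ← sub_eq_zero, sub_eq_add_neg, ← sub_zsmul, hz]
    exact ⟨-(b' * y), by rw [pow_succ]; linear_combination (p : ℤ) ^ k * b' * hxy⟩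

namespace KummerModel.IsCM

variable {G K : Type*} [AddCommGroup G] [Field K] {D : KummerModel G K} {v : Valuation K ℝ≥0}
  {Γ : G →+ G} {q p n : ℕ} {τ : K}

lemma q_nsmul (h : D.IsCM Γ q p τ) {u : G} (hu : Γ u = 0) : q • u = 0 := by
  have := h.sq u
  rw [hu, map_zero, zero_sub] at this
  exact neg_eq_zero.1 this.symm

lemma map_map_of_nsmul (h : D.IsCM Γ (p ^ n) p τ) (hn : n ≠ 0) {u : G} (hu : p • u = 0) :
    Γ (Γ u) = Γ u := by
  have : p ^ n • u = 0 := by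
    obtain ⟨m, rfl⟩ := Nat.exists_eq_succ_of_ne_zero hn
    rw [pow_succ, mul_nsmul', hu, nsmul_zero]
  rw [h.sq, this, sub_zero]

lemma mem_ker_of_map_eq_zero [IsAlgClosed K] (h : D.IsCM Γ (p ^ n) p τ) (hp : p.Prime) (hn : n ≠ 0)
    (hD : D.IsGood v) (hvp : v p < 1) (hvτ : v τ < 1) {u : G} (hu : Γ u = 0) : u ∈ hD.ker := by
  obtain ⟨Cp, hCp⟩ := h.mult_nsmul
  obtain ⟨C₁, hC₁, -⟩ := h.mult_one_sub
  obtain ⟨C, hC, -⟩ := h.mult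
  obtain ⟨w, hw0, hpw, hwk⟩ :=
    hCp.exists_mem_ker_of_v_lt_one hD h.infinite_order h.surj_nsmul hvp
  have hpw : p • w = 0 := hpw
  have hΓw : Γ w = 0 := by
    refine hC₁.notMem_ker_of_v_eq_one hD h.infinite_order h.surj_one_sub
      (v.map_one_sub_of_lt hvτ) ?_ (hC.map_mem_ker hD h.infinite_order h.surj hwk)
    rw [AddMonoidHom.sub_apply, AddMonoidHom.id_apply, h.map_map_of_nsmul hn hpw, sub_self]
  obtain ⟨w₀, hΓ0, hw₀⟩ := h.cyclic
  have hbase (t : G) (ht : Γ t = 0) (hpt : p • t = 0) : t ∈ hD.ker := by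
    obtain ⟨a, rfl⟩ := hw₀ w hΓw
    obtain ⟨b, rfl⟩ := hw₀ t ht
    obtain ⟨c, hc⟩ := exists_zsmul_eq_of_prime_nsmul hp (h.q_nsmul hΓ0) hw0 hpw hpt
    rw [← hc]
    exact zsmul_mem hwk c
  have hstep (u : G) (hu : Γ u = 0) (hpu : p • u ∈ hD.ker) : u ∈ hD.ker := by
    obtain ⟨t, ht, hut⟩ := hCp.exists_sub_mem_ker hD h.infinite_order h.surj_nsmul (P := u) hpu
    have ht : p • t = 0 := ht
    have hΓt := h.map_map_of_nsmul hn ht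
    have h1 : t - Γ t ∈ hD.ker := hbase _ (by rw [map_sub, hΓt, sub_self])
      (by rw [nsmul_sub, ← map_nsmul, ht, map_zero, sub_zero])
    have h2 : u - Γ t ∈ hD.ker := by simpa using add_mem hut h1
    have h3 := hC.map_mem_ker hD h.infinite_order h.surj h2
    rw [map_sub, hu, hΓt, zero_sub] at h3
    simpa using sub_mem h2 h3
  have hind (m : ℕ) : ∀ u, Γ u = 0 → p ^ m • u = 0 → u ∈ hD.ker := by
    induction m with
    | zero => intro u _ h1; rw [pow_zero, one_nsmul] at h1; rw [h1]; exact zero_mem _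
    | succ m ih =>
      intro u hu h1
      refine hstep u hu (ih _ (by rw [map_nsmul, hu, nsmul_zero]) ?_)
      rw [← mul_nsmul', ← pow_succ, h1]
  exact hind n u hu (h.q_nsmul hu)

end KummerModel.IsCM

namespace KummerModel

variable {G K κ : Type*} [AddCommGroup G] [Field K] [Field κ] {D : KummerModel G K}
  {v : Valuation K ℝ≥0}

open Classical in
/-- The reduction of an element, extended by zero. -/
noncomputable def _root_.Valuation.reduce (v : Valuation K ℝ≥0) (red : v.integer →+* κ) (a : K) :
    κ := if h : a ∈ v.integer then red ⟨a, h⟩ else 0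

/-- The reduction of a good model. -/
noncomputable def IsGood.reduction (hD : D.IsGood v) (red : v.integer →+* κ)
    (hsurj : Function.Surjective red) (hker : ∀ a, red a = 0 ↔ v a < 1) :
    KummerModel (G ⧸ hD.ker) κ :=
  have hx (P : G) (hP : P ∉ hD.ker) : D.x P ∈ v.integer := (hD.notMem_ker.1 hP).2
  have hlift (Q : G ⧸ hD.ker) (hQ : Q ≠ 0) : ∃ P, P ∉ hD.ker ∧ (P : G ⧸ hD.ker) = Q ∧
      ∃ X : v.integer, D.x P = X := by
    obtain ⟨P, rfl⟩ := QuotientAddGroup.mk_surjective Q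
    have hP : P ∉ hD.ker := fun h => hQ ((QuotientAddGroup.eq_zero_iff _).2 h)
    exact ⟨P, hP, rfl, ⟨_, hx P hP⟩, rfl⟩
  have hout (P : G) (hP : P ∉ hD.ker) {X : v.integer} (hX : D.x P = X) :
      v.reduce red (D.x (P : G ⧸ hD.ker).out) = red X := by
    obtain ⟨S, hS⟩ := QuotientAddGroup.mk_out_eq_add hD.ker P
    have h1 := hD.v_sub_lt hP S.2
    have h2 : D.x (P : G ⧸ hD.ker).out ∈ v.integer := hx _ fun h => hP (by
      rw [hS] at h
      simpa using sub_mem h S.2)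
    rw [Valuation.reduce, dif_pos h2, ← sub_eq_zero, ← map_sub, hker]
    rw [← hS, hX] at h1
    exact h1
  have hne (P : G) : (P : G ⧸ hD.ker) ≠ 0 ↔ P ∉ hD.ker := (QuotientAddGroup.eq_zero_iff _).not
  have r2 : red 2 = 2 := map_ofNat red 2
  have r4 : red 4 = 4 := map_ofNat red 4
  have r8 : red 8 = 8 := map_ofNat red 8
  have r9 : red 9 = 9 := map_ofNat red 9
  have r27 : red 27 = 27 := map_ofNat red 27
  let B2 : v.integer := ⟨D.b2, hD.b2⟩
  let B4 : v.integer := ⟨D.b4, hD.b4⟩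
  let B6 : v.integer := ⟨D.b6, hD.b6⟩
  let B8 : v.integer := ⟨D.b8, hD.b8⟩
  { x := fun Q => v.reduce red (D.x Q.out)
    b2 := red B2
    b4 := red B4
    b6 := red B6
    b8 := red B8
    rel := by
      have : (4 * B8 : v.integer) = B2 * B6 - B4 ^ 2 := Subtype.ext D.rel
      simpa [r4] using congrArg red this
    disc := by
      have h : v (D.Δ) = 1 := hD.disc
      have e : ((-B2 ^ 2 * B8 - 8 * B4 ^ 3 - 27 * B6 ^ 2 + 9 * B2 * B4 * B6 : v.integer) : K) =
        D.Δ := rfl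
      rw [← e] at h
      intro h0
      refine h.not_lt ((hker _).1 ?_)
      simpa [r8, r9, r27] using h0
    x_eq := fun P S hP hS => by
      obtain ⟨P, hP', rfl, X, hX⟩ := hlift P hP
      obtain ⟨S, hS', rfl, Y, hY⟩ := hlift S hS
      rw [hout P hP' hX, hout S hS' hY, ← sub_eq_zero, ← map_sub, hker]
      have e : ((X - Y : v.integer) : K) = D.x P - D.x S := by rw [hX, hY]; rfl
      rw [e]
      constructor
      · intro h
        rcases hD.mem_ker_of_v_sub_lt hP' hS' h with h | h
        · left
          rw [← sub_eq_zero, ← QuotientAddGroup.mk_sub, QuotientAddGroup.eq_zero_iff]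
          exact h
        · right
          rw [eq_neg_iff_add_eq_zero, ← QuotientAddGroup.mk_add, QuotientAddGroup.eq_zero_iff]
          exact h
      · rintro (h | h)
        · rw [← sub_eq_zero, ← QuotientAddGroup.mk_sub, QuotientAddGroup.eq_zero_iff] at h
          simpa using hD.v_sub_lt hS' h
        · rw [eq_neg_iff_add_eq_zero, ← QuotientAddGroup.mk_add, QuotientAddGroup.eq_zero_iff] at h
          have := hD.v_sub_lt (P := -S) (by simpa using hS') h
          rw [neg_add_cancel_comm_assoc, D.x_neg] at this
          exact this
    surj := fun c => by
      obtain ⟨X, rfl⟩ := hsurj c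
      obtain ⟨P, hP0, hP⟩ := D.surj X
      have hP' : P ∉ hD.ker := hD.notMem_ker.2 ⟨hP0, by rw [hP]; exact X.2⟩
      exact ⟨P, (hne P).2 hP', hout P hP' hP⟩
    sum_eq := fun P S hP hS h₁ h₂ => by
      obtain ⟨P, hP', rfl, X, hX⟩ := hlift P hP
      obtain ⟨S, hS', rfl, Y, hY⟩ := hlift S hS
      rw [← QuotientAddGroup.mk_add] at h₁ ⊢
      rw [← QuotientAddGroup.mk_sub] at h₂ ⊢
      rw [hne] at h₁ h₂
      have := D.sum_eq' (hD.notMem_ker.1 hP').1 (hD.notMem_ker.1 hS').1 (hD.notMem_ker.1 h₁).1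
        (hD.notMem_ker.1 h₂).1
      obtain ⟨Z, hZ⟩ : ∃ Z : v.integer, D.x (P + S) = Z := ⟨⟨_, hx _ h₁⟩, rfl⟩
      obtain ⟨W, hW⟩ : ∃ Z : v.integer, D.x (P - S) = Z := ⟨⟨_, hx _ h₂⟩, rfl⟩
      rw [hout P hP' hX, hout S hS' hY, hout _ h₁ hZ, hout _ h₂ hW]
      rw [hX, hY, hZ, hW, sumForm] at this
      have h : ((X - Y) ^ 2 * (Z + W) : v.integer) =
        2 * X * Y * (X + Y) + B2 * (X * Y) + B4 * (X + Y) + B6 := Subtype.ext this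
      simpa [r2, r4] using congrArg red h
    prod_eq := fun P S hP hS h₁ h₂ => by
      obtain ⟨P, hP', rfl, X, hX⟩ := hlift P hP
      obtain ⟨S, hS', rfl, Y, hY⟩ := hlift S hS
      rw [← QuotientAddGroup.mk_add] at h₁ ⊢
      rw [← QuotientAddGroup.mk_sub] at h₂ ⊢
      rw [hne] at h₁ h₂
      have := D.prod_eq' (hD.notMem_ker.1 hP').1 (hD.notMem_ker.1 hS').1 (hD.notMem_ker.1 h₁).1
        (hD.notMem_ker.1 h₂).1
      obtain ⟨Z, hZ⟩ : ∃ Z : v.integer, D.x (P + S) = Z := ⟨⟨_, hx _ h₁⟩, rfl⟩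
      obtain ⟨W, hW⟩ : ∃ Z : v.integer, D.x (P - S) = Z := ⟨⟨_, hx _ h₂⟩, rfl⟩
      rw [hout P hP' hX, hout S hS' hY, hout _ h₁ hZ, hout _ h₂ hW]
      rw [hX, hY, hZ, hW, prodForm] at this
      have h : ((X - Y) ^ 2 * (Z * W) : v.integer) =
        (X * Y) ^ 2 - B4 * (X * Y) - B6 * (X + Y) - B8 := Subtype.ext this
      simpa [r2, r4] using congrArg red h
    dup := fun P h₁ => by
      have hP : P ≠ 0 := by
        rintro rfl
        simp at h₁
      obtain ⟨P, hP', rfl, X, hX⟩ := hlift P hP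
      rw [← QuotientAddGroup.mk_add] at h₁ ⊢
      rw [hne] at h₁
      have := D.dup' (hD.notMem_ker.1 h₁).1
      obtain ⟨Z, hZ⟩ : ∃ Z : v.integer, D.x (P + P) = Z := ⟨⟨_, hx _ h₁⟩, rfl⟩
      rw [hout P hP' hX, hout _ h₁ hZ]
      rw [hX, hZ, psi, phi] at this
      have h : ((4 * X ^ 3 + B2 * X ^ 2 + 2 * B4 * X + B6) * Z : v.integer) =
        X ^ 4 - B4 * X ^ 2 - 2 * B6 * X - B8 := Subtype.ext this
      simpa [r2, r4] using congrArg red h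
    two_tors := fun P hP h₁ => by
      obtain ⟨P, hP', rfl, X, hX⟩ := hlift P hP
      rw [← QuotientAddGroup.mk_add, QuotientAddGroup.eq_zero_iff] at h₁
      rw [hout P hP' hX]
      have h : v (D.psi (D.x P)) < 1 := by
        by_cases h0 : P + P = 0
        · rw [(D.psi_eq_zero_iff (hD.notMem_ker.1 hP').1).2 h0]
          simp
        · have h2 := (hD.mem_ker.1 h₁).resolve_left h0
          have := D.dup' h0
          have h3 : D.psi (D.x P) = (D.x (P + P))⁻¹ * D.phi (D.x P) := by
            have := v.ne_zero_of_one_lt h2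
            rw [← D.dup' h0]
            field_simp
          rw [h3]
          refine v.mul_lt_one_of_mem (v.inv_lt_one_of_one_lt h2) ?_
          rw [hX]
          exact (X ^ 4 - B4 * X ^ 2 - 2 * B6 * X - B8).2
      rw [hX] at h
      have h' := (hker (4 * X ^ 3 + B2 * X ^ 2 + 2 * B4 * X + B6)).2 h
      simpa [r2, r4] using h' }

lemma IsGood.reduction_x (hD : D.IsGood v) (red : v.integer →+* κ)
    (hsurj : Function.Surjective red) (hker : ∀ a, red a = 0 ↔ v a < 1) {P : G} (hP : P ∉ hD.ker)
    {X : v.integer} (hX : D.x P = X) :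
    (hD.reduction red hsurj hker).x (P : G ⧸ hD.ker) = red X := by
  obtain ⟨S, hS⟩ := QuotientAddGroup.mk_out_eq_add hD.ker P
  have h1 := hD.v_sub_lt hP S.2
  have h2 : D.x (P : G ⧸ hD.ker).out ∈ v.integer := (hD.notMem_ker.1 fun h => hP (by
    rw [hS] at h
    simpa using sub_mem h S.2)).2
  show v.reduce red (D.x (P : G ⧸ hD.ker).out) = red X
  rw [Valuation.reduce, dif_pos h2, ← sub_eq_zero, ← map_sub, hker]
  rw [← hS, hX] at h1
  exact h1

end KummerModel

/-- A model over a field of positive characteristic on which `Γ` acts as the `q`-Frobenius on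
`x`-coordinates and has exactly `q` fixed points. -/
structure KummerModel.IsFrob {G κ : Type*} [AddCommGroup G] [Field κ] (D : KummerModel G κ)
    (Γ : G →+ G) (q : ℕ) : Prop where
  inj : Function.Injective Γ
  x_map : ∀ P, P ≠ 0 → D.x (Γ P) = D.x P ^ q
  card : Nat.card {P // Γ P = P} = q

namespace KummerModel

variable {G K κ : Type*} [AddCommGroup G] [Field K] [Field κ] {D : KummerModel G K}
  {v : Valuation K ℝ≥0} {Γ : G →+ G} {p n : ℕ} {τ : K}

lemma IsMult.card_fixed [IsAlgClosed K] {C : Finset G} {g : K} {Γ' : G →+ G}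
    (h : D.IsMult Γ' C g) (hD : D.IsGood v)
    (hinf : ∃ P₀ : G, ∀ n : ℕ, n ≠ 0 → n • P₀ ≠ 0) (hΓ : Function.Surjective Γ') (hg : v g = 1)
    (f : G ⧸ hD.ker →+ G ⧸ hD.ker) (hf : ∀ P : G, f P = (Γ' P : G)) :
    Nat.card {Q // f Q = 0} = C.card + 1 := by
  classical
  have h1 : Nat.card {u // Γ' u = 0} = C.card + 1 := by
    rw [Nat.subtype_card (insert 0 C) fun u => by rw [Finset.mem_insert, h.mem_iff'],
      Finset.card_insert_of_notMem fun h0 => h.ne_zero h0 rfl]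
  rw [← h1]
  refine (Nat.card_congr (Equiv.ofBijective (fun u : {u // Γ' u = 0} =>
    (⟨(u : G), by rw [hf, u.2, QuotientAddGroup.mk_zero]⟩ : {Q // f Q = 0})) ⟨?_, ?_⟩)).symm
  · rintro ⟨a, ha⟩ ⟨b, hb⟩ hab
    have hab : (a : G ⧸ hD.ker) = b := congrArg Subtype.val hab
    rw [← sub_eq_zero, ← QuotientAddGroup.mk_sub, QuotientAddGroup.eq_zero_iff] at hab
    have := h.notMem_ker_of_v_eq_one hD hinf hΓ hg (u := a - b) (by rw [map_sub, ha, hb, sub_zero])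
      hab
    exact Subtype.ext (sub_eq_zero.1 this)
  · rintro ⟨Q, hQ⟩
    obtain ⟨P, rfl⟩ := QuotientAddGroup.mk_surjective Q
    rw [hf, QuotientAddGroup.eq_zero_iff] at hQ
    obtain ⟨u, hu, hPu⟩ := h.exists_sub_mem_ker hD hinf hΓ hQ
    refine ⟨⟨u, hu⟩, Subtype.ext ?_⟩
    show (u : G ⧸ hD.ker) = P
    rw [eq_comm, ← sub_eq_zero, ← QuotientAddGroup.mk_sub, QuotientAddGroup.eq_zero_iff]
    exact hPu

lemma _root_.IsAlgClosed.exists_pow_sub_mul_add_eq_zero {F : Type*} [Field F] [IsAlgClosed F]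
    (m : ℕ) (c e : F) : ∃ r : F, r ^ (m + 2) - c * r + e = 0 := by
  open Polynomial in
  obtain ⟨r, hr⟩ := IsAlgClosed.exists_root (X ^ (m + 2) - C c * X + C e : F[X]) (by
    have : (X ^ (m + 2) - C c * X + C e : F[X]).natDegree = m + 2 := by
      compute_degree!
      simp
    exact degree_ne_of_natDegree_ne (n := 0) (by rw [this]; exact Nat.succ_ne_zero _))
  exact ⟨r, by simpa using hr⟩

lemma IsCM.exists_isFrob [IsAlgClosed K] [IsAlgClosed κ] [CharP κ p] (h : D.IsCM Γ (p ^ n) p τ)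
    (hp : p.Prime) (hn : n ≠ 0) (hD : D.IsGood v) (hvp : v p < 1) (hvτ : v τ < 1)
    (red : v.integer →+* κ) (hsurj : Function.Surjective red) (hker : ∀ a, red a = 0 ↔ v a < 1) :
    ∃ (D' : KummerModel (G ⧸ hD.ker) κ) (Γ' : G ⧸ hD.ker →+ G ⧸ hD.ker), D'.IsFrob Γ' (p ^ n) := by
  have : Fact p.Prime := ⟨hp⟩
  obtain ⟨C, hC, hcard⟩ := h.mult
  obtain ⟨C₁, hC₁, hcard₁⟩ := h.mult_one_sub
  have hΓker (u : G) (hu : Γ u = 0) : u ∈ hD.ker := h.mem_ker_of_map_eq_zero hp hn hD hvp hvτ hu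
  have hmem (P : G) (hP : P ∈ hD.ker) : Γ P ∈ hD.ker := hC.map_mem_ker hD h.infinite_order h.surj hP
  have hmem' (P : G) (hP : Γ P ∈ hD.ker) : P ∈ hD.ker := by
    obtain ⟨u, hu, hPu⟩ := hC.exists_sub_mem_ker hD h.infinite_order h.surj hP
    simpa using add_mem hPu (hΓker u hu)
  let Γ' : G ⧸ hD.ker →+ G ⧸ hD.ker := QuotientAddGroup.map _ _ Γ hmem
  have hΓ' (P : G) : Γ' (P : G ⧸ hD.ker) = (Γ P : G) := rfl
  have hinj : Function.Injective Γ' := by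
    rw [injective_iff_map_eq_zero]
    intro Q hQ
    obtain ⟨P, rfl⟩ := QuotientAddGroup.mk_surjective Q
    rw [hΓ', QuotientAddGroup.eq_zero_iff] at hQ
    exact (QuotientAddGroup.eq_zero_iff _).2 (hmem' P hQ)
  have hfix : Nat.card {Q // Γ' Q = Q} = p ^ n := by
    rw [← hcard₁, ← hC₁.card_fixed hD h.infinite_order h.surj_one_sub (v.map_one_sub_of_lt hvτ)
      (AddMonoidHom.id _ - Γ') fun P => rfl]
    refine Nat.card_congr (Equiv.subtypeEquivRight fun Q => ?_)
    rw [AddMonoidHom.sub_apply, AddMonoidHom.id_apply, sub_eq_zero, eq_comm]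
  obtain ⟨c, a, d, hc, ha, hd, hx⟩ := hC.exists_v_sub_lt hD h.infinite_order h.surj hΓker
  rw [hcard] at hx
  let c' : v.integer := ⟨c, hc.le⟩
  let a' : v.integer := ⟨a, ha⟩
  let d' : v.integer := ⟨d, hd⟩
  have hc' : red c' ≠ 0 := fun h0 => hc.not_lt ((hker c').1 h0)
  have hx' (Q : G ⧸ hD.ker) (hQ : Q ≠ 0) :
      red c' * (hD.reduction red hsurj hker).x (Γ' Q) =
        (hD.reduction red hsurj hker).x Q ^ p ^ n - red a' ^ p ^ n + red d' := by
    obtain ⟨P, rfl⟩ := QuotientAddGroup.mk_surjective Q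
    have hP : P ∉ hD.ker := fun h => hQ ((QuotientAddGroup.eq_zero_iff _).2 h)
    have hP' : Γ P ∉ hD.ker := fun h => hP (hmem' P h)
    obtain ⟨X, hX⟩ : ∃ Z : v.integer, D.x P = Z := ⟨⟨_, (hD.notMem_ker.1 hP).2⟩, rfl⟩
    obtain ⟨Y, hY⟩ : ∃ Z : v.integer, D.x (Γ P) = Z := ⟨⟨_, (hD.notMem_ker.1 hP').2⟩, rfl⟩
    rw [hΓ', hD.reduction_x red hsurj hker hP hX, hD.reduction_x red hsurj hker hP' hY,
      ← sub_pow_char_pow]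
    have h1 := hx P hP
    rw [hX, hY] at h1
    have h2 : red (c' * Y - ((X - a') ^ p ^ n + d')) = 0 := (hker _).2 h1
    rw [← sub_eq_zero, ← h2]
    simp
  obtain ⟨m, hm⟩ : ∃ m, p ^ n = m + 2 := Nat.exists_eq_add_of_le'
    (hp.two_le.trans (Nat.le_self_pow hn p))
  obtain ⟨s, hs⟩ := IsAlgClosed.exists_pow_nat_eq (red c') (n := m + 1) (by omega)
  have hs0 : s ≠ 0 := by
    rintro rfl
    exact hc' (by rw [← hs, zero_pow (by omega)])
  obtain ⟨r, hr⟩ := IsAlgClosed.exists_pow_sub_mul_add_eq_zero m (red c') (red d' - red a' ^ p ^ n)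
  rw [← hm] at hr
  refine ⟨(hD.reduction red hsurj hker).affine r s hs0, Γ', hinj, fun Q hQ => ?_, hfix⟩
  rw [affine_x, affine_x, div_pow, sub_pow_char_pow, div_eq_div_iff hs0 (pow_ne_zero _ hs0)]
  have e : s ^ p ^ n = red c' * s := by rw [hm, ← hs]; ring
  rw [e]
  linear_combination s * hx' Q hQ + s * hr

end KummerModel

namespace KummerModel

variable {G K : Type*} [AddCommGroup G] [Field K] {D : KummerModel G K}
  {v : Valuation K ℝ≥0}

/-- Two distinct points of order two. -/
structure IsTwoBasis (T₁ T₂ : G) : Prop where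
  ne₁ : T₁ ≠ 0
  ne₂ : T₂ ≠ 0
  ne : T₁ ≠ T₂
  add₁ : T₁ + T₁ = 0
  add₂ : T₂ + T₂ = 0

namespace IsTwoBasis

variable {T₁ T₂ : G} (h : IsTwoBasis T₁ T₂)
include h

lemma neg₁ : -T₁ = T₁ := neg_eq_of_add_eq_zero_left h.add₁
lemma neg₂ : -T₂ = T₂ := neg_eq_of_add_eq_zero_left h.add₂

lemma add_ne : T₁ + T₂ ≠ 0 := fun h0 => h.ne (by rw [eq_neg_of_add_eq_zero_left h0, h.neg₂])

lemma symm : IsTwoBasis T₂ T₁ := ⟨h.ne₂, h.ne₁, h.ne.symm, h.add₂, h.add₁⟩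

lemma right : IsTwoBasis T₁ (T₁ + T₂) :=
  ⟨h.ne₁, h.add_ne, fun h0 => h.ne₂ (by simpa using h0), h.add₁,
    by rw [add_add_add_comm, h.add₁, h.add₂, add_zero]⟩

lemma x_ne (D : KummerModel G K) : D.x T₁ ≠ D.x T₂ := by
  rw [Ne, D.x_eq _ _ h.ne₁ h.ne₂, h.neg₂, or_self]
  exact h.ne

lemma x_ne₁ (D : KummerModel G K) : D.x T₁ ≠ D.x (T₁ + T₂) := h.right.x_ne D

lemma x_ne₂ (D : KummerModel G K) : D.x T₂ ≠ D.x (T₁ + T₂) := by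
  rw [add_comm]
  exact h.symm.right.x_ne D

lemma b2_eq (D : KummerModel G K) : D.b2 = -4 * (D.x T₁ + D.x T₂ + D.x (T₁ + T₂)) := by
  have h1 := D.two_tors _ h.ne₁ h.add₁
  have h2 := D.two_tors _ h.ne₂ h.add₂
  have h3 := D.two_tors _ h.add_ne h.right.add₂
  refine mul_left_cancel₀ (mul_ne_zero (mul_ne_zero (sub_ne_zero.2 (h.x_ne D))
    (sub_ne_zero.2 (h.x_ne₁ D))) (sub_ne_zero.2 (h.x_ne₂ D))) ?_
  linear_combination h1 * (D.x T₂ - D.x (T₁ + T₂)) - h2 * (D.x T₁ - D.x (T₁ + T₂)) +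
    h3 * (D.x T₁ - D.x T₂)

lemma b4_eq (D : KummerModel G K) (two : (2 : K) ≠ 0) :
    D.b4 = 2 * (D.x T₁ * D.x T₂ + D.x T₁ * D.x (T₁ + T₂) + D.x T₂ * D.x (T₁ + T₂)) := by
  have h1 := D.two_tors _ h.ne₁ h.add₁
  have h2 := D.two_tors _ h.ne₂ h.add₂
  refine mul_left_cancel₀ (mul_ne_zero two (sub_ne_zero.2 (h.x_ne D))) ?_
  linear_combination h1 - h2 - (D.x T₁ ^ 2 - D.x T₂ ^ 2) * h.b2_eq D

lemma b6_eq (D : KummerModel G K) (two : (2 : K) ≠ 0) :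
    D.b6 = -4 * (D.x T₁ * D.x T₂ * D.x (T₁ + T₂)) := by
  have h1 := D.two_tors _ h.ne₁ h.add₁
  linear_combination h1 - D.x T₁ ^ 2 * h.b2_eq D - 2 * D.x T₁ * h.b4_eq D two

lemma b8_eq (D : KummerModel G K) (two : (2 : K) ≠ 0) :
    D.b8 = 4 * (D.x T₁ + D.x T₂ + D.x (T₁ + T₂)) * (D.x T₁ * D.x T₂ * D.x (T₁ + T₂)) -
      (D.x T₁ * D.x T₂ + D.x T₁ * D.x (T₁ + T₂) + D.x T₂ * D.x (T₁ + T₂)) ^ 2 := by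
  refine mul_left_cancel₀ (mul_ne_zero two two) ?_
  have := D.rel
  rw [h.b2_eq D, h.b4_eq D two, h.b6_eq D two] at this
  linear_combination this

lemma psi_eq (D : KummerModel G K) (two : (2 : K) ≠ 0) (X : K) :
    D.psi X = 4 * ((X - D.x T₁) * (X - D.x T₂) * (X - D.x (T₁ + T₂))) := by
  rw [psi, h.b2_eq D, h.b4_eq D two, h.b6_eq D two]
  ring

lemma Δ_eq (D : KummerModel G K) (two : (2 : K) ≠ 0) :
    D.Δ = 16 * ((D.x T₁ - D.x T₂) * (D.x T₁ - D.x (T₁ + T₂)) * (D.x T₂ - D.x (T₁ + T₂))) ^ 2 := by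
  rw [Δ, h.b2_eq D, h.b4_eq D two, h.b6_eq D two, h.b8_eq D two]
  ring

lemma x_two_sub (D : KummerModel G K) (two : (2 : K) ≠ 0) {P : G} (hP : P + P ≠ 0) :
    (D.x (P + P) - D.x T₁) * D.psi (D.x P) =
      ((D.x P - D.x T₁) ^ 2 - (D.x T₁ - D.x T₂) * (D.x T₁ - D.x (T₁ + T₂))) ^ 2 := by
  have := D.dup' hP
  rw [phi, h.b4_eq D two, h.b6_eq D two, h.b8_eq D two] at this
  rw [sub_mul, mul_comm, this, h.psi_eq D two]
  ring

lemma x_add (D : KummerModel G K) (two : (2 : K) ≠ 0) {u : G} (hu : u ≠ 0) (hu₁ : u ≠ T₁) :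
    (D.x (T₁ + u) - D.x T₁) * (D.x u - D.x T₁) =
      (D.x T₁ - D.x T₂) * (D.x T₁ - D.x (T₁ + T₂)) := by
  have h1 : T₁ + u ≠ 0 := fun h0 => hu₁ (by rw [eq_neg_of_add_eq_zero_right h0, h.neg₁])
  have h2 : T₁ - u ≠ 0 := fun h0 => hu₁ (sub_eq_zero.1 h0).symm
  have h3 := D.sum_eq _ _ h.ne₁ hu h1 h2
  have h4 : D.x (T₁ - u) = D.x (T₁ + u) := by
    rw [← D.x_neg, neg_sub, sub_eq_add_neg, h.neg₁, add_comm]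
  have h5 : D.x u - D.x T₁ ≠ 0 := sub_ne_zero.2 (D.x_ne h.ne₁ hu h1 h2).symm
  rw [h4, h.b2_eq D, h.b4_eq D two, h.b6_eq D two] at h3
  refine mul_left_cancel₀ (mul_ne_zero two h5) ?_
  linear_combination h3

/-- The effect of an endomorphism without two-torsion in its kernel on the differences of
`x`-coordinates of points of order two. -/
lemma map_sub_map (two : (2 : K) ≠ 0) {Γ : G →+ G} {C : Finset G} {g : K} (hΓ : D.IsMult Γ C g)
    (h₁ : Γ T₁ ≠ 0) (h₂ : Γ T₂ ≠ 0) :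
    (D.x (Γ T₂) - D.x (Γ T₁)) * g ^ 2 *
        (∏ u ∈ C, (D.x u - D.x T₂)) * ∏ u ∈ C, (D.x u - D.x T₁) =
      (D.x T₂ - D.x T₁) * ∏ u ∈ C, ((D.x T₁ - D.x T₂) * (D.x u - D.x (T₁ + T₂))) := by
  have h0 (u : G) (hu : u ∈ C) : (D.x T₂ - D.x (T₁ + u)) * (D.x u - D.x T₁) =
      -((D.x T₁ - D.x T₂) * (D.x u - D.x (T₁ + T₂))) := by
    have hu' := (hΓ.mem u).1 hu
    linear_combination -h.x_add D two hu'.1 (by rintro rfl; exact h₁ hu'.2)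
  have h1 := hΓ.eq _ _ h₂ h₁
  have h2 : ∏ u ∈ C, (D.x T₂ - D.x u) = (-1) ^ C.card * ∏ u ∈ C, (D.x u - D.x T₂) := by
    rw [← Finset.prod_const, ← Finset.prod_mul_distrib]
    exact Finset.prod_congr rfl fun u _ => by ring
  have h3 : (∏ u ∈ C, (D.x T₂ - D.x (T₁ + u))) * ∏ u ∈ C, (D.x u - D.x T₁) =
      (-1) ^ C.card * ∏ u ∈ C, ((D.x T₁ - D.x T₂) * (D.x u - D.x (T₁ + T₂))) := by
    rw [← Finset.prod_const, ← Finset.prod_mul_distrib, ← Finset.prod_mul_distrib]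
    exact Finset.prod_congr rfl fun u hu => by rw [h0 u hu]; ring
  rw [h2] at h1
  refine mul_left_cancel₀ (pow_ne_zero C.card (neg_ne_zero.2 (one_ne_zero (α := K)))) ?_
  linear_combination (∏ u ∈ C, (D.x u - D.x T₁)) * h1 + (D.x T₂ - D.x T₁) * h3

end IsTwoBasis

/-- Doubling permutes an element of odd order periodically. -/
lemma exists_two_pow_nsmul {A : Type*} [AddCommGroup A] {u : A} {m : ℕ} (hm : Odd m)
    (hu : m • u = 0) : ∃ k, k ≠ 0 ∧ 2 ^ k • u = u := by
  refine ⟨m.totient, (Nat.totient_pos.2 hm.pos).ne', ?_⟩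
  have h1 : 2 ^ m.totient ≡ 1 [MOD m] := Nat.ModEq.pow_totient (Nat.coprime_two_left.2 hm)
  have h2 : addOrderOf u ∣ m := addOrderOf_dvd_of_nsmul_eq_zero hu
  conv_rhs => rw [← one_nsmul u]
  exact nsmul_eq_nsmul_iff_modEq.2 (h1.of_dvd h2)

lemma doubling_induction {A : Type*} [AddCommGroup A] {u : A} {m : ℕ} (hm : Odd m)
    (hu : m • u = 0) (hu0 : u ≠ 0) (S : A → Prop) (h1 : S (u + u))
    (h2 : ∀ P, P + P ≠ 0 → S P → S (P + P)) : S u := by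
  obtain ⟨k, hk, hku⟩ := exists_two_pow_nsmul hm hu
  have hne (j : ℕ) : 2 ^ j • u ≠ 0 := fun h0 => hu0 <| by
    have h3 := addOrderOf_dvd_of_nsmul_eq_zero h0
    have h4 := addOrderOf_dvd_of_nsmul_eq_zero hu
    have h5 : addOrderOf u ∣ 1 := by
      rw [← (Nat.Coprime.pow_left j (Nat.coprime_two_left.2 hm)).gcd_eq_one]
      exact Nat.dvd_gcd h3 h4
    exact AddMonoid.addOrderOf_eq_one_iff.1 (Nat.dvd_one.1 h5)
  have hS (j : ℕ) : S (2 ^ (j + 1) • u) := by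
    induction j with
    | zero => rwa [zero_add, pow_one, two_nsmul]
    | succ j ih =>
      have h3 : 2 ^ (j + 1 + 1) • u = 2 ^ (j + 1) • u + 2 ^ (j + 1) • u := by
        rw [← add_nsmul, ← two_mul, ← pow_succ']
      rw [h3]
      exact h2 _ (h3 ▸ hne _) ih
  obtain ⟨j, rfl⟩ := Nat.exists_eq_succ_of_ne_zero hk
  exact hku ▸ hS j

end KummerModel

namespace KummerModel

variable {G K : Type*} [AddCommGroup G] [Field K] {D : KummerModel G K}
  {v : Valuation K ℝ≥0} {T₁ T₂ : G}

lemma _root_.Valuation.ne_zero_of_eq_one {K : Type*} [Field K] {v : Valuation K ℝ≥0} {a : K}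
    (h : v a = 1) : a ≠ 0 := by
  rintro rfl
  simp at h

lemma _root_.Valuation.map_four_of_two {K : Type*} [Field K] {v : Valuation K ℝ≥0}
    (h : v 2 = 1) : v 4 = 1 := by
  rw [show (4 : K) = 2 * 2 by norm_num, map_mul, h, one_mul]

namespace IsTwoBasis

/-- If two of the three points of order two are closer to each other than to the third, then a
point of odd order is at the same distance from both. -/
lemma v_sub_eq (h : IsTwoBasis T₁ T₂) (two : v 2 = 1)
    (hlt : v (D.x T₁ - D.x T₂) < v (D.x T₁ - D.x (T₁ + T₂))) {u : G} {m : ℕ} (hm : Odd m)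
    (hu : m • u = 0) (hu0 : u ≠ 0) : v (D.x u - D.x T₁) = v (D.x u - D.x T₂) := by
  by_contra hne
  have two' : (2 : K) ≠ 0 := Valuation.ne_zero_of_eq_one two
  set e₁ := D.x T₁ with he₁
  set e₂ := D.x T₂ with he₂
  set e₃ := D.x (T₁ + T₂) with he₃
  set s := v (e₁ - e₃) with hs
  have hδ : 0 < v (e₁ - e₂) := v.pos_iff.2 (sub_ne_zero.2 (h.x_ne D))
  have hspos : 0 < s := hδ.trans hlt
  have hle : v (D.x u - e₁) ≤ v (e₁ - e₂) ∧ v (D.x u - e₂) ≤ v (e₁ - e₂) := by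
    have h1 : e₁ - e₂ = (D.x u - e₂) - (D.x u - e₁) := by ring
    rw [h1]
    rcases lt_or_gt_of_ne hne with h2 | h2
    · rw [v.map_sub_eq_of_lt_left h2]
      exact ⟨h2.le, le_rfl⟩
    · rw [v.map_sub_eq_of_lt_right h2]
      exact ⟨le_rfl, h2.le⟩
  have hψ {P : G} (hP : P + P ≠ 0) : D.psi (D.x P) ≠ 0 := by
    rw [Ne, D.psi_eq_zero_iff (by rintro rfl; simp at hP)]
    exact hP
  have hv {P : G} (hP : P + P ≠ 0) : v (D.x (P + P) - e₁) *
      (v (D.x P - e₁) * v (D.x P - e₂) * v (D.x P - e₃)) =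
        v ((D.x P - e₁) ^ 2 - (e₁ - e₂) * (e₁ - e₃)) ^ 2 := by
    have h1 := congrArg v (h.x_two_sub D two' hP)
    rw [h.psi_eq D two'] at h1
    simpa only [map_mul, map_pow, Valuation.map_four_of_two two, one_mul] using h1
  have hv0 {P : G} (hP : P + P ≠ 0) :
      0 < v (D.x P - e₁) * v (D.x P - e₂) * v (D.x P - e₃) := by
    rw [← map_mul, ← map_mul, v.pos_iff]
    intro h0
    exact hψ hP (by rw [h.psi_eq D two', h0, mul_zero])
  have hord {P : G} (hP : P ≠ 0) (hmP : m • P = 0) : P + P ≠ 0 := fun h0 => hP (by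
    obtain ⟨j, rfl⟩ := hm
    rw [add_nsmul, one_nsmul, mul_nsmul, two_nsmul, h0, nsmul_zero, zero_add] at hmP
    exact hmP)
  have hfar : s ≤ v (D.x u - e₁) := by
    refine doubling_induction hm hu hu0 (fun P => s ≤ v (D.x P - e₁)) ?_ ?_
    · have hu2 := hord hu0 hu
      have h1 : v (D.x u - e₃) = s := by
        rw [show D.x u - e₃ = (D.x u - e₁) + (e₁ - e₃) by ring,
          v.map_add_eq_of_lt_right (hle.1.trans_lt hlt)]
      have h2 : v ((D.x u - e₁) ^ 2 - (e₁ - e₂) * (e₁ - e₃)) = v (e₁ - e₂) * s := by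
        rw [v.map_sub_eq_of_lt_right, map_mul]
        rw [map_pow, map_mul, sq]
        calc _ ≤ v (e₁ - e₂) * v (e₁ - e₂) := mul_le_mul' hle.1 hle.1
          _ < _ := by gcongr
      have h3 := hv hu2
      rw [h1, h2] at h3
      have h4 : (v (e₁ - e₂) * s) * (v (e₁ - e₂) * s) ≤
          v (D.x (u + u) - e₁) * (v (e₁ - e₂) * v (e₁ - e₂) * s) := by
        rw [← sq, ← h3]
        gcongr
        exacts [hle.1, hle.2]
      have h5 : s * (v (e₁ - e₂) * v (e₁ - e₂) * s) ≤
          v (D.x (u + u) - e₁) * (v (e₁ - e₂) * v (e₁ - e₂) * s) := by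
        calc _ = (v (e₁ - e₂) * s) * (v (e₁ - e₂) * s) := by ring
          _ ≤ _ := h4
      exact le_of_mul_le_mul_right h5 (by positivity)
    · intro P hP hsP
      have ht : v (D.x P - e₁) ≠ 0 := (hspos.trans_le hsP).ne'
      have h1 : v (D.x P - e₂) = v (D.x P - e₁) := by
        rw [show D.x P - e₂ = (D.x P - e₁) + (e₁ - e₂) by ring,
          v.map_add_eq_of_lt_left (hlt.trans_le hsP)]
      have h2 : v (D.x P - e₃) ≤ v (D.x P - e₁) := by
        rw [show D.x P - e₃ = (D.x P - e₁) + (e₁ - e₃) by ring]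
        exact v.map_add_le le_rfl hsP
      have h3 : v ((D.x P - e₁) ^ 2 - (e₁ - e₂) * (e₁ - e₃)) = v (D.x P - e₁) ^ 2 := by
        rw [v.map_sub_eq_of_lt_left, map_pow]
        rw [map_pow, map_mul, sq]
        calc v (e₁ - e₂) * s < s * s := by gcongr
          _ ≤ _ := by gcongr
      have h4 := hv hP
      rw [h1, h3] at h4
      have h5 : v (D.x P - e₁) * (v (D.x P - e₁) * v (D.x P - e₁) * v (D.x P - e₁)) ≤
          v (D.x (P + P) - e₁) * (v (D.x P - e₁) * v (D.x P - e₁) * v (D.x P - e₁)) := by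
        calc _ = (v (D.x P - e₁) ^ 2) ^ 2 := by ring
          _ = _ := h4.symm
          _ ≤ _ := by gcongr
      exact hsP.trans (le_of_mul_le_mul_right h5 (by positivity))
  exact absurd (hfar.trans hle.1) hlt.not_ge

end IsTwoBasis

lemma IsTwoBasis.not_lt (h : IsTwoBasis T₁ T₂) (two : v 2 = 1) {Γ : G →+ G} {C : Finset G} {g : K}
    (hΓ : D.IsMult Γ C g) {m : ℕ} (hm : Odd m) (hC : ∀ u, Γ u = 0 → m • u = 0)
    (h₁ : Γ T₁ = T₂) (h₂ : Γ T₂ = T₁ + T₂) :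
    ¬ v (D.x T₁ - D.x T₂) < v (D.x T₁ - D.x (T₁ + T₂)) := by
  intro hlt
  have two' : (2 : K) ≠ 0 := Valuation.ne_zero_of_eq_one two
  have heq (u : G) (hu : u ∈ C) := h.v_sub_eq two hlt hm (hC u ((hΓ.mem u).1 hu).2)
    ((hΓ.mem u).1 hu).1
  have h₃ : Γ (T₁ + T₂) = T₁ := by
    rw [map_add, h₁, h₂, add_left_comm, h.add₂, add_zero]
  have e1 : T₂ + (T₁ + T₂) = T₁ := by rw [add_left_comm, h.add₂, add_zero]
  have e2 : T₁ + (T₁ + T₂) = T₂ := by rw [← add_assoc, h.add₁, zero_add]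
  have hb₂ : IsTwoBasis T₂ (T₁ + T₂) := add_comm T₁ T₂ ▸ h.symm.right
  have hb₃ : IsTwoBasis (T₁ + T₂) T₁ := h.right.symm
  have A := congrArg v (hb₂.map_sub_map two' hΓ (by rw [h₂]; exact h.add_ne)
    (by rw [h₃]; exact h.ne₁))
  have B := congrArg v (hb₃.map_sub_map two' hΓ (by rw [h₃]; exact h.ne₁)
    (by rw [h₁]; exact h.ne₂))
  rw [h₂, h₃, e1] at A
  rw [h₁, h₃, add_comm _ T₁, e2] at B
  simp only [map_mul, map_prod, Finset.prod_mul_distrib, map_pow] at A B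
  have hprod : ∏ u ∈ C, v (D.x u - D.x T₁) = ∏ u ∈ C, v (D.x u - D.x T₂) :=
    Finset.prod_congr rfl heq
  have hnz (T : G) (hT : T + T = 0) (hT' : Γ T ≠ 0) : ∏ u ∈ C, v (D.x u - D.x T) ≠ 0 := by
    rw [Finset.prod_ne_zero_iff]
    intro u hu
    obtain ⟨hu0, hu1⟩ := (hΓ.mem u).1 hu
    rw [v.ne_zero_iff, sub_ne_zero, Ne, D.x_eq _ _ hu0 (by rintro rfl; simp at hT'),
      neg_eq_of_add_eq_zero_left hT, or_self]
    rintro rfl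
    exact hT' hu1
  have n2 := hnz T₂ h.add₂ (by rw [h₂]; exact h.add_ne)
  have n3 := hnz (T₁ + T₂) hb₃.add₁ (by rw [h₃]; exact h.ne₁)
  have hs : v (D.x T₂ - D.x (T₁ + T₂)) = v (D.x T₁ - D.x (T₁ + T₂)) := by
    rw [show D.x T₂ - D.x (T₁ + T₂) =
      (D.x T₁ - D.x (T₁ + T₂)) - (D.x T₁ - D.x T₂) by ring, v.map_sub_eq_of_lt_left hlt]
  rw [hprod] at A B
  rw [v.map_sub_swap (D.x (T₁ + T₂)) (D.x T₂)] at A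
  rw [v.map_sub_swap (D.x (T₁ + T₂)) (D.x T₁)] at B
  rw [v.map_sub_swap (D.x T₂) (D.x T₁)] at B
  rw [hs] at A
  have hs0 : v (D.x T₁ - D.x (T₁ + T₂)) ≠ 0 := v.ne_zero_iff.2 (sub_ne_zero.2 (h.x_ne₁ D))
  have hg : v g ≠ 0 := v.ne_zero_iff.2 hΓ.ne
  refine hlt.ne (mul_left_cancel₀ (mul_ne_zero (mul_ne_zero (pow_ne_zero 2 hg) n2) n3) ?_)
  calc _ = v (D.x T₁ - D.x T₂) * v g ^ 2 * (∏ u ∈ C, v (D.x u - D.x T₂)) *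
        ∏ u ∈ C, v (D.x u - D.x (T₁ + T₂)) := by ring
    _ = _ := B
    _ = _ := A.symm
    _ = _ := by ring

end KummerModel

namespace KummerModel

variable {G K : Type*} [AddCommGroup G] [Field K] {D : KummerModel G K}
  {v : Valuation K ℝ≥0} {T₁ T₂ : G}

lemma IsTwoBasis.isGood (h : IsTwoBasis T₁ T₂) (two : v 2 = 1)
    (h₂ : v (D.x T₁ - D.x (T₁ + T₂)) = v (D.x T₁ - D.x T₂))
    (h₃ : v (D.x T₂ - D.x (T₁ + T₂)) = v (D.x T₁ - D.x T₂)) :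
    (D.affine (D.x T₁) (D.x T₁ - D.x T₂) (sub_ne_zero.2 (h.x_ne D))).IsGood v := by
  have two' : (2 : K) ≠ 0 := Valuation.ne_zero_of_eq_one two
  have hδ : v (D.x T₁ - D.x T₂) ≠ 0 := v.ne_zero_iff.2 (sub_ne_zero.2 (h.x_ne D))
  have i2 : (2 : K) ∈ v.integer := two.le
  have i4 : (4 : K) ∈ v.integer := (Valuation.map_four_of_two two).le
  set E := D.affine (D.x T₁) (D.x T₁ - D.x T₂) (sub_ne_zero.2 (h.x_ne D)) with hE
  have x₁ : E.x T₁ = 0 := by simp [hE]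
  have x₂ : E.x T₂ = -1 := by
    rw [hE, affine_x, div_eq_iff (sub_ne_zero.2 (h.x_ne D))]
    ring
  have x₃ : v (E.x (T₁ + T₂)) = 1 := by
    rw [hE, affine_x, map_div₀, v.map_sub_swap, h₂, div_self hδ]
  have x₃' : v (1 + E.x (T₁ + T₂)) = 1 := by
    have : 1 + E.x (T₁ + T₂) = (D.x (T₁ + T₂) - D.x T₂) / (D.x T₁ - D.x T₂) := by
      rw [hE, affine_x, eq_div_iff (sub_ne_zero.2 (h.x_ne D)), add_mul,
        div_mul_cancel₀ _ (sub_ne_zero.2 (h.x_ne D))]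
      ring
    rw [this, map_div₀, v.map_sub_swap, h₃, div_self hδ]
  have i3 : E.x (T₁ + T₂) ∈ v.integer := x₃.le
  refine ⟨?_, ?_, ?_, ?_, ?_⟩
  · rw [h.b2_eq E, x₁, x₂]
    repeat' first | assumption | apply add_mem | apply mul_mem | apply neg_mem | apply zero_mem | apply one_mem
  · rw [h.b4_eq E two', x₁, x₂]
    repeat' first | assumption | apply add_mem | apply mul_mem | apply neg_mem | apply zero_mem | apply one_mem
  · rw [h.b6_eq E two', x₁, x₂]
    repeat' first | assumption | apply add_mem | apply mul_mem | apply neg_mem | apply zero_mem | apply one_mem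
  · rw [h.b8_eq E two', x₁, x₂]
    repeat' first | assumption | apply sub_mem | apply pow_mem | apply add_mem | apply mul_mem | apply neg_mem | apply zero_mem | apply one_mem
  · rw [h.Δ_eq E two', x₁, x₂, show (16 : K) * ((0 - -1) * (0 - E.x (T₁ + T₂)) *
        (-1 - E.x (T₁ + T₂))) ^ 2 = (2 ^ 2 * (E.x (T₁ + T₂) * (1 + E.x (T₁ + T₂)))) ^ 2 by ring]
    simp [x₃, x₃', two]

/-- A model with complex multiplication has good reduction at odd residue characteristics. -/
lemma IsCM.exists_isGood_of_odd {Γ : G →+ G} {q p : ℕ} {τ : K} (h : D.IsCM Γ q p τ)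
    (hq : Odd q) (two : v 2 = 1) : ∃ (r s : K) (hs : s ≠ 0), (D.affine r s hs).IsGood v := by
  obtain ⟨T, hT, hTT⟩ := h.two_torsion
  obtain ⟨C, hC, -⟩ := h.mult
  have hsq (T : G) (hTT : T + T = 0) : Γ (Γ T) = T + Γ T := by
    obtain ⟨j, rfl⟩ := hq
    rw [h.sq, add_nsmul, one_nsmul, mul_nsmul, two_nsmul, hTT, nsmul_zero, zero_add,
      sub_eq_add_neg, neg_eq_of_add_eq_zero_left hTT, add_comm]
  have hbasis (T : G) (hT : T ≠ 0) (hTT : T + T = 0) : IsTwoBasis T (Γ T) := by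
    have := hsq T hTT
    refine ⟨hT, fun h0 => hT ?_, fun h0 => hT ?_, hTT, by rw [← map_add, hTT, map_zero]⟩
    · rwa [h0, map_zero, add_zero, eq_comm] at this
    · rw [← h0, ← h0, hTT] at this
      exact this
  have key (T : G) (hT : T ≠ 0) (hTT : T + T = 0) :
      v (D.x T - D.x (T + Γ T)) ≤ v (D.x T - D.x (Γ T)) :=
    not_lt.1 ((hbasis T hT hTT).not_lt two hC hq (fun u => h.q_nsmul) rfl (hsq T hTT))
  have b := hbasis T hT hTT
  have k₁ := key T hT hTT
  have k₂ := key (Γ T) b.ne₂ b.add₂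
  have k₃ := key (T + Γ T) b.add_ne b.right.add₂
  have h₃ : Γ (T + Γ T) = T := by rw [map_add, hsq T hTT, add_left_comm, b.add₂, add_zero]
  rw [hsq T hTT, show Γ T + (T + Γ T) = T by rw [add_left_comm, b.add₂, add_zero],
    v.map_sub_swap] at k₂
  rw [h₃, show T + Γ T + T = Γ T by rw [add_comm, ← add_assoc, hTT, zero_add],
    v.map_sub_swap, v.map_sub_swap _ (D.x T)] at k₃
  exact ⟨_, _, _, b.isGood two (k₁.antisymm (k₂.trans k₃)) (k₃.trans k₁ |>.antisymm k₂)⟩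

end KummerModel

namespace KummerModel

variable {G K : Type*} [AddCommGroup G] [Field K] {D : KummerModel G K}
  {v : Valuation K ℝ≥0} {T₁ T₂ : G}

lemma IsCM.affine {Γ : G →+ G} {q p : ℕ} {τ : K} (h : D.IsCM Γ q p τ) (r s : K) (hs : s ≠ 0) :
    (D.affine r s hs).IsCM Γ q p τ where
  root := h.root
  sq := h.sq
  surj := h.surj
  surj_one_sub := h.surj_one_sub
  surj_nsmul := h.surj_nsmul
  mult := h.mult.imp fun _ hC => ⟨hC.1.affine r s hs, hC.2⟩
  cyclic := h.cyclic
  mult_one_sub := h.mult_one_sub.imp fun _ hC => ⟨hC.1.affine r s hs, hC.2⟩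
  mult_two_sub := h.mult_two_sub.imp fun _ hC => ⟨hC.1.affine r s hs, hC.2⟩
  mult_nsmul := h.mult_nsmul.imp fun _ hC => hC.affine r s hs
  infinite_order := h.infinite_order
  two_torsion := h.two_torsion

lemma exists_isTwoBasis [IsAlgClosed K] (D : KummerModel G K) (two : (2 : K) ≠ 0) {T : G}
    (hT : T ≠ 0) (hTT : T + T = 0) : ∃ T', IsTwoBasis T T' := by
  have hT0 := D.two_tors T hT hTT
  set e := D.x T with he
  obtain ⟨d, hd⟩ := IsAlgClosed.exists_pow_nat_eq
    ((D.b2 + 4 * e) ^ 2 - 16 * (2 * D.b4 + D.b2 * e + 4 * e ^ 2)) (n := 2) (by norm_num)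
  have eight : (8 : K) ≠ 0 := by
    rw [show (8 : K) = 2 ^ 3 by norm_num]; exact pow_ne_zero 3 two
  have key (d : K)
      (hd : d ^ 2 = (D.b2 + 4 * e) ^ 2 - 16 * (2 * D.b4 + D.b2 * e + 4 * e ^ 2))
      (hne : -(D.b2 + 4 * e) + d ≠ 8 * e) : ∃ T', IsTwoBasis T T' := by
    obtain ⟨T', hT', hx⟩ := D.surj ((-(D.b2 + 4 * e) + d) / 8)
    have hψ : D.psi (D.x T') = 0 := by
      have : D.psi (D.x T') = (D.x T' - e) * (4 * D.x T' ^ 2 + (D.b2 + 4 * e) * D.x T' +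
          (2 * D.b4 + D.b2 * e + 4 * e ^ 2)) := by
        unfold psi
        linear_combination hT0
      rw [this, hx, mul_eq_zero]
      right
      field_simp
      linear_combination 4 * hd
    refine ⟨T', hT, hT', ?_, hTT, (D.psi_eq_zero_iff hT').1 hψ⟩
    rintro rfl
    rw [← he, eq_div_iff eight] at hx
    exact hne (by rw [← hx, mul_comm])
  by_cases h1 : -(D.b2 + 4 * e) + d = 8 * e
  · by_cases h2 : -(D.b2 + 4 * e) + -d = 8 * e
    · exfalso
      have hd0 : d = 0 := mul_left_cancel₀ two (by linear_combination h1 - h2)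
      subst hd0
      have b2 : D.b2 = -12 * e := by linear_combination -h1
      have b4 : D.b4 = 6 * e ^ 2 := mul_left_cancel₀ (mul_ne_zero two (mul_ne_zero two eight)) (by
        rw [b2] at hd
        linear_combination hd)
      have b6 : D.b6 = -4 * e ^ 3 := by
        rw [b2, b4] at hT0
        linear_combination hT0
      have b8 : D.b8 = 3 * e ^ 4 := mul_left_cancel₀ (mul_ne_zero two two) (by
        have := D.rel
        rw [b2, b4, b6] at this
        linear_combination this)
      apply D.Δ_ne
      rw [Δ, b2, b4, b6, b8]
      ring
    · exact key _ (by rw [neg_sq, hd]) h2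
  · exact key _ hd h1

lemma x_sub_ne_of_map_eq (D : KummerModel G K) {T u : G} {Γ : G →+ G} (hT : T ≠ 0)
    (hTT : T + T = 0) (hΓ : Γ T = T) (hu : u ≠ 0) (hu' : Γ u = 0) : D.x u - D.x T ≠ 0 := by
  rw [sub_ne_zero, Ne, D.x_eq _ _ hu hT, neg_eq_of_add_eq_zero_left hTT, or_self]
  rintro rfl
  exact hT (hΓ ▸ hu')

/-- The discriminant in terms of the kernel of an endomorphism that fixes the points of order
two. -/
lemma IsTwoBasis.prod_psi (h : IsTwoBasis T₁ T₂) (two : (2 : K) ≠ 0) {Γ : G →+ G} {C : Finset G}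
    {g : K} (hΓ : D.IsMult Γ C g) (h₁ : Γ T₁ = T₁) (h₂ : Γ T₂ = T₂) :
    g ^ 12 * ∏ u ∈ C, D.psi (D.x u) ^ 2 = D.Δ ^ C.card := by
  have h₃ : Γ (T₁ + T₂) = T₁ + T₂ := by rw [map_add, h₁, h₂]
  have key {T₁ T₂ : G} (h : IsTwoBasis T₁ T₂) (h₁ : Γ T₁ = T₁) (h₂ : Γ T₂ = T₂) :
      g ^ 2 * (∏ u ∈ C, (D.x u - D.x T₂)) * ∏ u ∈ C, (D.x u - D.x T₁) =
        (∏ u ∈ C, (D.x T₁ - D.x T₂)) * ∏ u ∈ C, (D.x u - D.x (T₁ + T₂)) := by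
    have := h.map_sub_map two hΓ (by rw [h₁]; exact h.ne₁) (by rw [h₂]; exact h.ne₂)
    rw [h₁, h₂] at this
    refine mul_left_cancel₀ (sub_ne_zero.2 (h.x_ne D).symm) ?_
    rw [← Finset.prod_mul_distrib, ← this]
    ring
  have k₁ := key h h₁ h₂
  have k₂ := key h.right h₁ h₃
  have k₃ := key (add_comm T₁ T₂ ▸ h.symm.right : IsTwoBasis T₂ (T₁ + T₂)) h₂ h₃
  rw [show T₁ + (T₁ + T₂) = T₂ by rw [← add_assoc, h.add₁, zero_add]] at k₂
  rw [show T₂ + (T₁ + T₂) = T₁ by rw [add_left_comm, h.add₂, add_zero]] at k₃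
  set A := ∏ u ∈ C, (D.x u - D.x T₁)
  set B := ∏ u ∈ C, (D.x u - D.x T₂)
  set E := ∏ u ∈ C, (D.x u - D.x (T₁ + T₂))
  have hA : A ≠ 0 := Finset.prod_ne_zero_iff.2 fun u hu => D.x_sub_ne_of_map_eq h.ne₁ h.add₁ h₁
    ((hΓ.mem u).1 hu).1 ((hΓ.mem u).1 hu).2
  have hB : B ≠ 0 := Finset.prod_ne_zero_iff.2 fun u hu => D.x_sub_ne_of_map_eq h.ne₂ h.add₂ h₂
    ((hΓ.mem u).1 hu).1 ((hΓ.mem u).1 hu).2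
  have hE : E ≠ 0 := Finset.prod_ne_zero_iff.2 fun u hu => D.x_sub_ne_of_map_eq h.add_ne h.right.add₂ h₃
    ((hΓ.mem u).1 hu).1 ((hΓ.mem u).1 hu).2
  simp only [Finset.prod_const] at k₁ k₂ k₃
  have e1 : ∏ u ∈ C, D.psi (D.x u) ^ 2 = 16 ^ C.card * (A * B * E) ^ 2 := by
    rw [← Finset.prod_const, ← Finset.prod_mul_distrib, ← Finset.prod_mul_distrib,
      ← Finset.prod_pow, ← Finset.prod_mul_distrib]
    exact Finset.prod_congr rfl fun u _ => by rw [h.psi_eq D two]; ring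
  have e2 (a b c : K) (n : ℕ) :
      (16 * (a * b * c) ^ 2) ^ n = 16 ^ n * (a ^ n * b ^ n * c ^ n) ^ 2 := by ring
  rw [e1, h.Δ_eq D two, e2]
  set α := (D.x T₁ - D.x T₂) ^ C.card
  set β := (D.x T₁ - D.x (T₁ + T₂)) ^ C.card
  set γ := (D.x T₂ - D.x (T₁ + T₂)) ^ C.card
  have k : g ^ 6 * (A * B * E) = α * β * γ := by
    refine mul_left_cancel₀ (mul_ne_zero (mul_ne_zero hA hB) hE) ?_
    calc _ = (g ^ 2 * B * A) * (g ^ 2 * E * A) * (g ^ 2 * E * B) := by ring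
      _ = _ := by rw [k₁, k₂, k₃]; ring
  rw [← k]
  ring

end KummerModel

namespace KummerModel

/-- A Tate-type normal form of the coefficients. -/
structure IsTate {G K : Type*} [AddCommGroup G] [Field K] (D : KummerModel G K)
    (v : Valuation K ℝ≥0) : Prop where
  b2 : D.b2 = 1
  b4 : D.b4 = 0
  b6 : D.b6 = 4 * D.b8
  b8 : v D.b8 < 1
  two : v 2 < 1

variable {G K : Type*} [AddCommGroup G] [Field K] {D : KummerModel G K}
  {v : Valuation K ℝ≥0}

namespace IsTate

variable (h : D.IsTate v)
include h

lemma psi_eq (X : K) : D.psi X = X ^ 2 + (4 * X ^ 3 + 4 * D.b8) := by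
  rw [psi, h.b2, h.b4, h.b6]
  ring

lemma phi_eq (X : K) : D.phi X = X ^ 4 - (8 * D.b8 * X + D.b8) := by
  rw [phi, h.b4, h.b6]
  ring

lemma four : v 4 < 1 := by
  rw [show (4 : K) = 2 * 2 by norm_num, map_mul]
  exact mul_lt_one_of_lt_of_le h.two h.two.le

lemma eight : v 8 < 1 := by
  rw [show (8 : K) = 4 * 2 by norm_num, map_mul]
  exact mul_lt_one_of_lt_of_le h.four h.two.le

lemma Δ_eq : D.Δ = -D.b8 * (1 + 4 * (108 * D.b8)) := by
  rw [Δ, h.b2, h.b4, h.b6]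
  ring

lemma b8_ne : D.b8 ≠ 0 := fun h0 => D.Δ_ne (by rw [h.Δ_eq, h0]; ring)

lemma v_pos : 0 < v D.b8 := v.pos_iff.2 h.b8_ne

lemma v_Δ : v D.Δ = v D.b8 := by
  have h1 : (108 : K) ∈ v.integer := ofNat_mem _ 108
  rw [h.Δ_eq, map_mul, Valuation.map_neg, v.map_one_add_of_lt, mul_one]
  exact v.mul_lt_one_of_mem h.four (mul_mem h1 h.b8.le)

lemma v_psi {X : K} (h0 : v X ≤ 1) (h1 : v D.b8 < v X ^ 2) : v (D.psi X) = v X ^ 2 := by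
  have hX : 0 < v X := by
    rw [pos_iff_ne_zero]
    intro h2
    simp [h2] at h1
  rw [h.psi_eq, v.map_add_eq_of_lt_left, map_pow]
  rw [map_pow]
  refine v.map_add_lt ?_ ?_
  · rw [map_mul, map_pow]
    calc v 4 * v X ^ 3 ≤ v 4 * v X ^ 2 := by gcongr v 4 * ?_; exact pow_le_pow_of_le_one zero_le h0 (by norm_num)
      _ < 1 * v X ^ 2 := by gcongr; exact h.four
      _ = _ := one_mul _
  · rw [map_mul]
    exact (mul_le_of_le_one_left' h.four.le).trans_lt h1

lemma v_x_two_of_lt {P : G} (hP : P + P ≠ 0) (h0 : v (D.x P) ≤ 1) (h1 : v D.b8 < v (D.x P) ^ 4) :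
    v (D.x (P + P)) = v (D.x P) ^ 2 := by
  have h2 : v D.b8 < v (D.x P) ^ 2 := h1.trans_le (pow_le_pow_of_le_one zero_le h0 (by norm_num))
  have h3 := congrArg v (D.dup' hP)
  have h4 : v (D.phi (D.x P)) = v (D.x P) ^ 4 := by
    rw [h.phi_eq, v.map_sub_eq_of_lt_left, map_pow]
    rw [map_pow]
    refine v.map_add_lt ?_ h1
    rw [mul_right_comm, map_mul, map_mul]
    exact (mul_le_of_le_one_left' (mul_le_one' h.eight.le h0)).trans_lt h1
  rw [map_mul, h.v_psi h0 h2, h4] at h3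
  refine mul_left_cancel₀ (h.v_pos.trans h2).ne' ?_
  rw [h3]
  ring

lemma v_x_two_of_gt {P : G} (hP : P + P ≠ 0) (h1 : v D.b8 < v (D.x P) ^ 2)
    (h2 : v (D.x P) ^ 4 < v D.b8) :
    v (D.x (P + P)) * v (D.x P) ^ 2 = v D.b8 := by
  have h0 : v (D.x P) < 1 := by
    refine lt_of_not_ge fun h0 => (h2.trans h.b8).not_ge ?_
    exact one_le_pow_of_one_le' h0 _
  have h3 := congrArg v (D.dup' hP)
  have h4 : v (D.phi (D.x P)) = v D.b8 := by
    rw [h.phi_eq, v.map_sub_eq_of_lt_right, v.map_add_eq_of_lt_right]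
    · rw [mul_right_comm, map_mul]
      exact mul_lt_of_lt_one_left h.v_pos (by rw [map_mul]; exact mul_lt_one_of_lt_of_le h.eight h0.le)
    · rw [v.map_add_eq_of_lt_right, map_pow]
      · exact h2
      · rw [mul_right_comm, map_mul]
        exact mul_lt_of_lt_one_left h.v_pos
          (by rw [map_mul]; exact mul_lt_one_of_lt_of_le h.eight h0.le)
  rwa [map_mul, h.v_psi h0.le h1, h4, mul_comm] at h3

lemma v_x_two_of_one_le {P : G} (hP : P + P ≠ 0) (h0 : 1 ≤ v (D.x P)) :
    v (D.x P) ≤ v (D.x (P + P)) := by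
  have h3 := congrArg v (D.dup' hP)
  have h5 : v (8 * D.b8 * D.x P + D.b8) < v (D.x P) ^ 4 := by
    have h6 : v (D.x P) ≤ v (D.x P) ^ 4 := le_self_pow₀ h0 (by norm_num)
    refine v.map_add_lt ?_ (h.b8.trans_le (h0.trans h6))
    rw [map_mul, map_mul]
    exact (mul_lt_of_lt_one_left (by positivity) (mul_lt_one_of_lt_of_le h.eight h.b8.le)).trans_le h6
  have h4 : v (D.phi (D.x P)) = v (D.x P) ^ 4 := by
    rw [h.phi_eq, v.map_sub_eq_of_lt_left, map_pow]
    rwa [map_pow]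
  have h6 : v (D.psi (D.x P)) ≤ v (D.x P) ^ 3 := by
    rw [h.psi_eq]
    refine v.map_add_le ?_ (v.map_add_le ?_ ?_)
    · rw [map_pow]
      exact pow_le_pow_right' h0 (by norm_num)
    · rw [map_mul, map_pow]
      exact mul_le_of_le_one_left' h.four.le
    · rw [map_mul]
      exact (mul_le_one' h.four.le h.b8.le).trans (one_le_pow_of_one_le' h0 _)
  rw [map_mul, h4] at h3
  have h7 : v (D.x P) * v (D.x P) ^ 3 ≤ v (D.x (P + P)) * v (D.x P) ^ 3 := by
    calc _ = v (D.x P) ^ 4 := by ring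
      _ = _ := h3.symm
      _ ≤ v (D.x P) ^ 3 * v (D.x (P + P)) := by gcongr
      _ = _ := mul_comm _ _
  exact le_of_mul_le_mul_right h7 (by positivity)

lemma one_le_v_x_two {P : G} (hP : P + P ≠ 0) (h0 : v (D.x P) ^ 2 ≤ v D.b8) :
    1 ≤ v (D.x (P + P)) := by
  have h1 : v (D.x P) < 1 := by
    refine lt_of_not_ge fun h1 => (h0.trans_lt h.b8).not_ge ?_
    exact one_le_pow_of_one_le' h1 _
  have h3 := congrArg v (D.dup' hP)
  have h4 : v (D.phi (D.x P)) = v D.b8 := by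
    have h5 : v (8 * D.b8 * D.x P + D.b8) = v D.b8 := by
      rw [v.map_add_eq_of_lt_right]
      rw [mul_right_comm, map_mul]
      exact mul_lt_of_lt_one_left h.v_pos
        (by rw [map_mul]; exact mul_lt_one_of_lt_of_le h.eight h1.le)
    rw [h.phi_eq, v.map_sub_eq_of_lt_right, h5]
    rw [h5, map_pow]
    calc v (D.x P) ^ 4 = v (D.x P) ^ 2 * v (D.x P) ^ 2 := by ring
      _ ≤ v D.b8 * v D.b8 := mul_le_mul' h0 h0
      _ < v D.b8 := mul_lt_of_lt_one_left h.v_pos h.b8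
  have h6 : v (D.psi (D.x P)) ≤ v D.b8 := by
    rw [h.psi_eq]
    refine v.map_add_le (by rwa [map_pow]) (v.map_add_le ?_ ?_)
    · rw [map_mul, map_pow]
      exact (mul_le_of_le_one_left' h.four.le).trans
        ((pow_le_pow_of_le_one zero_le h1.le (by norm_num)).trans h0)
    · rw [map_mul]
      exact mul_le_of_le_one_left' h.four.le
  rw [map_mul, h4] at h3
  have h7 : 1 * v D.b8 ≤ v (D.x (P + P)) * v D.b8 := by
    calc _ = v D.b8 := one_mul _
      _ = _ := h3.symm
      _ ≤ v D.b8 * v (D.x (P + P)) := by gcongr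
      _ = _ := mul_comm _ _
  exact le_of_mul_le_mul_right h7 h.v_pos

end IsTate

end KummerModel

namespace KummerModel

variable {G K : Type*} [AddCommGroup G] [Field K] {D : KummerModel G K}
  {v : Valuation K ℝ≥0}

lemma _root_.add_self_ne_zero_of_odd_nsmul {A : Type*} [AddCommGroup A] {u : A} {m : ℕ}
    (hm : Odd m) (hu : m • u = 0) (hu0 : u ≠ 0) : u + u ≠ 0 := fun h0 => hu0 (by
  obtain ⟨j, rfl⟩ := hm
  rwa [add_nsmul, one_nsmul, mul_nsmul, two_nsmul, h0, nsmul_zero, zero_add] at hu)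

lemma _root_.nsmul_add_self_eq_zero {A : Type*} [AddCommGroup A] {u : A} {m : ℕ}
    (hu : m • u = 0) : m • (u + u) = 0 := by rw [nsmul_add, hu, add_zero]

namespace IsTate

variable (h : D.IsTate v) {u : G} {m : ℕ} (hm : Odd m) (hu : m • u = 0) (hu0 : u ≠ 0)
include h hm hu hu0

lemma v_x_le_one : v (D.x u) ≤ 1 := by
  by_contra! h1
  have key {P : G} (hP : P + P ≠ 0) (hPu : 1 < v (D.x P)) : v (D.x P) < v (D.x (P + P)) := by
    refine lt_of_le_of_ne (h.v_x_two_of_one_le hP hPu.le) fun h2 => ?_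
    have h3 := congrArg v (D.dup' hP)
    have h4 : v (D.phi (D.x P)) = v (D.x P) ^ 4 := by
      rw [h.phi_eq, v.map_sub_eq_of_lt_left, map_pow]
      rw [map_pow]
      have h6 : v (D.x P) ≤ v (D.x P) ^ 4 := le_self_pow₀ hPu.le (by norm_num)
      refine v.map_add_lt ?_ (h.b8.trans_le (hPu.le.trans h6))
      rw [map_mul, map_mul]
      exact (mul_lt_of_lt_one_left (by positivity)
        (mul_lt_one_of_lt_of_le h.eight h.b8.le)).trans_le h6
    have h5 : v (D.psi (D.x P)) < v (D.x P) ^ 3 := by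
      rw [h.psi_eq]
      refine v.map_add_lt ?_ (v.map_add_lt ?_ ?_)
      · rw [map_pow]
        exact pow_lt_pow_right₀ hPu (by norm_num)
      · rw [map_mul, map_pow]
        exact mul_lt_of_lt_one_left (by positivity) h.four
      · rw [map_mul]
        exact (mul_lt_one_of_lt_of_le h.four h.b8.le).trans_le (one_le_pow_of_one_le' hPu.le _)
    rw [map_mul, h4, ← h2] at h3
    refine (mul_lt_mul_of_pos_right h5 (zero_lt_one.trans hPu)).ne ?_
    rw [h3]
    ring
  refine lt_irrefl (v (D.x u)) (doubling_induction hm hu hu0 (fun P => v (D.x u) < v (D.x P))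
    (key (add_self_ne_zero_of_odd_nsmul hm hu hu0) h1)
    fun P hP hPu => hPu.trans (key hP (h1.trans hPu)))

lemma lt_v_x_sq : v D.b8 < v (D.x u) ^ 2 := by
  by_contra! h1
  have h2 := doubling_induction hm hu hu0 (fun P => 1 ≤ v (D.x P))
    (h.one_le_v_x_two (add_self_ne_zero_of_odd_nsmul hm hu hu0) h1)
    fun P hP hPu => hPu.trans (h.v_x_two_of_one_le hP hPu)
  exact (h1.trans_lt h.b8).not_ge (one_le_pow_of_one_le' h2 _)

lemma v_x_pow_four_ne : v (D.x u) ^ 4 ≠ v D.b8 := by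
  intro h1
  have hP := add_self_ne_zero_of_odd_nsmul hm hu hu0
  have h2 := h.lt_v_x_sq hm (nsmul_add_self_eq_zero hu) hP
  have h0 := h.v_x_le_one hm hu hu0
  have h3 := congrArg v (D.dup' hP)
  rw [map_mul, h.v_psi h0 (h.lt_v_x_sq hm hu hu0)] at h3
  have h4 : v (D.phi (D.x u)) ≤ v D.b8 := by
    rw [h.phi_eq]
    refine v.map_sub_le (by rw [map_pow, h1]) (v.map_add_le ?_ le_rfl)
    rw [mul_right_comm, map_mul, map_mul]
    exact mul_le_of_le_one_left' (mul_le_one' h.eight.le h0)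
  rw [← h3] at h4
  have h5 : v D.b8 * (v (D.x u) ^ 4) < v D.b8 * v D.b8 := by
    calc v D.b8 * (v (D.x u) ^ 4) < v (D.x (u + u)) ^ 2 * (v (D.x u) ^ 4) := by
          gcongr
          rw [h1]
          exact h.v_pos
      _ = (v (D.x u) ^ 2 * v (D.x (u + u))) * (v (D.x u) ^ 2 * v (D.x (u + u))) := by ring
      _ ≤ _ := mul_le_mul' h4 h4
  rw [h1] at h5
  exact lt_irrefl _ h5

lemma v_x_two : ∃ (a e : ℤ), e ^ 2 = 4 ∧ v (D.x (u + u)) = v D.b8 ^ a * v (D.x u) ^ e := by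
  have hP := add_self_ne_zero_of_odd_nsmul hm hu hu0
  rcases lt_or_gt_of_ne (h.v_x_pow_four_ne hm hu hu0) with h1 | h1
  · have h2 := h.lt_v_x_sq hm hu hu0
    refine ⟨1, -2, by norm_num, ?_⟩
    have h3 := h.v_x_two_of_gt hP h2 h1
    rw [zpow_one, zpow_neg, ← div_eq_mul_inv, eq_div_iff]
    · exact_mod_cast h3
    · exact_mod_cast (h.v_pos.trans h2).ne'
  · refine ⟨0, 2, by norm_num, ?_⟩
    rw [h.v_x_two_of_lt hP (h.v_x_le_one hm hu hu0) h1, zpow_zero, one_mul]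
    norm_cast

omit hu hu0 in
lemma exists_zpow (j : ℕ) : ∀ u : G, m • u = 0 → u ≠ 0 → 2 ^ j • u ≠ 0 ∧
    ∃ (a e : ℤ), e ^ 2 = 4 ^ j ∧ v (D.x (2 ^ j • u)) = v D.b8 ^ a * v (D.x u) ^ e := by
  induction j with
  | zero => exact fun u _ hu0 => ⟨by simpa, 0, 1, by simp, by simp⟩
  | succ j ih =>
    intro u hu hu0
    obtain ⟨a, e, he, hae⟩ := h.v_x_two hm hu hu0
    obtain ⟨hne, a', e', he', hae'⟩ := ih (u + u) (nsmul_add_self_eq_zero hu)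
      (add_self_ne_zero_of_odd_nsmul hm hu hu0)
    have h1 : 2 ^ j • (u + u) = 2 ^ (j + 1) • u := by rw [pow_succ, mul_nsmul', two_nsmul]
    rw [h1] at hne hae'
    refine ⟨hne, a' + a * e', e * e', by rw [mul_pow, he, he', pow_succ]; ring, ?_⟩
    rw [hae', hae, mul_zpow, ← zpow_mul, ← zpow_mul, zpow_add₀ h.v_pos.ne', mul_assoc]

end IsTate

end KummerModel

namespace KummerModel

variable {G K : Type*} [AddCommGroup G] [Field K] {D : KummerModel G K}
  {v : Valuation K ℝ≥0}

lemma IsTate.exists_pow_eq (h : D.IsTate v) {m : ℕ} (hm : Odd m) :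
    ∃ N : ℕ, Odd N ∧ ∀ u : G, m • u = 0 → u ≠ 0 → ∃ s : ℤ, v (D.x u) ^ N = v D.b8 ^ s := by
  set k := m.totient with hk
  have hk0 : 0 < k := Nat.totient_pos.2 hm.pos
  have h4 : 1 ≤ 4 ^ k := Nat.one_le_pow _ _ (by norm_num)
  refine ⟨4 ^ k - 1, ?_, fun u hu hu0 => ?_⟩
  · exact Nat.Even.sub_odd h4 ((by decide : Even 4).pow_of_ne_zero hk0.ne') odd_one
  have hku : 2 ^ k • u = u := by
    have h1 : 2 ^ m.totient ≡ 1 [MOD m] := Nat.ModEq.pow_totient (Nat.coprime_two_left.2 hm)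
    conv_rhs => rw [← one_nsmul u]
    exact nsmul_eq_nsmul_iff_modEq.2 (h1.of_dvd (addOrderOf_dvd_of_nsmul_eq_zero hu))
  obtain ⟨-, a, e, he, hae⟩ := h.exists_zpow hm k u hu hu0
  have hx : v (D.x u) ≠ 0 := by
    intro h0
    have := h.lt_v_x_sq hm hu hu0
    rw [h0] at this
    simp at this
  rw [hku] at hae
  refine ⟨-(a * (1 + e)), ?_⟩
  have h1 : v (D.x u) ^ (1 - e) = v D.b8 ^ a := by
    rw [zpow_sub₀ hx, zpow_one, div_eq_iff (zpow_ne_zero _ hx)]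
    exact hae
  rw [← mul_neg, zpow_mul, ← h1, ← zpow_mul, ← zpow_natCast, Nat.cast_sub h4]
  congr 1
  push_cast
  linear_combination -he

lemma _root_.Finset.prod_zpow_eq_zpow_sum₀ {ι M : Type*} [CommGroupWithZero M] {a : M}
    (ha : a ≠ 0) (s : Finset ι) (f : ι → ℤ) : ∏ i ∈ s, a ^ f i = a ^ ∑ i ∈ s, f i := by
  classical
  induction s using Finset.induction with
  | empty => simp
  | insert i s hi ih => rw [Finset.prod_insert hi, Finset.sum_insert hi, zpow_add₀ ha, ih]

lemma IsCM.not_isTate [IsAlgClosed K] {Γ : G →+ G} {n : ℕ} {τ : K}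
    (h : D.IsCM Γ (2 ^ n) 2 τ) (two : (2 : K) ≠ 0) (hτ : v τ ≤ 1) :
    ¬ D.IsTate v := by
  intro ht
  obtain ⟨T₁, hT₁, hTT₁⟩ := h.two_torsion
  obtain ⟨T₂, hb⟩ := D.exists_isTwoBasis two hT₁ hTT₁
  obtain ⟨C, hC, hcard⟩ := h.mult_two_sub
  have hfix (T : G) (hT : T + T = 0) : (2 • Γ - AddMonoidHom.id G) T = T := by
    rw [AddMonoidHom.sub_apply, AddMonoidHom.id_apply, AddMonoidHom.smul_apply, two_nsmul,
      ← map_add, hT, map_zero, zero_sub, neg_eq_of_add_eq_zero_left hT]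
  have hprod := congrArg v (hb.prod_psi two hC (hfix _ hb.add₁) (hfix _ hb.add₂))
  have hg : v (2 * τ - 1) = 1 := by
    rw [v.map_sub_eq_of_lt_right, map_one]
    rw [map_one, map_mul]
    exact mul_lt_one_of_lt_of_le ht.two hτ
  obtain ⟨m, hm⟩ : ∃ m, m + 1 = 4 * 2 ^ n := ⟨4 * 2 ^ n - 1, by have := Nat.two_pow_pos n; omega⟩
  have hmodd : Odd m := by
    rw [Nat.odd_iff]
    omega
  have hCm (u : G) (hu : u ∈ C) : m • u = 0 := by
    have h1 := ((hC.mem u).1 hu).2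
    have h2 : Γ u + Γ u = u := by
      rw [AddMonoidHom.sub_apply, AddMonoidHom.id_apply, AddMonoidHom.smul_apply, two_nsmul,
        sub_eq_zero] at h1
      exact h1
    have h3 : Γ (Γ u) + Γ (Γ u) = Γ u := by rw [← map_add, h2]
    have h4 : (4 * 2 ^ n) • u = u := by
      have h5 : 2 ^ n • u = Γ u - Γ (Γ u) := by rw [h.sq u]; abel
      rw [mul_nsmul', h5]
      calc 4 • (Γ u - Γ (Γ u)) = 2 • ((Γ u + Γ u) - (Γ (Γ u) + Γ (Γ u))) := by abel
        _ = (u + u) - (Γ u + Γ u) := by rw [h3]; nth_rewrite 1 [h2]; abel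
        _ = u := by rw [h2, add_sub_cancel_right]
    rw [← hm, add_nsmul, one_nsmul, add_eq_right] at h4
    exact h4
  obtain ⟨N, hN, hs⟩ := ht.exists_pow_eq hmodd
  have hs' (u : G) : ∃ s : ℤ, u ∈ C → v (D.x u) ^ N = v D.b8 ^ s := by
    by_cases hu : u ∈ C
    · exact (hs u (hCm u hu) ((hC.mem u).1 hu).1).imp fun s hs _ => hs
    · exact ⟨0, fun h => absurd h hu⟩
  choose s hs using hs'
  rw [map_mul, map_pow, hg, one_pow, one_mul, map_prod, map_pow, ht.v_Δ] at hprod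
  have h1 : (∏ u ∈ C, v (D.psi (D.x u) ^ 2)) ^ N = v D.b8 ^ (4 * ∑ u ∈ C, s u) := by
    rw [← Finset.prod_pow, mul_comm, zpow_mul, ← Finset.prod_zpow_eq_zpow_sum₀ ht.v_pos.ne',
      ← Finset.prod_zpow]
    refine Finset.prod_congr rfl fun u hu => ?_
    have hu0 := ((hC.mem u).1 hu).1
    rw [← hs u hu, map_pow, ht.v_psi (ht.v_x_le_one hmodd (hCm u hu) hu0)
      (ht.lt_v_x_sq hmodd (hCm u hu) hu0)]
    norm_cast
    ring
  rw [hprod, ← pow_mul, ← zpow_natCast] at h1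
  have h2 := zpow_right_injective₀ ht.v_pos ht.b8.ne h1
  have h3 : (4 : ℤ) ∣ ((C.card * N : ℕ) : ℤ) := ⟨_, h2⟩
  have h4 : 4 ∣ C.card * N := by exact_mod_cast h3
  have h5 : 4 ∣ C.card := (Nat.Coprime.pow_left 2 (Nat.coprime_two_left.2 hN) : Nat.Coprime 4 N).dvd_of_dvd_mul_right h4
  omega

end KummerModel

lemma Valuation.exists_root_unit {K : Type*} [Field K] [IsAlgClosed K] {v : Valuation K ℝ≥0}
    {ε : K} (two : (2 : K) ≠ 0) (hε : v ε < 1) :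
    ∃ z, z ^ 2 = z - ε ∧ v z < 1 ∧ v (1 - z) = 1 := by
  obtain ⟨d, hd⟩ := IsAlgClosed.exists_pow_nat_eq (1 - 4 * ε) (n := 2) (by norm_num)
  have key (z : K) (hz : z ^ 2 = z - ε) : v z < 1 ∨ v (1 - z) < 1 := by
    by_contra! h
    have h1 : v z * v (1 - z) < 1 := by
      rw [← map_mul, show z * (1 - z) = ε by linear_combination -hz]
      exact hε
    exact h1.not_ge (one_le_mul h.1 h.2)
  have hz : ((1 + d) / 2) ^ 2 = (1 + d) / 2 - ε := by
    field_simp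
    linear_combination hd
  rcases key _ hz with h | h
  · exact ⟨_, hz, h, v.map_one_sub_of_lt h⟩
  · refine ⟨1 - (1 + d) / 2, by linear_combination hz, h, ?_⟩
    exact v.map_one_sub_of_lt h

namespace KummerModel

variable {G K : Type*} [AddCommGroup G] [Field K] {D : KummerModel G K}
  {v : Valuation K ℝ≥0}

lemma exists_affine_b8_eq_zero [IsAlgClosed K] (D : KummerModel G K) (three : (3 : K) ≠ 0) :
    ∃ (r s : K) (hs : s ≠ 0), (D.affine r s hs).b6 = 1 ∧ (D.affine r s hs).b8 = 0 := by
  obtain ⟨r, hr⟩ : ∃ r : K, D.b8 + 3 * r * D.b6 + 3 * r ^ 2 * D.b4 + r ^ 3 * D.b2 + 3 * r ^ 4 = 0 := by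
    open Polynomial in
    obtain ⟨r, hr⟩ := IsAlgClosed.exists_root (C 3 * X ^ 4 + C D.b2 * X ^ 3 +
        C (3 * D.b4) * X ^ 2 + C (3 * D.b6) * X + C D.b8 : K[X]) (by
      have : (C 3 * X ^ 4 + C D.b2 * X ^ 3 +
        C (3 * D.b4) * X ^ 2 + C (3 * D.b6) * X + C D.b8 : K[X]).natDegree = 4 := by
        compute_degree!
      exact degree_ne_of_natDegree_ne (n := 0) (by rw [this]; norm_num))
    refine ⟨r, ?_⟩
    simp only [IsRoot.def, eval_add, eval_mul, eval_C, eval_pow, eval_X] at hr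
    linear_combination hr
  set E := D.affine r 1 one_ne_zero with hE
  have h8 : E.b8 = 0 := by
    rw [hE]
    simp only [affine, hr, zero_div]
  have h6 : E.b6 ≠ 0 := fun h6 => E.Δ_ne (by
    have := E.rel
    rw [h6, h8] at this
    have h4 : E.b4 = 0 := by
      rw [← sq_eq_zero_iff]
      linear_combination this
    rw [Δ, h4, h6, h8]
    ring)
  obtain ⟨s, hs⟩ := IsAlgClosed.exists_pow_nat_eq E.b6 (n := 3) (by norm_num)
  have hs0 : s ≠ 0 := by
    rintro rfl
    exact h6 (by rw [← hs]; ring)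
  refine ⟨r, s, hs0, ?_, ?_⟩
  · show _ / s ^ 3 = 1
    rw [hs, div_eq_one_iff_eq h6, hE]
    simp [affine]
  · simp only [affine, hr, zero_div]

lemma exists_isTate [IsAlgClosed K] (D : KummerModel G K) (h6 : D.b6 = 1) (h8 : D.b8 = 0)
    (two : (2 : K) ≠ 0) (hv2 : v 2 < 1) (hD : ¬ D.IsGood v) :
    ∃ (r s : K) (hs : s ≠ 0), (D.affine r s hs).IsTate v := by
  set t := D.b4 with ht
  have hb2 : D.b2 = t ^ 2 := by
    have := D.rel
    rw [h6, h8] at this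
    linear_combination -this
  have hΔ : D.Δ = t ^ 3 - 27 := by
    rw [Δ, hb2, h6, h8]
    ring
  have three : v 3 = 1 := by
    rw [show (3 : K) = 1 + 2 by norm_num, v.map_one_add_of_lt hv2]
  have h27 : v 27 = 1 := by
    rw [show (27 : K) = 3 ^ 3 by norm_num, map_pow, three, one_pow]
  have hbad : 1 < v t ∨ v t = 1 ∧ v (t ^ 3 - 27) < 1 := by
    by_contra! hh
    refine hD ⟨?_, hh.1, ?_, ?_, ?_⟩
    · rw [hb2]
      exact pow_mem (show t ∈ v.integer from hh.1) 2
    · rw [h6]; exact one_mem _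
    · rw [h8]; exact zero_mem _
    · rw [hΔ]
      rcases hh.1.lt_or_eq with h1 | h1
      · rw [v.map_sub_eq_of_lt_right, h27]
        rw [h27, map_pow]
        exact pow_lt_one₀ zero_le h1 (by norm_num)
      · refine le_antisymm (v.map_sub_le ?_ h27.le) (hh.2 h1)
        rw [map_pow, h1, one_pow]
  have ht1 : 1 ≤ v t := hbad.elim (fun h => h.le) fun h => h.1.ge
  have ht0 : t ≠ 0 := by
    rintro h0
    rw [h0, map_zero] at ht1
    exact ht1.not_gt zero_lt_one
  have ht3 : (v t ^ 3)⁻¹ ≤ 1 := inv_le_one_of_one_le₀ (one_le_pow_of_one_le' ht1 _)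
  obtain ⟨w, hw, hw1, hw2⟩ := v.exists_root_unit (ε := 6 / t ^ 3) two (by
    rw [show (6 : K) / t ^ 3 = 2 * (3 * (t ^ 3)⁻¹) by field_simp; norm_num]
    refine v.mul_lt_one_of_mem hv2 (mul_mem three.le ?_)
    rw [Valuation.mem_integer_iff, map_inv₀, map_pow]
    exact ht3)
  obtain ⟨z, hz⟩ : ∃ z, z = 1 - w := ⟨_, rfl⟩
  have hz2 : t ^ 3 * (z - z ^ 2) = 6 := by
    rw [hz, show (1 - w) - (1 - w) ^ 2 = 6 / t ^ 3 by linear_combination -hw]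
    field_simp
  rw [← hz] at hw2
  have hz0 : z ≠ 0 := Valuation.ne_zero_of_eq_one hw2
  set r := -1 / (t * z) with hr
  set c := (9 / (t ^ 3 * z) - 1) / (t ^ 3 * z ^ 3) with hc
  set s := t ^ 2 + 12 * r with hs
  have hvr : v r ≤ 1 := by
    rw [hr, map_div₀, Valuation.map_neg, map_one, map_mul, hw2, mul_one, one_div]
    exact inv_le_one_of_one_le₀ ht1
  have hvs : v s = v t ^ 2 := by
    rw [hs, v.map_add_eq_of_lt_left, map_pow]
    rw [map_pow]
    refine (v.mul_lt_one_of_mem ?_ hvr).trans_le (one_le_pow_of_one_le' ht1 _)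
    rw [show (12 : K) = 2 * (2 * 3) by norm_num]
    exact v.mul_lt_one_of_mem hv2 (mul_mem hv2.le three.le)
  have hs0 : s ≠ 0 := by
    rw [← v.ne_zero_iff, hvs]
    exact pow_ne_zero _ (v.ne_zero_iff.2 ht0)
  have hvc : v c < v s ^ 3 := by
    have h1 : v c = v (9 / (t ^ 3 * z) - 1) * (v t ^ 3)⁻¹ := by
      rw [hc, map_div₀, map_mul, map_pow, map_pow, hw2, one_pow, mul_one, div_eq_mul_inv]
    have h9 : v 9 = 1 := by
      rw [show (9 : K) = 3 ^ 2 by norm_num, map_pow, three, one_pow]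
    have h2 : v (9 / (t ^ 3 * z)) ≤ 1 := by
      rw [map_div₀, map_mul, map_pow, hw2, h9, mul_one, one_div]
      exact ht3
    have h3 : v (9 / (t ^ 3 * z) - 1) ≤ 1 := v.map_sub_le h2 (by rw [map_one])
    rw [h1, hvs]
    rcases hbad with h | ⟨h4, h5⟩
    · calc _ ≤ (1 : ℝ≥0) := mul_le_one' h3 ht3
        _ < _ := one_lt_pow₀ (one_lt_pow₀ h (by norm_num)) (by norm_num)
    · rw [h4]
      have : 9 / (t ^ 3 * z) - 1 = (w * t ^ 3 - (t ^ 3 - 27) + 2 * (-9)) / (t ^ 3 * z) := by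
        rw [eq_div_iff (mul_ne_zero (pow_ne_zero _ ht0) hz0), sub_mul,
          div_mul_cancel₀ _ (mul_ne_zero (pow_ne_zero _ ht0) hz0), hz]
        ring
      rw [this, map_div₀, map_mul, map_pow, h4, hw2]
      simp only [one_pow, mul_one, inv_one, div_one]
      refine v.map_add_lt (v.map_sub_lt ?_ h5) ?_
      · rw [map_mul, map_pow, h4, one_pow, mul_one]; exact hw1
      · rw [map_mul, Valuation.map_neg, h9, mul_one]; exact hv2
  have k4 : t + r * t ^ 2 + 6 * r ^ 2 = 0 := by
    rw [hr]
    field_simp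
    linear_combination -hz2
  have k6 : 1 + 2 * r * t + r ^ 2 * t ^ 2 + 4 * r ^ 3 = 4 * c := by
    rw [hr, hc]
    field_simp
    linear_combination (t ^ 3 * (z - z ^ 2) + 6) * hz2
  have k8 : 3 * r + 3 * r ^ 2 * t + r ^ 3 * t ^ 2 + 3 * r ^ 4 = s * c := by
    have four : (4 : K) ≠ 0 := by
      rw [show (4 : K) = 2 * 2 by norm_num]; exact mul_ne_zero two two
    refine mul_left_cancel₀ four ?_
    rw [mul_left_comm, ← k6, hs]
    linear_combination -(t + r * t ^ 2 + 6 * r ^ 2) * k4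
  refine ⟨r, s, hs0, ?_, ?_, ?_, ?_, hv2⟩
  · show (_ + _) / _ = _
    rw [hb2, ← hs, div_self hs0]
  · show (t + r * D.b2 + _) / _ = _
    rw [hb2, k4, zero_div]
  · show (D.b6 + 2 * r * t + r ^ 2 * D.b2 + _) / _ =
      4 * ((D.b8 + 3 * r * D.b6 + 3 * r ^ 2 * t + r ^ 3 * D.b2 + 3 * r ^ 4) / s ^ 4)
    rw [h6, h8, hb2, k6, zero_add, mul_one, k8]
    field_simp
  · show v ((D.b8 + 3 * r * D.b6 + 3 * r ^ 2 * t + r ^ 3 * D.b2 + 3 * r ^ 4) / s ^ 4) < 1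
    rw [h6, h8, hb2, zero_add, mul_one, k8, pow_succ', mul_div_mul_left _ _ hs0, map_div₀, map_pow]
    exact (div_lt_one₀ (pow_pos (v.pos_iff.2 hs0) _)).2 hvc

end KummerModel

namespace KummerModel

variable {G K : Type*} [AddCommGroup G] [Field K] {D : KummerModel G K}
  {v : Valuation K ℝ≥0}

/-- A model with complex multiplication has potentially good reduction. -/
theorem IsCM.exists_isGood [IsAlgClosed K] [CharZero K] {Γ : G →+ G} {p n : ℕ} {τ : K}
    (h : D.IsCM Γ (p ^ n) p τ) (hp : p.Prime) (hvp : v p < 1) (hτ : v τ ≤ 1) :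
    ∃ D' : KummerModel G K, D'.IsCM Γ (p ^ n) p τ ∧ D'.IsGood v := by
  rcases hp.eq_two_or_odd' with rfl | hodd
  · rw [Nat.cast_two] at hvp
    by_contra! hno
    obtain ⟨r, s, hs, h6, h8⟩ := D.exists_affine_b8_eq_zero three_ne_zero
    have h1 := h.affine r s hs
    obtain ⟨r', s', hs', h2⟩ := exists_isTate _ h6 h8 two_ne_zero hvp (hno _ h1)
    exact (h1.affine r' s' hs').not_isTate two_ne_zero hτ h2
  · have two : v 2 = 1 := by
      obtain ⟨j, hj⟩ := hodd
      have i2 : v 2 ≤ 1 := ofNat_mem v.integer 2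
      refine i2.antisymm (not_lt.1 fun h2 => hvp.ne ?_)
      rw [hj]
      push_cast
      rw [v.map_add_eq_of_lt_right, map_one]
      rw [map_one]
      exact v.mul_lt_one_of_mem h2 (natCast_mem v.integer j)
    obtain ⟨r, s, hs, hgood⟩ := h.exists_isGood_of_odd hodd.pow two
    exact ⟨_, h.affine r s hs, hgood⟩

end KummerModel

lemma Nat.card_eq_ncard_pair {α : Type*} (f : α → α) (hf : ∀ a b, b = a ∨ b = f a) (a : α) :
    Nat.card α = ({a, f a} : Set α).ncard := by
  rw [← Set.ncard_univ]
  congr 1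
  ext b
  simpa using hf a b

/-- Two sets that consist of at most one orbit of an involution have the same size if they are
simultaneously empty and the involutions are simultaneously trivial. -/
lemma Nat.card_eq_of_orbit {α β : Type*} (f : α → α) (g : β → β) (h : Nonempty α ↔ Nonempty β)
    (hf : ∀ a b, b = a ∨ b = f a) (hg : ∀ a b, b = a ∨ b = g a) (hfg : ∀ a b, f a = a ↔ g b = b) :
    Nat.card α = Nat.card β := by
  cases isEmpty_or_nonempty α with
  | inl h' =>
    have : IsEmpty β := by rwa [← not_nonempty_iff, ← h, not_nonempty_iff]
    simp
  | inr h' =>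
    obtain ⟨a⟩ := h'
    obtain ⟨b⟩ := h.1 ⟨a⟩
    rw [Nat.card_eq_ncard_pair f hf a, Nat.card_eq_ncard_pair g hg b]
    by_cases h0 : f a = a
    · rw [h0, (hfg a b).1 h0]; simp
    · rw [Set.ncard_pair (Ne.symm h0), Set.ncard_pair fun h => h0 ((hfg a b).2 h.symm)]

lemma FiniteField.exists_map_eq_of_pow_card_eq {k K : Type*} [Field k] [Fintype k] [Field K]
    (i : k →+* K) {z : K} (hz : z ^ Fintype.card k = z) : ∃ a, i a = z := by
  classical
  have h0 : (Polynomial.X ^ Fintype.card k - Polynomial.X : Polynomial K) ≠ 0 :=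
    FiniteField.X_pow_card_sub_X_ne_zero K Fintype.one_lt_card
  have hsub : Finset.univ.image i ⊆
      (Polynomial.X ^ Fintype.card k - Polynomial.X : Polynomial K).roots.toFinset := by
    intro y hy
    obtain ⟨a, -, rfl⟩ := Finset.mem_image.1 hy
    rw [Multiset.mem_toFinset, Polynomial.mem_roots h0]
    simp [← map_pow, FiniteField.pow_card]
  have heq := Finset.eq_of_subset_of_card_le hsub (by
    rw [Finset.card_image_of_injective _ i.injective, Finset.card_univ]
    refine (Multiset.toFinset_card_le _).trans ((Polynomial.card_roots' _).trans ?_)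
    rw [FiniteField.X_pow_card_sub_X_natDegree_eq K Fintype.one_lt_card])
  have hz' : z ∈ Finset.univ.image i := by
    rw [heq, Multiset.mem_toFinset, Polynomial.mem_roots h0]
    simp [hz]
  obtain ⟨a, -, h⟩ := Finset.mem_image.1 hz'
  exact ⟨a, h⟩

namespace KummerModel

variable {G κ k : Type*} [AddCommGroup G] [Field κ] [Field k] [Fintype k] {D : KummerModel G κ}
  {Γ : G →+ G}

/-- A curve whose rational points lie over the same `x`-coordinates as the fixed points of the
Frobenius endomorphism has as many points as there are fixed points. -/
theorem IsFrob.card_point (h : D.IsFrob Γ (Fintype.card k)) (i : k →+* κ) (W : WeierstrassCurve k)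
    [W.IsElliptic] {r : k} (hr : r ≠ 0)
    (h₁ : ∀ x, (∃ P, P ≠ 0 ∧ Γ P = P ∧ D.x P = i x) ↔ ∃ y, W.toAffine.Equation (r * x) y)
    (h₂ : ∀ x y P, P ≠ 0 → Γ P = P → D.x P = i x → W.toAffine.Equation (r * x) y →
      (P + P = 0 ↔ W.toAffine.negY (r * x) y = y)) :
    Nat.card W.toAffine.Point = Fintype.card k := by
  have hfin : Finite {P // Γ P = P} := Nat.finite_of_card_ne_zero (by
    rw [h.card]; exact Fintype.card_ne_zero)
  have hfib (x : k) : Finite {P // P ≠ 0 ∧ Γ P = P ∧ D.x P = i x} :=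
    Finite.of_injective (β := {P // Γ P = P}) (fun P => ⟨P.1, P.2.2.1⟩) fun P S h => by
      rw [Subtype.mk.injEq] at h
      exact Subtype.ext h
  have e₁ : {P // Γ P = P} ≃ Option (Σ x : k, {P // P ≠ 0 ∧ Γ P = P ∧ D.x P = i x}) :=
    (Equiv.ofBijective (fun o => match o with
      | none => ⟨0, map_zero Γ⟩
      | some ⟨_, P⟩ => ⟨P.1, P.2.2.1⟩) (by
        constructor
        · rintro (_ | ⟨x, P, h1, h2, h3⟩) (_ | ⟨x', P', h1', h2', h3'⟩) heq
          · rfl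
          · exact absurd (Subtype.mk.inj heq).symm h1'
          · exact absurd (Subtype.mk.inj heq) h1
          · obtain rfl : P = P' := Subtype.mk.inj heq
            obtain rfl : x = x' := i.injective (h3.symm.trans h3')
            rfl
        · rintro ⟨P, hP⟩
          by_cases h0 : P = 0
          · exact ⟨none, by simp [h0]⟩
          · obtain ⟨a, ha⟩ := FiniteField.exists_map_eq_of_pow_card_eq i
              (z := D.x P) (by rw [← h.x_map P h0, hP])
            exact ⟨some ⟨a, P, h0, hP, ha.symm⟩, rfl⟩)).symm
  have e₂ : W.toAffine.Point ≃ Option (Σ x : k, {y // W.toAffine.Equation (r * x) y}) :=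
    (Equiv.ofBijective (fun o => match o with
      | none => .zero
      | some ⟨x, y⟩ => .some (r * x) y.1 (W.toAffine.equation_iff_nonsingular.1 y.2)) (by
        constructor
        · rintro (_ | ⟨x, y, h1⟩) (_ | ⟨x', y', h1'⟩) heq
          · rfl
          · cases heq
          · cases heq
          · obtain ⟨h1, h2⟩ := WeierstrassCurve.Affine.Point.some.inj heq
            obtain rfl : x = x' := mul_left_cancel₀ hr h1
            obtain rfl : y = y' := h2
            rfl
        · rintro (_ | ⟨x, y, hxy⟩)
          · exact ⟨none, rfl⟩
          · obtain ⟨x, rfl⟩ : ∃ z, x = r * z := ⟨x / r, by field_simp⟩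
            exact ⟨some ⟨x, y, W.toAffine.equation_iff_nonsingular.2 hxy⟩, rfl⟩)).symm
  have hcard := h.card
  rw [Nat.card_congr e₁, Finite.card_option, Nat.card_sigma] at hcard
  rw [Nat.card_congr e₂, Finite.card_option, Nat.card_sigma, ← hcard]
  congr 1
  refine Finset.sum_congr rfl fun x _ => ?_
  refine Nat.card_eq_of_orbit
    (fun y => ⟨W.toAffine.negY (r * x) y.1, (W.toAffine.equation_neg _ _).2 y.2⟩)
    (fun P => ⟨-P.1, neg_ne_zero.2 P.2.1, by rw [map_neg, P.2.2.1], by rw [x_neg, P.2.2.2]⟩)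
    ?_ ?_ ?_ ?_
  · rw [nonempty_subtype, nonempty_subtype, h₁]
  · rintro ⟨a, ha⟩ ⟨b, hb⟩
    rw [Subtype.mk.injEq, Subtype.mk.injEq]
    exact WeierstrassCurve.Affine.Y_eq_of_X_eq hb ha rfl
  · rintro ⟨P, h0, h1, h2⟩ ⟨S, h0', h1', h2'⟩
    rw [Subtype.mk.injEq, Subtype.mk.injEq]
    exact (D.x_eq S P h0' h0).1 (h2'.trans h2.symm)
  · rintro ⟨y, hy⟩ ⟨P, h0, h1, h2⟩
    rw [Subtype.mk.injEq, Subtype.mk.injEq, ← h₂ x y P h0 h1 h2 hy, neg_eq_iff_add_eq_zero]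

end KummerModel

namespace KummerModel

variable {G κ : Type*} [AddCommGroup G] [Field κ] {D : KummerModel G κ} {Γ : G →+ G} {p n : ℕ}

lemma IsFrob.map_ne_zero {q : ℕ} (h : D.IsFrob Γ q) {P : G} (hP : P ≠ 0) : Γ P ≠ 0 := fun h0 =>
  hP (h.inj (by rw [h0, map_zero]))

lemma exists_points (D : KummerModel G κ) {c d : κ} (hcd : c ≠ d) : ∃ P S, P ≠ 0 ∧ S ≠ 0 ∧
    P + S ≠ 0 ∧ P - S ≠ 0 ∧ D.x P = c ∧ D.x S = d := by
  obtain ⟨P, hP, rfl⟩ := D.surj c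
  obtain ⟨S, hS, rfl⟩ := D.surj d
  refine ⟨P, S, hP, hS, fun h => hcd ?_, fun h => hcd ?_, rfl, rfl⟩
  · rw [(D.x_eq P S hP hS).2 (Or.inr (eq_neg_of_add_eq_zero_left h))]
  · rw [(D.x_eq P S hP hS).2 (Or.inl (sub_eq_zero.1 h))]

variable [Fact p.Prime] [CharP κ p]

/-- The coefficients of a model with a Frobenius endomorphism are fixed by Frobenius. -/
lemma IsFrob.coeff_pow [Infinite κ] (h : D.IsFrob Γ (p ^ n)) :
    D.b2 ^ p ^ n = D.b2 ∧ D.b4 ^ p ^ n = D.b4 ∧ D.b6 ^ p ^ n = D.b6 ∧ D.b8 ^ p ^ n = D.b8 := by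
  have hF (z : κ) : z ^ p ^ n = iterateFrobenius κ p n z := (iterateFrobenius_def p n z).symm
  have hx (P : G) (hP : P ≠ 0) : D.x (Γ P) = iterateFrobenius κ p n (D.x P) := by
    rw [h.x_map P hP, hF]
  simp only [hF]
  set F := iterateFrobenius κ p n
  have hs (c d : κ) (hcd : c ≠ d) :
      (F D.b2 - D.b2) * (F c * F d) + (F D.b4 - D.b4) * (F c + F d) + (F D.b6 - D.b6) = 0 := by
    obtain ⟨P, S, hP, hS, h1, h2, rfl, rfl⟩ := D.exists_points hcd
    have e1 := congrArg F (D.sum_eq P S hP hS h1 h2)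
    have e2 := D.sum_eq (Γ P) (Γ S) (h.map_ne_zero hP) (h.map_ne_zero hS)
      (by rw [← map_add]; exact h.map_ne_zero h1) (by rw [← map_sub]; exact h.map_ne_zero h2)
    rw [← map_add, ← map_sub, hx P hP, hx S hS, hx _ h1, hx _ h2] at e2
    simp only [map_mul, map_add, map_sub, map_pow, map_ofNat] at e1
    linear_combination e2 - e1
  have hp (c d : κ) (hcd : c ≠ d) :
      (F D.b4 - D.b4) * (F c * F d) + (F D.b6 - D.b6) * (F c + F d) + (F D.b8 - D.b8) = 0 := by
    obtain ⟨P, S, hP, hS, h1, h2, rfl, rfl⟩ := D.exists_points hcd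
    have e1 := congrArg F (D.prod_eq P S hP hS h1 h2)
    have e2 := D.prod_eq (Γ P) (Γ S) (h.map_ne_zero hP) (h.map_ne_zero hS)
      (by rw [← map_add]; exact h.map_ne_zero h1) (by rw [← map_sub]; exact h.map_ne_zero h2)
    rw [← map_add, ← map_sub, hx P hP, hx S hS, hx _ h1, hx _ h2] at e2
    simp only [map_mul, map_add, map_sub, map_pow] at e1
    linear_combination e1 - e2
  classical
  obtain ⟨d, hd⟩ := Infinite.exists_notMem_finset ({0, 1} : Finset κ)
  simp only [Finset.mem_insert, Finset.mem_singleton, not_or] at hd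
  have hd1 : F d - 1 ≠ 0 := by
    rw [← map_one F]
    exact sub_ne_zero.2 fun h => hd.2 (F.injective h)
  have hd0 : F d ≠ 0 := by simpa using hd.1
  have e1 := hs 0 1 zero_ne_one
  have e2 := hs 0 d (Ne.symm hd.1)
  have e3 := hs 1 d (Ne.symm hd.2)
  have e4 := hp 0 1 zero_ne_one
  simp only [map_zero, map_one] at e1 e2 e3 e4
  have h4 : F D.b4 - D.b4 = 0 := (mul_eq_zero.1
    (by linear_combination e2 - e1 : (F D.b4 - D.b4) * (F d - 1) = 0)).resolve_right hd1
  have h6 : F D.b6 - D.b6 = 0 := by linear_combination e1 - h4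
  have h2 : F D.b2 - D.b2 = 0 := (mul_eq_zero.1
    (by linear_combination e3 - h6 - (1 + F d) * h4 : (F D.b2 - D.b2) * F d = 0)).resolve_right hd0
  have h8 : F D.b8 - D.b8 = 0 := by linear_combination e4 - h6
  exact ⟨sub_eq_zero.1 h2, sub_eq_zero.1 h4, sub_eq_zero.1 h6, sub_eq_zero.1 h8⟩

lemma IsFrob.affine (h : D.IsFrob Γ (p ^ n)) {r s : κ} (hs : s ≠ 0) (hr' : r ^ p ^ n = r)
    (hs' : s ^ p ^ n = s) : (D.affine r s hs).IsFrob Γ (p ^ n) where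
  inj := h.inj
  x_map P hP := by rw [affine_x, affine_x, div_pow, sub_pow_char_pow, h.x_map P hP, hr', hs']
  card := h.card

/-- The points over a rational `x`-coordinate are fixed or negated by Frobenius. -/
lemma IsFrob.map_eq_or {q : ℕ} (h : D.IsFrob Γ q) {P : G} (hP : P ≠ 0) (hx : D.x P ^ q = D.x P) :
    Γ P = P ∨ Γ P = -P :=
  (D.x_eq _ _ (h.map_ne_zero hP) hP).1 (by rw [h.x_map P hP, hx])

end KummerModel

namespace KummerModel

variable {G κ : Type*} [AddCommGroup G] [Field κ] {D : KummerModel G κ} {Γ : G →+ G} {q : ℕ}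

lemma IsFrob.exists_fixed (h : D.IsFrob Γ q) (hq : 1 < q) : ∃ P, P ≠ 0 ∧ Γ P = P := by
  have : Finite {P // Γ P = P} := Nat.finite_of_card_ne_zero (by rw [h.card]; omega)
  have : Nontrivial {P // Γ P = P} := Finite.one_lt_card_iff_nontrivial.1 (by rwa [h.card])
  obtain ⟨⟨P, hP⟩, h0⟩ := exists_ne (⟨0, map_zero Γ⟩ : {P // Γ P = P})
  exact ⟨P, fun h => h0 (Subtype.ext h), hP⟩

lemma IsFrob.nsmul_eq_zero (h : D.IsFrob Γ q) {P : G} (hP : Γ P = P) : q • P = 0 := by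
  have := card_nsmul_eq_zero' (x := (⟨P, hP⟩ : Γ.eqLocus (AddMonoidHom.id G)))
  rw [show Nat.card (Γ.eqLocus (AddMonoidHom.id G)) = q from h.card] at this
  exact congrArg Subtype.val this

lemma IsFrob.exists_two_torsion (h : D.IsFrob Γ q) (h0 : q ≠ 0) (hq : Even q) :
    ∃ T, T ≠ 0 ∧ Γ T = T ∧ T + T = 0 := by
  have hc : Nat.card (Γ.eqLocus (AddMonoidHom.id G)) = q := h.card
  have : Finite (Γ.eqLocus (AddMonoidHom.id G)) := Nat.finite_of_card_ne_zero (by rwa [hc])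
  obtain ⟨T, hT⟩ := exists_prime_addOrderOf_dvd_card' (G := Γ.eqLocus (AddMonoidHom.id G)) 2
    (by rw [hc]; exact hq.two_dvd)
  refine ⟨T, fun h => ?_, T.2, ?_⟩
  · rw [show T = 0 from Subtype.ext h] at hT
    simp at hT
  · have := addOrderOf_nsmul_eq_zero T
    rw [hT, two_nsmul] at this
    exact congrArg Subtype.val this

lemma sub_ne_zero_of_map_eq_neg {P S : G} (hP : Γ P = -P) (hS : Γ S = S) (hPP : P + P ≠ 0) :
    P - S ≠ 0 := by
  intro h
  rw [sub_eq_zero] at h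
  subst h
  exact hPP (by nth_rw 2 [← hS]; rw [hP, add_neg_cancel])

lemma add_ne_zero_of_map_eq_neg {P S : G} (hP : Γ P = -P) (hS : Γ S = S) (hPP : P + P ≠ 0) :
    P + S ≠ 0 := by
  rw [← sub_neg_eq_add]
  exact sub_ne_zero_of_map_eq_neg hP (by rw [map_neg, hS]) hPP

/-- Frobenius swaps the `x`-coordinates of `P + S` and `P - S` if `P` is negated and `S` fixed. -/
lemma IsFrob.pow_x_add (h : D.IsFrob Γ q) {P S : G} (hP : Γ P = -P) (hS : Γ S = S)
    (hPP : P + P ≠ 0) : D.x (P + S) ^ q = D.x (P - S) := by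
  rw [← h.x_map _ (add_ne_zero_of_map_eq_neg hP hS hPP), map_add, hP, hS, ← D.x_neg]
  congr 1
  abel

lemma IsFrob.pow_x_sub (h : D.IsFrob Γ q) {P S : G} (hP : Γ P = -P) (hS : Γ S = S)
    (hPP : P + P ≠ 0) : D.x (P - S) ^ q = D.x (P + S) := by
  have := h.pow_x_add (S := -S) hP (by rw [map_neg, hS]) hPP
  rwa [← sub_eq_add_neg, sub_neg_eq_add] at this

lemma x_add_ne_x_sub (D : KummerModel G κ) {P S : G} (h₁ : P + S ≠ 0) (h₂ : P - S ≠ 0)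
    (hP : P + P ≠ 0) (hS : S + S ≠ 0) : D.x (P + S) ≠ D.x (P - S) := by
  rw [Ne, D.x_eq _ _ h₁ h₂, not_or]
  refine ⟨fun h => hS ?_, fun h => hP ?_⟩
  · rw [sub_eq_add_neg, add_right_inj] at h
    nth_rw 1 [h]
    exact neg_add_cancel S
  · rw [neg_sub, add_comm, sub_eq_add_neg, add_right_inj] at h
    nth_rw 1 [h]
    exact neg_add_cancel P

lemma sq_x_add_sub (D : KummerModel G κ) {P S : G} (hP : P ≠ 0) (hS : S ≠ 0) (h₁ : P + S ≠ 0)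
    (h₂ : P - S ≠ 0) : ((D.x P - D.x S) ^ 2 * (D.x (P + S) - D.x (P - S))) ^ 2 =
      D.psi (D.x P) * D.psi (D.x S) := by
  rw [← D.sumForm_sq_sub, ← D.sum_eq' hP hS h₁ h₂, ← D.prod_eq' hP hS h₁ h₂]
  ring

end KummerModel

open KummerModel in
/-- In odd characteristic, a model with a Frobenius endomorphism comes from a curve. -/
theorem KummerModel.IsFrob.exists_curve_odd {G κ k : Type*} [AddCommGroup G] [Field κ] [Infinite κ]
    [Field k] [Fintype k] {D : KummerModel G κ} {Γ : G →+ G} {p n : ℕ} [Fact p.Prime] [CharP κ p]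
    (hk : Fintype.card k = p ^ n) (h : D.IsFrob Γ (Fintype.card k)) (i : k →+* κ) (hodd : Odd p) :
    ∃ W : WeierstrassCurve k, W.IsElliptic ∧ Nat.card W.toAffine.Point = Fintype.card k := by
  have h' := h
  rw [hk] at h'
  have two : (2 : κ) ≠ 0 := Ring.two_ne_zero (R := κ) (by
    rw [ringChar.eq κ p]; rintro rfl; exact absurd hodd (by decide))
  have twok : (2 : k) ≠ 0 := fun h0 => two (by rw [← map_ofNat i 2, h0, map_zero])
  have hfix (a : k) : i a ^ Fintype.card k = i a := by rw [← map_pow, FiniteField.pow_card]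
  have hrat {z : κ} (hz : z ^ p ^ n = z) : ∃ a, i a = z :=
    FiniteField.exists_map_eq_of_pow_card_eq i (by rwa [hk])
  obtain ⟨h2, h4, h6, h8⟩ := h'.coeff_pow
  obtain ⟨b2, hb2⟩ := hrat h2
  obtain ⟨b4, hb4⟩ := hrat h4
  obtain ⟨b6, hb6⟩ := hrat h6
  obtain ⟨b8, hb8⟩ := hrat h8
  have hψ (x : k) : i (4 * x ^ 3 + b2 * x ^ 2 + 2 * b4 * x + b6) = D.psi (i x) := by
    simp only [psi, map_add, map_mul, map_pow, map_ofNat, hb2, hb4, hb6]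
  obtain ⟨S, hS, hΓS⟩ := h.exists_fixed Fintype.one_lt_card
  have hSS : S + S ≠ 0 := by
    intro h0
    obtain ⟨m, hm⟩ := hodd.pow (n := n)
    have := h'.nsmul_eq_zero hΓS
    rw [hm, add_nsmul, mul_comm, mul_nsmul', two_nsmul, h0, nsmul_zero, zero_add, one_nsmul] at this
    exact hS this
  obtain ⟨x₀, hx₀⟩ := hrat (z := D.x S) (by rw [← h'.x_map S hS, hΓS])
  obtain ⟨c, hc⟩ : ∃ c, c = 4 * x₀ ^ 3 + b2 * x₀ ^ 2 + 2 * b4 * x₀ + b6 := ⟨_, rfl⟩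
  have hic : i c = D.psi (D.x S) := by rw [hc, hψ, hx₀]
  have hc0 : c ≠ 0 := by
    rintro rfl
    exact hSS ((D.psi_eq_zero_iff hS).1 (by rw [← hic, map_zero]))
  have hr : 4 * c ≠ 0 := mul_ne_zero (by
    rw [show (4 : k) = 2 * 2 by norm_num]; exact mul_ne_zero twok twok) hc0
  let W : WeierstrassCurve k := ⟨0, c * b2, 0, 8 * c ^ 2 * b4, 16 * c ^ 3 * b6⟩
  have hW (x y : k) : W.toAffine.Equation (4 * c * x) y ↔
      y ^ 2 = 16 * c ^ 3 * (4 * x ^ 3 + b2 * x ^ 2 + 2 * b4 * x + b6) := by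
    rw [WeierstrassCurve.Affine.equation_iff]
    simp only [W]
    constructor <;> intro h <;> linear_combination h
  have hΔ : W.Δ ≠ 0 := by
    have : i W.Δ = (4 * i c) ^ 6 * D.Δ := by
      have := D.rel
      simp only [WeierstrassCurve.Δ, WeierstrassCurve.b₂, WeierstrassCurve.b₄, WeierstrassCurve.b₆,
        WeierstrassCurve.b₈, W, Δ, map_add, map_mul, map_neg, map_sub, map_pow, map_ofNat, map_zero,
        hb2, hb4, hb6]
      linear_combination 1024 * i c ^ 6 * D.b2 ^ 2 * this
    intro h0
    rw [h0, map_zero] at this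
    refine mul_ne_zero (pow_ne_zero 6 ?_) D.Δ_ne this.symm
    rw [← map_ofNat i 4, ← map_mul]
    exact (_root_.map_ne_zero i).2 hr
  have : W.IsElliptic := ⟨isUnit_iff_ne_zero.2 hΔ⟩
  refine ⟨W, this, h.card_point i W hr (fun x => ⟨?_, ?_⟩) ?_⟩
  · rintro ⟨P, hP, hΓP, hx⟩
    by_cases hPS : D.x P = D.x S
    · obtain rfl : x = x₀ := i.injective (by rw [← hx, hPS, hx₀])
      exact ⟨4 * c ^ 2, (hW _ _).2 (by rw [← hc]; ring)⟩
    · have h1 : P + S ≠ 0 := fun h =>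
        hPS ((D.x_eq P S hP hS).2 (Or.inr (eq_neg_of_add_eq_zero_left h)))
      have h2 : P - S ≠ 0 := fun h => hPS ((D.x_eq P S hP hS).2 (Or.inl (sub_eq_zero.1 h)))
      obtain ⟨u, hu⟩ := hrat (z := D.x (P + S)) (by rw [← h'.x_map _ h1, map_add, hΓP, hΓS])
      obtain ⟨w, hw⟩ := hrat (z := D.x (P - S)) (by rw [← h'.x_map _ h2, map_sub, hΓP, hΓS])
      have key := D.sq_x_add_sub hP hS h1 h2
      rw [← hic, hx, ← hψ, ← hx₀, ← hu, ← hw] at key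
      have key' : ((x - x₀) ^ 2 * (u - w)) ^ 2 =
          (4 * x ^ 3 + b2 * x ^ 2 + 2 * b4 * x + b6) * c := i.injective (by simpa using key)
      exact ⟨4 * c * ((x - x₀) ^ 2 * (u - w)), (hW _ _).2 (by
        linear_combination 16 * c ^ 2 * key')⟩
  · rintro ⟨y, hy⟩
    obtain ⟨P, hP, hx⟩ := D.surj (i x)
    refine ⟨P, hP, ?_, hx⟩
    rcases h.map_eq_or hP (by rw [hx, hfix]) with hΓP | hΓP
    · exact hΓP
    by_cases hPP : P + P = 0
    · rw [hΓP, ← eq_neg_of_add_eq_zero_left hPP]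
    exfalso
    have h1 := add_ne_zero_of_map_eq_neg hΓP hΓS hPP
    have h2 := sub_ne_zero_of_map_eq_neg hΓP hΓS hPP
    have key := D.sq_x_add_sub hP hS h1 h2
    obtain ⟨E, hE⟩ : ∃ E, E = (D.x P - D.x S) ^ 2 * (D.x (P + S) - D.x (P - S)) := ⟨_, rfl⟩
    have hE0 : E ≠ 0 := by
      rw [hE]
      exact mul_ne_zero (pow_ne_zero _ (sub_ne_zero.2 (D.x_ne hP hS h1 h2)))
        (sub_ne_zero.2 (D.x_add_ne_x_sub h1 h2 hPP hSS))
    have hEq : E ^ p ^ n = -E := by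
      rw [hE, mul_pow, ← pow_mul, mul_comm 2, pow_mul, sub_pow_char_pow, sub_pow_char_pow,
        h'.pow_x_add hΓP hΓS hPP, h'.pow_x_sub hΓP hΓS hPP, ← h'.x_map P hP, ← h'.x_map S hS, hΓP,
        hΓS, x_neg]
      ring
    have hEy : E ^ 2 = i (y / (4 * c)) ^ 2 := by
      rw [hE, key, ← hic, hx, ← hψ, ← map_mul, ← map_pow]
      congr 1
      rw [div_pow, (hW x y).1 hy, eq_div_iff (pow_ne_zero _ hr)]
      ring
    have hE' : E ^ p ^ n = E := by
      obtain ⟨e, rfl⟩ : ∃ e, i e = E := by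
        rcases sq_eq_sq_iff_eq_or_eq_neg.1 hEy with h | h
        · exact ⟨_, h.symm⟩
        · exact ⟨_, (map_neg i _).trans h.symm⟩
      rw [← hk, hfix]
    refine mul_ne_zero two hE0 ?_
    linear_combination hEq - hE'
  · intro x y P hP hΓP hx hy
    rw [← D.psi_eq_zero_iff hP, hx, ← hψ, map_eq_zero]
    rw [hW] at hy
    rw [WeierstrassCurve.Affine.negY, show -y - W.a₁ * (4 * c * x) - W.a₃ = -y by simp [W],
      neg_eq_iff_add_eq_zero, ← two_mul, mul_eq_zero_iff_left twok, ← pow_eq_zero_iff (a := y) two_ne_zero,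
      hy, mul_eq_zero_iff_left]
    rw [show 16 * c ^ 3 = (4 * c) ^ 2 * c by ring]
    exact mul_ne_zero (pow_ne_zero _ hr) hc0

namespace KummerModel

variable {G κ k : Type*} [AddCommGroup G] [Field κ] [Field k] [Fintype k] {D : KummerModel G κ}
  {Γ : G →+ G} {n : ℕ}

/-- In characteristic two, the addition law in Artin–Schreier form. -/
lemma artinSchreier_eq (D : KummerModel G κ) (two : (2 : κ) = 0) (h2 : D.b2 = 1) (h4 : D.b4 = 0)
    (h6 : D.b6 = 0) {P S : G} (hP : P ≠ 0) (hS : S ≠ 0) (h₁ : P + S ≠ 0) (h₂ : P - S ≠ 0)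
    (hxP : D.x P ≠ 0) (hxS : D.x S ≠ 0) :
    ((D.x P + D.x S) ^ 2 * D.x (P + S) / (D.x P * D.x S) + D.x P + D.x S) ^ 2 +
      ((D.x P + D.x S) ^ 2 * D.x (P + S) / (D.x P * D.x S) + D.x P + D.x S) =
      D.x P + D.b8 / D.x P ^ 2 + (D.x S + D.b8 / D.x S ^ 2) := by
  have e1 := D.sum_eq P S hP hS h₁ h₂
  have e2 := D.prod_eq P S hP hS h₁ h₂
  rw [h2, h4, h6] at e1
  rw [h4, h6] at e2
  generalize D.x P = X at *
  generalize D.x S = Y at *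
  generalize D.x (P + S) = m at *
  generalize D.x (P - S) = l at *
  have e0 : (X + Y) ^ 2 * m ^ 2 + X * Y * m + (X * Y) ^ 2 + D.b8 = 0 := by
    linear_combination m * e1 - e2 +
      two * (2 * X * Y * m ^ 2 + m * X * Y * (X + Y) + X * Y * m + D.b8)
  linear_combination (norm := (field_simp; ring)) (X + Y) ^ 2 / (X * Y) ^ 2 * e0 +
    two * ((X + Y) ^ 2 * m / (X * Y) * (X + Y) - D.b8 * (X ^ 2 + Y ^ 2 + X * Y) / (X * Y) ^ 2)

variable [CharP κ 2]

/-- A criterion for a curve in characteristic two to have the right number of points. -/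
lemma IsFrob.card_point_two (h : D.IsFrob Γ (Fintype.card k)) (i : k →+* κ) (h2 : D.b2 = 1)
    (h4 : D.b4 = 0) (h6 : D.b6 = 0) {a : k} (ha : i a = D.b8) (c : k)
    (hc : ∀ x, x ≠ 0 → ((∃ P, P ≠ 0 ∧ Γ P = P ∧ D.x P = i x) ↔
      ∃ z, z ^ 2 + z = x + a / x ^ 2 + c)) :
    ∃ W : WeierstrassCurve k, W.IsElliptic ∧ Nat.card W.toAffine.Point = Fintype.card k := by
  have two : (2 : κ) = 0 := CharTwo.two_eq_zero
  have twok : (2 : k) = 0 := i.injective (by rw [map_ofNat, two, map_zero])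
  have : CharP k 2 := (i.charP_iff i.injective 2).2 ‹_›
  have hpsi {P : G} (hP : P ≠ 0) : P + P = 0 ↔ D.x P = 0 := by
    rw [← D.psi_eq_zero_iff hP, psi, h2, h4, h6, show 4 * D.x P ^ 3 + 1 * D.x P ^ 2 +
      2 * 0 * D.x P + 0 = D.x P ^ 2 by linear_combination 2 * D.x P ^ 3 * two,
      pow_eq_zero_iff two_ne_zero]
  have ha0 : a ≠ 0 := by
    rintro rfl
    refine D.disc ?_
    rw [← ha, h4, h6, map_zero]
    ring
  let W : WeierstrassCurve k := ⟨1, c, 0, 0, a⟩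
  have hW (x y : k) : W.toAffine.Equation (1 * x) y ↔ y ^ 2 + x * y = x ^ 3 + c * x ^ 2 + a := by
    rw [WeierstrassCurve.Affine.equation_iff]
    simp [W]
  have hΔ : W.Δ ≠ 0 := by
    have : W.Δ = -a := by
      simp only [WeierstrassCurve.Δ, WeierstrassCurve.b₂, WeierstrassCurve.b₄, WeierstrassCurve.b₆,
        WeierstrassCurve.b₈, W]
      linear_combination twok * (-a * (6 * c + 24 * c ^ 2 + 32 * c ^ 3) - 216 * a ^ 2)
    rw [this]
    exact neg_ne_zero.2 ha0
  have : W.IsElliptic := ⟨isUnit_iff_ne_zero.2 hΔ⟩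
  refine ⟨W, this, h.card_point i W one_ne_zero (fun x => ?_) fun x y P hP hΓP hx hy => ?_⟩
  · by_cases hx : x = 0
    · subst hx
      refine iff_of_true ?_ ?_
      · obtain ⟨T, hT, hxT⟩ := D.surj 0
        have hTT := (hpsi hT).2 hxT
        refine ⟨T, hT, ?_, by rw [hxT, map_zero]⟩
        rcases h.map_eq_or hT (by rw [hxT, zero_pow Fintype.card_ne_zero]) with h | h
        · exact h
        · rw [h, ← eq_neg_of_add_eq_zero_left hTT]
      · obtain ⟨y, hy⟩ := FiniteField.isSquare_of_char_two (ringChar.eq k 2) a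
        exact ⟨y, (hW _ _).2 (by rw [hy]; ring)⟩
    · rw [hc x hx]
      constructor
      · rintro ⟨z, hz⟩
        refine ⟨x * z, (hW _ _).2 ?_⟩
        linear_combination (norm := (field_simp; ring)) x ^ 2 * hz
      · rintro ⟨y, hy⟩
        refine ⟨y / x, ?_⟩
        rw [hW] at hy
        linear_combination (norm := (field_simp; ring)) hy / x ^ 2
  · rw [hpsi hP, hx, _root_.map_eq_zero, WeierstrassCurve.Affine.negY]
    simp only [W]
    constructor
    · rintro rfl
      linear_combination -y * twok
    · intro h
      linear_combination -h - y * twok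

end KummerModel

namespace KummerModel

variable {G κ k : Type*} [AddCommGroup G] [Field κ] [Field k] [Fintype k] {D : KummerModel G κ}
  {Γ : G →+ G} {n : ℕ} [CharP κ 2]

lemma IsFrob.exists_curve_of_b2_eq_one [Infinite κ] (hk : Fintype.card k = 2 ^ n)
    (h : D.IsFrob Γ (Fintype.card k)) (i : k →+* κ) (h2 : D.b2 = 1) (h4 : D.b4 = 0)
    (h6 : D.b6 = 0) :
    ∃ W : WeierstrassCurve k, W.IsElliptic ∧ Nat.card W.toAffine.Point = Fintype.card k := by
  have : Fact (Nat.Prime 2) := ⟨Nat.prime_two⟩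
  have two : (2 : κ) = 0 := CharTwo.two_eq_zero
  have twok : (2 : k) = 0 := i.injective (by rw [map_ofNat, two, map_zero])
  have h' := h
  rw [hk] at h'
  have hrat {z : κ} (hz : z ^ Fintype.card k = z) : ∃ a, i a = z :=
    FiniteField.exists_map_eq_of_pow_card_eq i hz
  have hfix (a : k) : i a ^ Fintype.card k = i a := by rw [← map_pow, FiniteField.pow_card]
  obtain ⟨a, ha⟩ := hrat (z := D.b8) (by rw [hk]; exact h'.coeff_pow.2.2.2)
  have hpsi {P : G} (hP : P ≠ 0) : P + P = 0 ↔ D.x P = 0 := by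
    rw [← D.psi_eq_zero_iff hP, psi, h2, h4, h6, show 4 * D.x P ^ 3 + 1 * D.x P ^ 2 +
      2 * 0 * D.x P + 0 = D.x P ^ 2 by linear_combination 2 * D.x P ^ 3 * two,
      pow_eq_zero_iff two_ne_zero]
  by_cases hex : ∃ S, S ≠ 0 ∧ Γ S = S ∧ S + S ≠ 0
  · obtain ⟨S, hS, hΓS, hSS⟩ := hex
    obtain ⟨y, hy⟩ := hrat (z := D.x S) (by rw [← h.x_map S hS, hΓS])
    have hxS : D.x S ≠ 0 := fun h => hSS ((hpsi hS).2 h)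
    have hy0 : y ≠ 0 := by rintro rfl; exact hxS (by rw [← hy, map_zero])
    refine h.card_point_two i h2 h4 h6 ha (y + a / y ^ 2) fun x hx0 => ⟨?_, ?_⟩
    · rintro ⟨P, hP, hΓP, hx⟩
      have hxP : D.x P ≠ 0 := by rw [hx]; exact (_root_.map_ne_zero i).2 hx0
      by_cases hPS : D.x P = D.x S
      · obtain rfl : x = y := i.injective (by rw [← hx, hPS, hy])
        exact ⟨0, by linear_combination -(x + a / x ^ 2) * twok⟩
      · have h1 : P + S ≠ 0 := fun h =>
          hPS ((D.x_eq P S hP hS).2 (Or.inr (eq_neg_of_add_eq_zero_left h)))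
        have h2' : P - S ≠ 0 := fun h => hPS ((D.x_eq P S hP hS).2 (Or.inl (sub_eq_zero.1 h)))
        obtain ⟨u, hu⟩ := hrat (z := D.x (P + S)) (by rw [← h.x_map _ h1, map_add, hΓP, hΓS])
        have key := D.artinSchreier_eq two h2 h4 h6 hP hS h1 h2' hxP hxS
        rw [hx, ← hy, ← hu, ← ha] at key
        exact ⟨(x + y) ^ 2 * u / (x * y) + x + y, i.injective (by simpa using key)⟩
    · rintro ⟨z, hz⟩
      obtain ⟨P, hP, hx⟩ := D.surj (i x)
      have hxP : D.x P ≠ 0 := by rw [hx]; exact (_root_.map_ne_zero i).2 hx0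
      refine ⟨P, hP, ?_, hx⟩
      refine (h.map_eq_or hP (by rw [hx, hfix])).resolve_right fun hΓP => ?_
      have hPP : P + P ≠ 0 := fun h => hxP ((hpsi hP).1 h)
      have h1 := add_ne_zero_of_map_eq_neg hΓP hΓS hPP
      have h2' := sub_ne_zero_of_map_eq_neg hΓP hΓS hPP
      have key := D.artinSchreier_eq two h2 h4 h6 hP hS h1 h2' hxP hxS
      obtain ⟨Z, hZ⟩ : ∃ Z, Z = (D.x P + D.x S) ^ 2 * D.x (P + S) / (D.x P * D.x S) + D.x P +
        D.x S := ⟨_, rfl⟩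
      rw [← hZ] at key
      have hz' : i z ^ 2 + i z = Z ^ 2 + Z := by
        rw [key, hx, ← hy, ← ha]
        simpa using congrArg i hz
      obtain ⟨e, rfl⟩ : ∃ e, i e = Z := by
        have : (Z - i z) * (Z - i (-1 - z)) = 0 := by
          rw [map_sub, map_neg, map_one]
          linear_combination -hz'
        rcases mul_eq_zero.1 this with h | h
        · exact ⟨_, (sub_eq_zero.1 h).symm⟩
        · exact ⟨_, (sub_eq_zero.1 h).symm⟩
      have hne : D.x P + D.x S ≠ 0 := by
        intro h0
        exact D.x_ne hP hS h1 h2' (by linear_combination h0 - D.x S * two)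
      have hxe : D.x (P + S) = i ((e - x - y) * (x * y) / (x + y) ^ 2) := by
        simp only [map_div₀, map_mul, map_sub, map_pow, map_add, hZ, ← hx, hy]
        field_simp
        ring
      refine D.x_add_ne_x_sub h1 h2' hPP hSS ?_
      rw [← h.pow_x_add hΓP hΓS hPP, hxe, hfix]
  · push Not at hex
    obtain ⟨T, hT, hΓT⟩ := h.exists_fixed Fintype.one_lt_card
    have hxT := (hpsi hT).1 (hex T hT hΓT)
    have hcard : Fintype.card k = 2 := by
      rw [← h.card, Nat.card_eq_two_iff]
      refine ⟨⟨0, map_zero Γ⟩, ⟨T, hΓT⟩, fun h => hT (congrArg Subtype.val h).symm, ?_⟩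
      rw [Set.eq_univ_iff_forall]
      rintro ⟨P, hΓP⟩
      rw [Set.mem_insert_iff, Set.mem_singleton_iff, Subtype.mk.injEq, Subtype.mk.injEq]
      by_cases hP : P = 0
      · exact Or.inl hP
      · refine Or.inr ?_
        rcases (D.x_eq P T hP hT).1 (by rw [hxT, (hpsi hP).1 (hex P hP hΓP)]) with h | h
        · exact h
        · rw [h, ← eq_neg_of_add_eq_zero_left (hex T hT hΓT)]
    have hk2 (z : k) (hz : z ≠ 0) : z = 1 := by
      have := FiniteField.pow_card z
      rw [hcard, sq] at this
      exact mul_right_cancel₀ hz (by rw [this, one_mul])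
    have ha0 : a ≠ 0 := by
      rintro rfl
      refine D.disc ?_
      rw [← ha, h4, h6, map_zero]
      ring
    refine h.card_point_two i h2 h4 h6 ha 1 fun x hx0 => iff_of_false ?_ ?_
    · rintro ⟨P, hP, hΓP, hx⟩
      exact (_root_.map_ne_zero i).2 hx0 (by rw [← hx, ← hpsi hP, hex P hP hΓP])
    · rintro ⟨z, hz⟩
      have := FiniteField.pow_card z
      rw [hcard] at this
      rw [hk2 x hx0, hk2 a ha0, this] at hz
      refine one_ne_zero (α := k) ?_
      linear_combination (z - 1) * twok - hz

/-- In characteristic two, a model with a Frobenius endomorphism comes from a curve. -/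
theorem IsFrob.exists_curve_two [Infinite κ] (hk : Fintype.card k = 2 ^ n) (hn : n ≠ 0)
    (h : D.IsFrob Γ (Fintype.card k)) (i : k →+* κ) :
    ∃ W : WeierstrassCurve k, W.IsElliptic ∧ Nat.card W.toAffine.Point = Fintype.card k := by
  have : Fact (Nat.Prime 2) := ⟨Nat.prime_two⟩
  have two : (2 : κ) = 0 := CharTwo.two_eq_zero
  have h' := h
  rw [hk] at h'
  obtain ⟨h2, h4, -, -⟩ := h'.coeff_pow
  have rel := D.rel
  have hb2 : D.b2 ≠ 0 := by
    intro h0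
    obtain ⟨T, hT, hΓT, hTT⟩ := h'.exists_two_torsion (pow_ne_zero _ two_ne_zero)
      ((Nat.even_pow).2 ⟨even_two, hn⟩)
    have e := D.two_tors T hT hTT
    have h6 : D.b6 = 0 := by
      rw [h0] at e
      linear_combination e - two * (2 * D.x T ^ 3 + D.b4 * D.x T)
    have h4 : D.b4 = 0 := by
      rw [← pow_eq_zero_iff two_ne_zero]
      rw [h0] at rel
      linear_combination rel - two * 2 * D.b8
    refine D.disc ?_
    rw [h0, h4, h6]
    ring
  have hF := h'.affine (r := D.b4 / D.b2) hb2 (by rw [div_pow, h2, h4]) h2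
  have e2 : (D.affine (D.b4 / D.b2) D.b2 hb2).b2 = 1 := by
    simp only [KummerModel.affine]
    linear_combination (norm := (field_simp; ring)) two * (6 * D.b4 / D.b2 ^ 2)
  have e4 : (D.affine (D.b4 / D.b2) D.b2 hb2).b4 = 0 := by
    simp only [KummerModel.affine]
    linear_combination (norm := (field_simp; ring)) two * (D.b4 + 3 * (D.b4 / D.b2) ^ 2) / D.b2 ^ 2
  have e6 := (D.affine (D.b4 / D.b2) D.b2 hb2).rel
  rw [e2, e4] at e6
  rw [← hk] at hF
  exact hF.exists_curve_of_b2_eq_one hk i e2 e4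
    (by linear_combination -e6 + two * 2 * (D.affine (D.b4 / D.b2) D.b2 hb2).b8)

end KummerModel

/-- The residue field of a valuation on an algebraically closed field is algebraically closed. -/
theorem Valuation.exists_residue {K : Type u} [Field K] [IsAlgClosed K] (v : Valuation K ℝ≥0) :
    ∃ (κ : Type u) (_ : Field κ) (_ : IsAlgClosed κ) (red : v.integer →+* κ),
      Function.Surjective red ∧ ∀ a, red a = 0 ↔ v a < 1 := by
  let res : v.integer →+* IsLocalRing.ResidueField v.valuationSubring :=
    (IsLocalRing.residue v.valuationSubring).comp
      (Subring.inclusion (T := v.valuationSubring.toSubring) fun _ h => h)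
  have hsurj : Function.Surjective res := fun y => by
    obtain ⟨a, rfl⟩ := IsLocalRing.residue_surjective y
    exact ⟨⟨a.1, a.2⟩, rfl⟩
  refine ⟨_, inferInstance, ?_, res, hsurj, fun a => ?_⟩
  · refine IsAlgClosed.of_exists_root _ fun f hf hirr => ?_
    obtain ⟨g, hg, hdeg, hmon⟩ := Polynomial.lifts_and_natDegree_eq_and_monic
      (Polynomial.mem_lifts f |>.2 (Polynomial.map_surjective res hsurj f)) hf
    obtain ⟨z, hz⟩ := IsAlgClosed.exists_root (g.map (algebraMap v.integer K)) (by
      refine Polynomial.degree_ne_of_natDegree_ne (n := 0) ?_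
      rw [hmon.natDegree_map, hdeg]
      exact hirr.natDegree_pos.ne')
    have hz' : v z ≤ 1 := (Valuation.integer.integers v).mem_of_integral
      ⟨g, hmon, by rwa [Polynomial.IsRoot, Polynomial.eval_map] at hz⟩
    refine ⟨res ⟨z, hz'⟩, ?_⟩
    rw [← hg, Polynomial.eval_map, Polynomial.eval₂_at_apply]
    have : g.eval ⟨z, hz'⟩ = 0 := by
      apply Subtype.val_injective
      have h1 : (algebraMap v.integer K) (g.eval ⟨z, hz'⟩) = 0 := by
        rw [← Polynomial.eval₂_at_apply, ← Polynomial.eval_map]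
        exact hz
      exact h1
    rw [this, map_zero]
  · rw [RingHom.comp_apply, IsLocalRing.residue_eq_zero_iff, Valuation.mem_maximalIdeal_iff]
    rfl

lemma Padic.mk_le_continuum (p : ℕ) [Fact p.Prime] : Cardinal.mk ℚ_[p] ≤ Cardinal.continuum := by
  have h1 : Cardinal.mk ℚ_[p] ≤ Cardinal.mk (CauSeq ℚ (padicNorm p)) := Cardinal.mk_quotient_le
  refine (h1.trans (Cardinal.mk_subtype_le _)).trans ?_
  simp

lemma PadicAlgCl.mk_eq_continuum (p : ℕ) [Fact p.Prime] :
    Cardinal.mk (PadicAlgCl p) = Cardinal.continuum := by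
  apply le_antisymm
  · refine (Algebra.IsAlgebraic.cardinalMk_le_max ℚ_[p] (PadicAlgCl p)).trans ?_
    exact max_le (Padic.mk_le_continuum p) Cardinal.aleph0_le_continuum
  · exact (continuum_le_cardinal_of_nontriviallyNormedField ℚ_[p]).trans
      (Cardinal.mk_le_of_injective (algebraMap ℚ_[p] (PadicAlgCl p)).injective)

/-- There is a `p`-adic valuation on the complex numbers. -/
theorem Complex.exists_valuation {p : ℕ} (hp : p.Prime) : ∃ v : Valuation ℂ ℝ≥0, v p < 1 := by
  have : Fact p.Prime := ⟨hp⟩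
  obtain ⟨e⟩ := IsAlgClosed.ringEquiv_of_equiv_of_charZero (K := ℂ) (L := PadicAlgCl p)
    (by rw [Cardinal.mk_complex]; exact Cardinal.aleph0_lt_continuum)
    (Cardinal.eq.1 (by rw [Cardinal.mk_complex, PadicAlgCl.mk_eq_continuum]))
  refine ⟨(Valued.v : Valuation (PadicAlgCl p) ℝ≥0).comap (e : ℂ →+* PadicAlgCl p), ?_⟩
  rw [Valuation.comap_apply, map_natCast, PadicAlgCl.valuation_p]
  rw [one_div]
  exact inv_lt_one_of_one_lt₀ (by exact_mod_cast hp.one_lt)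

/-- Over a finite field `k` there is an elliptic curve with as many points as `k` has elements. -/
theorem WeierstrassCurve.exists_card_point_eq_card (k : Type*) [Field k] [Fintype k] {p : ℕ}
    (hp : p.Prime) [CharP k p] : ∃ E : WeierstrassCurve k, E.IsElliptic ∧
      Nat.card E.toAffine.Point = Fintype.card k := by
  have : Fact p.Prime := ⟨hp⟩
  obtain ⟨n, -, hk⟩ := FiniteField.card k p
  have hn : (n : ℕ) ≠ 0 := n.ne_zero
  generalize (n : ℕ) = n at hk hn
  obtain ⟨v, hv⟩ := Complex.exists_valuation hp
  have hvq : v ((p ^ n : ℕ) : ℂ) < 1 := by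
    rw [Nat.cast_pow, map_pow]
    exact pow_lt_one₀ zero_le hv hn
  obtain ⟨τ, hτ, hvτ, -⟩ := Valuation.exists_root_unit two_ne_zero hvq
  obtain ⟨D, Γ, hD⟩ := PeriodPair.exists_isCM (pow_pos hp.pos n) hτ hp.pos
  obtain ⟨D', hD', hgood⟩ := hD.exists_isGood hp hv hvτ.le
  obtain ⟨κ, _, _, red, hsurj, hker⟩ := v.exists_residue
  have hp0 : (p : κ) = 0 := by
    rw [← map_natCast red, hker]
    simpa using hv
  have : CharP κ p := (CharP.charP_iff_prime_eq_zero hp).2 hp0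
  obtain ⟨D₁, Γ₁, hF⟩ := hD'.exists_isFrob hp hn hgood hv hvτ red hsurj hker
  replace hF : D₁.IsFrob Γ₁ (Fintype.card k) := by rw [hk]; exact hF
  have : Infinite κ := IsAlgClosed.instInfinite
  let _ : Algebra (ZMod p) k := ZMod.algebra k p
  let _ : Algebra (ZMod p) κ := ZMod.algebra κ p
  let i : k →+* κ := (IsAlgClosed.lift : k →ₐ[ZMod p] κ)
  rcases hp.eq_two_or_odd' with rfl | hodd
  · exact hF.exists_curve_two hk hn i
  · exact hF.exists_curve_odd hk i hodd

end Arithmetic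

theorem stmt_15 (k : Type*) [Field k] [Fintype k] (p : ℕ) (hp : p.Prime) [CharP k p] :
    (∃ E : WeierstrassCurve k, E.IsElliptic ∧
      Nat.card E.toAffine.Point = Fintype.card k) ∧
    (∀ E : WeierstrassCurve k, E.IsElliptic →
      Nat.card E.toAffine.Point = Fintype.card k →
      ¬ (p : ℤ) ∣ ((Fintype.card k : ℤ) + 1 - (Nat.card E.toAffine.Point : ℤ))) := by
  refine ⟨WeierstrassCurve.exists_card_point_eq_card k hp, fun E _ h hdvd => ?_⟩
  rw [h, add_sub_cancel_left] at hdvd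
  exact hp.one_lt.not_ge (by exact_mod_cast Int.le_of_dvd one_pos hdvd)
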